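/- Let L be an even indefinite lattice of rank r whose discriminant group A(L) can be generated by at most r − 2 elements. Then L is the unique lattice with its invariants in the following sense: every even lattice L' of rank r with the same signature as L for which there exists a group isomorphism A(L) → A(L') preserving the discriminant quadratic forms is isometric to L. -/

import Mathlib

open Matrix

/-- Componentwise coercion `ℤⁿ → ℚⁿ`. -/
def ratify {n : ℕ} (x : Fin n → ℤ) : Fin n → ℚ := fun i => (x i : ℚ)

/-- The discriminant group `A(L) = L*/L` of the lattice `ℤⁿ` with Gram matrix `G`,
presented as the cokernel `ℤⁿ/G·ℤⁿ` (multiplication by `G` identifies `L*/L` with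
this cokernel when `det G ≠ 0`). -/
def DiscGroup {n : ℕ} (G : Matrix (Fin n) (Fin n) ℤ) :=
  (Fin n → ℤ) ⧸ LinearMap.range (Matrix.mulVecLin G)

instance {n : ℕ} (G : Matrix (Fin n) (Fin n) ℤ) : AddCommGroup (DiscGroup G) :=
  inferInstanceAs (AddCommGroup ((Fin n → ℤ) ⧸ LinearMap.range (Matrix.mulVecLin G)))

instance {n : ℕ} (G : Matrix (Fin n) (Fin n) ℤ) : Module ℤ (DiscGroup G) :=
  inferInstanceAs (Module ℤ ((Fin n → ℤ) ⧸ LinearMap.range (Matrix.mulVecLin G)))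

/-- The class of `u ∈ ℤⁿ` in the discriminant group. -/
def discMk {n : ℕ} (G : Matrix (Fin n) (Fin n) ℤ) (u : Fin n → ℤ) : DiscGroup G :=
  Submodule.Quotient.mk u

/-- The discriminant quadratic form `q_L : A(L) → ℚ/2ℤ` in the cokernel presentation:
the class of `u` (corresponding to `G⁻¹u ∈ L*`) is sent to `uᵀ G⁻¹ u mod 2ℤ`. -/
noncomputable def discQuad {n : ℕ} (G : Matrix (Fin n) (Fin n) ℤ) (u : Fin n → ℤ) :
    AddCircle (2 : ℚ) :=
  ((ratify u ⬝ᵥ ((G.map (Int.cast : ℤ → ℚ))⁻¹).mulVec (ratify u) : ℚ) : AddCircle (2 : ℚ))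

/-- `G` has signature `(p, q)`: over `ℝ` the form is congruent to a diagonal form with
`p` entries `+1` and `q` entries `−1`. -/
def HasSignature {n : ℕ} (G : Matrix (Fin n) (Fin n) ℤ) (p q : ℕ) : Prop :=
  ∃ (P : Matrix (Fin n) (Fin n) ℝ) (d : Fin n → ℝ), IsUnit P.det ∧
    (∀ i, d i = 1 ∨ d i = -1) ∧
    (Finset.univ.filter fun i => d i = 1).card = p ∧
    (Finset.univ.filter fun i => d i = -1).card = q ∧
    P.transpose * (G.map (Int.cast : ℤ → ℝ)) * P = Matrix.diagonal d

open LinearMap (BilinForm)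

/-- The defining relations between the one-dimensional forms `⟨a⟩` in the Witt group of `ℚ`. -/
inductive WittRel : FreeAbelianGroup ℚ → Prop
  | zero : WittRel (.of 0)
  | neg (a : ℚ) : WittRel (.of a + .of (-a))
  | mul_sq (a s : ℚ) : s ≠ 0 → WittRel (.of (a * s ^ 2) - .of a)
  | add (a b : ℚ) : WittRel (.of a + .of b - .of (a + b) - .of (a * b * (a + b)))

/-- The Witt group of `ℚ`, by generators and relations. -/
abbrev WittQ : Type := FreeAbelianGroup ℚ ⧸ AddSubgroup.closure {x | WittRel x}

namespace WittQ

/-- The class of the form `⟨a⟩`. -/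
def of (a : ℚ) : WittQ := QuotientAddGroup.mk (FreeAbelianGroup.of a)

lemma mk_eq_zero {x : FreeAbelianGroup ℚ} (h : WittRel x) : (QuotientAddGroup.mk x : WittQ) = 0 :=
  (QuotientAddGroup.eq_zero_iff x).mpr (AddSubgroup.subset_closure h)

lemma of_zero : of 0 = 0 := mk_eq_zero .zero

lemma of_neg (a : ℚ) : of (-a) = -of a := by
  have : of a + of (-a) = 0 := mk_eq_zero (.neg a)
  exact (neg_eq_of_add_eq_zero_right this).symm

lemma of_mul_sq (a : ℚ) {s : ℚ} (hs : s ≠ 0) : of (a * s ^ 2) = of a := by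
  have : of (a * s ^ 2) - of a = 0 := mk_eq_zero (.mul_sq a s hs)
  exact sub_eq_zero.mp this

lemma of_add (a b : ℚ) : of a + of b = of (a + b) + of (a * b * (a + b)) := by
  have : of a + of b - of (a + b) - of (a * b * (a + b)) = 0 := mk_eq_zero (.add a b)
  rw [sub_sub] at this
  exact sub_eq_zero.mp this

/-- Additive maps out of the Witt group. -/
def lift {A : Type*} [AddCommGroup A] (f : ℚ → A) (h0 : f 0 = 0) (hn : ∀ a, f a + f (-a) = 0)
    (hs : ∀ a s, s ≠ 0 → f (a * s ^ 2) = f a)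
    (ha : ∀ a b, f a + f b = f (a + b) + f (a * b * (a + b))) : WittQ →+ A :=
  QuotientAddGroup.lift _ (FreeAbelianGroup.lift f) (by
    rw [AddSubgroup.closure_le]
    rintro x (_ | a | ⟨a, s, h⟩ | ⟨a, b⟩)
    · simpa using h0
    · simpa using hn a
    · simpa [sub_eq_zero] using hs a s h
    · simpa [sub_eq_zero, sub_sub] using ha a b)

@[simp] lemma lift_of {A : Type*} [AddCommGroup A] (f : ℚ → A) (h0 hn hs ha) (a : ℚ) :
    lift f h0 hn hs ha (of a) = f a := by
  simp [lift, of]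

@[elab_as_elim]
lemma induction {P : WittQ → Prop} (x : WittQ) (h0 : P 0) (ha : ∀ a x, P x → P (of a + x)) :
    P x := by
  induction x using QuotientAddGroup.induction_on with
  | H z =>
    have : ∀ z : FreeAbelianGroup ℚ, ∀ y : WittQ, P y → P (QuotientAddGroup.mk z + y) := by
      intro z
      induction z using FreeAbelianGroup.induction_on with
      | zero => intro y hy; simpa using hy
      | of a => exact fun y hy => ha a y hy
      | neg a _ =>
        intro y hy
        have := ha (-a) y hy
        rwa [of_neg] at this
      | add a b iha ihb =>
        intro y hy
        have := iha _ (ihb y hy)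
        rwa [← add_assoc] at this
    have := this z 0 h0
    rwa [add_zero] at this

/-- The signature. -/
def sig : WittQ →+ ℤ :=
  lift (fun a => (SignType.sign a : ℤ)) (by simp) (fun a => by simp [Left.sign_neg])
    (fun a s hs => by
      rw [sign_mul, sign_pos (by positivity : 0 < s ^ 2), mul_one]) (fun a b => by
      rw [sign_mul, sign_mul]
      rcases lt_trichotomy a 0 with ha | rfl | ha
      · rcases lt_trichotomy b 0 with hb | rfl | hb
        · simp [ha, hb, add_neg ha hb]
        · simp
        · rcases lt_trichotomy (a + b) 0 with h | h | h <;> simp [ha, hb, h]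
      · simp
      · rcases lt_trichotomy b 0 with hb | rfl | hb
        · rcases lt_trichotomy (a + b) 0 with h | h | h <;> simp [ha, hb, h]
        · simp
        · simp [ha, hb, add_pos ha hb])

@[simp] lemma sig_of (a : ℚ) : sig (of a) = (SignType.sign a : ℤ) := by simp [sig]

/-- The parity of the valuation of the discriminant at a prime. -/
def parity (p : ℕ) [Fact p.Prime] : WittQ →+ ZMod 2 :=
  lift (fun a => (padicValRat p a : ZMod 2)) (by simp) (fun a => by
      rw [padicValRat.neg, ← two_mul]; exact by simp [show (2 : ZMod 2) = 0 from rfl])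
    (fun a s hs => by
      by_cases ha : a = 0
      · simp [ha]
      rw [padicValRat.mul ha (pow_ne_zero 2 hs), sq, padicValRat.mul hs hs]
      push_cast
      rw [← two_mul]
      simp [show (2 : ZMod 2) = 0 from rfl]) (fun a b => by
      have h2 : ∀ x : ZMod 2, x + x = 0 := by decide
      by_cases ha : a = 0
      · simp [ha]
      by_cases hb : b = 0
      · simp [hb]
      by_cases hab : a + b = 0
      · obtain rfl : b = -a := by linarith
        simp [padicValRat.neg, h2]
      rw [padicValRat.mul (mul_ne_zero ha hb) hab, padicValRat.mul ha hb]
      push_cast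
      linear_combination -h2 (padicValRat p (a + b) : ZMod 2))

@[simp] lemma parity_of (p : ℕ) [Fact p.Prime] (a : ℚ) :
    parity p (of a) = (padicValRat p a : ZMod 2) := by simp [parity]

/-- Scaling of forms by a nonzero rational number. -/
def scale (n : ℚ) : WittQ →+ WittQ :=
  if hn : n = 0 then 0 else
  lift (fun a => of (n * a)) (by simp [of_zero]) (fun a => by rw [mul_neg, of_neg, add_neg_cancel])
    (fun a s hs => by rw [← mul_assoc, of_mul_sq _ hs]) (fun a b => by
      rw [of_add, ← of_mul_sq (n * (a * b * (a + b))) hn]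
      ring_nf)

lemma scale_of {n : ℚ} (hn : n ≠ 0) (a : ℚ) : scale n (of a) = of (n * a) := by
  simp [scale, hn]

end WittQ

/-- A nonzero integer all of whose prime factors are less than `N`. -/
def IsSmoothInt (N : ℕ) (a : ℤ) : Prop := a ≠ 0 ∧ ∀ q : ℕ, q.Prime → (q : ℤ) ∣ a → q < N

namespace IsSmoothInt

variable {N : ℕ} {a b : ℤ}

lemma mul (ha : IsSmoothInt N a) (hb : IsSmoothInt N b) : IsSmoothInt N (a * b) :=
  ⟨mul_ne_zero ha.1 hb.1, fun q hq h =>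
    ((Nat.prime_iff_prime_int.mp hq).dvd_or_dvd h).elim (ha.2 q hq) (hb.2 q hq)⟩

lemma of_abs_lt (h0 : a ≠ 0) (h : |a| < N) : IsSmoothInt N a :=
  ⟨h0, fun q _ hq => by
    have := Int.le_of_dvd (abs_pos.mpr h0) ((dvd_abs _ _).mpr hq)
    omega⟩

lemma of_mul_left (h : IsSmoothInt N (a * b)) : IsSmoothInt N a :=
  ⟨left_ne_zero_of_mul h.1, fun q hq hd => h.2 q hq (hd.mul_right b)⟩

lemma mono {M : ℕ} (hNM : N ≤ M) (ha : IsSmoothInt N a) : IsSmoothInt M a :=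
  ⟨ha.1, fun q hq h => (ha.2 q hq h).trans_le hNM⟩

lemma not_dvd {p : ℕ} (hp : p.Prime) (ha : IsSmoothInt p a) : ¬ (p : ℤ) ∣ a :=
  fun h => lt_irrefl _ (ha.2 p hp h)

end IsSmoothInt

namespace WittQ

/-- The subgroup of the Witt group generated by smooth integers. -/
def smoothSub (N : ℕ) : AddSubgroup WittQ :=
  AddSubgroup.closure {x | ∃ a : ℤ, IsSmoothInt N a ∧ x = of a}

/-- The subgroup of the Witt group generated by integers prime to `p`. -/
def unitSub (p : ℕ) : AddSubgroup WittQ :=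
  AddSubgroup.closure {x | ∃ a : ℤ, ¬ (p : ℤ) ∣ a ∧ x = of a}

lemma of_mem_smoothSub {N : ℕ} {a : ℤ} (h : IsSmoothInt N a) : of a ∈ smoothSub N :=
  AddSubgroup.subset_closure ⟨a, h, rfl⟩

lemma of_mem_unitSub {p : ℕ} {a : ℤ} (h : ¬ (p : ℤ) ∣ a) : of a ∈ unitSub p :=
  AddSubgroup.subset_closure ⟨a, h, rfl⟩

lemma smoothSub_mono {N M : ℕ} (h : N ≤ M) : smoothSub N ≤ smoothSub M := by
  rw [smoothSub, AddSubgroup.closure_le]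
  rintro x ⟨a, ha, rfl⟩
  exact of_mem_smoothSub (ha.mono h)

lemma smoothSub_le_unitSub {p : ℕ} (hp : p.Prime) : smoothSub p ≤ unitSub p := by
  rw [smoothSub, AddSubgroup.closure_le]
  rintro x ⟨a, ha, rfl⟩
  exact of_mem_unitSub (ha.not_dvd hp)

lemma scale_mem_smoothSub {N : ℕ} {n : ℤ} (hn : IsSmoothInt N n) {x : WittQ}
    (hx : x ∈ smoothSub N) : scale n x ∈ smoothSub N := by
  have : smoothSub N ≤ (smoothSub N).comap (scale n) := by
    rw [smoothSub, AddSubgroup.closure_le]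
    rintro x ⟨a, ha, rfl⟩
    change scale n (of a) ∈ smoothSub N
    rw [scale_of (by exact_mod_cast hn.1)]
    exact_mod_cast of_mem_smoothSub (hn.mul ha)
  exact this hx

lemma of_mul_prime_sub_mem_aux {p : ℕ} (hp : p ≠ 0) (H : AddSubgroup WittQ) {r l m : ℤ}
    (h : m = r + p * l) (hl : of l ∈ H) (hrlm : of (r * l * m : ℤ) ∈ H) :
    of ((p * m : ℤ) : ℚ) - of ((p * r : ℤ) : ℚ) ∈ H := by
  have hp0 : (p : ℚ) ≠ 0 := by exact_mod_cast hp
  have e := of_add (p * r) (l * p ^ 2)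
  rw [of_mul_sq _ hp0] at e
  have e1 : (p * r + l * p ^ 2 : ℚ) = ((p * m : ℤ) : ℚ) := by rw [h]; push_cast; ring
  have e2 : (p * r * (l * p ^ 2) * ((p * m : ℤ) : ℚ) : ℚ) =
      ((r * l * m : ℤ) : ℚ) * (p ^ 2) ^ 2 := by push_cast; ring
  rw [e1, e2, of_mul_sq _ (pow_ne_zero 2 hp0)] at e
  have : of ((p * m : ℤ) : ℚ) - of ((p * r : ℤ) : ℚ) = of l - of (r * l * m : ℤ) := by
    rw [sub_eq_sub_iff_add_eq_add, add_comm (of (l : ℚ)), ← e]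
    push_cast
    rfl
  rw [this]
  exact H.sub_mem hl hrlm

lemma of_mul_prime_sub_mem {p : ℕ} (hp : p.Prime) (k : ℕ) : ∀ {m r : ℤ}, m.natAbs ≤ k →
    IsSmoothInt p m → |r| < p → (p : ℤ) ∣ m - r →
    of ((p * m : ℤ) : ℚ) - of ((p * r : ℤ) : ℚ) ∈ smoothSub p := by
  have hp1 : (1 : ℤ) < p := by exact_mod_cast hp.one_lt
  have step : ∀ {m r l : ℤ}, IsSmoothInt p m → |r| < p → m = r + p * l → |l| < p →
      of ((p * m : ℤ) : ℚ) - of ((p * r : ℤ) : ℚ) ∈ smoothSub p := by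
    intro m r l hm hr h hl
    by_cases hl0 : l = 0
    · rw [h, hl0, mul_zero, add_zero, sub_self]; exact zero_mem _
    have hr0 : r ≠ 0 := by
      rintro rfl
      exact hm.not_dvd hp ⟨l, by rw [h]; ring⟩
    have hl' := IsSmoothInt.of_abs_lt hl0 hl
    exact of_mul_prime_sub_mem_aux hp.ne_zero _ h (of_mem_smoothSub hl')
      (of_mem_smoothSub (((IsSmoothInt.of_abs_lt hr0 hr).mul hl').mul hm))
  induction k with
  | zero => intro m r hk hm; exact absurd (by omega) hm.1
  | succ k ih =>
    intro m r hk hm hr hd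
    by_cases hmp : |m| < p
    · obtain ⟨l, hl⟩ := hd
      refine step hm hr (by linarith) (l := l) ?_
      have : p * |l| < p * 2 := by
        rw [show (p : ℤ) * |l| = |p * l| by rw [abs_mul, Nat.abs_cast], ← hl]
        exact (abs_sub m r).trans_lt (by linarith)
      have := lt_of_mul_lt_mul_left this (by omega)
      omega
    · have hm1 : m.natAbs ≠ 1 := by rw [Int.abs_eq_natAbs] at hmp; omega
      set q := m.natAbs.minFac with hq
      have hqp : q.Prime := Nat.minFac_prime hm1
      obtain ⟨m', hm'⟩ : (q : ℤ) ∣ m := Int.natCast_dvd.mpr (Nat.minFac_dvd _)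
      have hqlt : q < p := hm.2 q hqp ⟨m', hm'⟩
      have hsm : IsSmoothInt p (m' * q) := by rw [mul_comm, ← hm']; exact hm
      have hm's : IsSmoothInt p m' := hsm.of_mul_left
      have hqs : IsSmoothInt p (q : ℤ) := by rw [hm'] at hm; exact hm.of_mul_left
      have hm'k : m'.natAbs ≤ k := by
        have h1 : m.natAbs = q * m'.natAbs := by rw [hm', Int.natAbs_mul, Int.natAbs_natCast]
        have h2 := hqp.two_le
        have h3 : m'.natAbs ≠ 0 := Int.natAbs_ne_zero.mpr hm's.1
        nlinarith [Nat.pos_of_ne_zero h3]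
      set r' := m' % p with hr'
      have hr'0 : 0 ≤ r' := Int.emod_nonneg _ (by omega)
      have hr'p : r' < p := Int.emod_lt_of_pos _ (by omega)
      have hd' : (p : ℤ) ∣ m' - r' := Int.dvd_self_sub_emod
      have hr'ne : r' ≠ 0 := by
        intro h0
        rw [h0, sub_zero] at hd'
        exact hm's.not_dvd hp hd'
      have h1 := ih hm'k hm's (by rw [abs_of_nonneg hr'0]; exact hr'p) hd'
      have h2 := scale_mem_smoothSub hqs h1
      have hq0 : ((q : ℤ) : ℚ) ≠ 0 := by exact_mod_cast hqp.ne_zero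
      rw [map_sub, scale_of hq0, scale_of hq0] at h2
      have hr's : IsSmoothInt p (q * r') :=
        hqs.mul (IsSmoothInt.of_abs_lt hr'ne (by rw [abs_of_nonneg hr'0]; exact hr'p))
      obtain ⟨l, hl⟩ : (p : ℤ) ∣ q * r' - r := by
        have : q * r' - r = (m - r) - q * (m' - r') := by rw [hm']; ring
        rw [this]; exact dvd_sub hd (hd'.mul_left _)
      have h3 := step hr's hr (l := l) (by linarith) (by
        have hb : |(p : ℤ) * l| ≤ (p - 1) * (p - 1) + (p - 1) := by
          rw [← hl]
          refine (abs_sub _ _).trans (add_le_add ?_ (by omega))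
          rw [abs_mul, Nat.abs_cast, abs_of_nonneg hr'0]
          exact mul_le_mul (by omega) (by omega) hr'0 (by omega)
        rw [abs_mul, Nat.abs_cast] at hb
        nlinarith)
      have := AddSubgroup.add_mem _ h2 h3
      rw [hm']
      push_cast at this ⊢
      rw [show (p : ℚ) * (q * m') = q * (p * m') by ring]
      rw [show (p : ℚ) * (q * r') = q * (p * r') by ring] at this
      rwa [sub_add_sub_cancel] at this

end WittQ

/-- The formal properties of a map `a ↦ ⟨a⟩` to a group satisfying the Witt relations of `𝔽_p`. -/
structure IsWittMap {F A : Type*} [Field F] [AddCommGroup A] (f : F → A) : Prop where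
  map_neg : ∀ a, f (-a) = -f a
  map_mul_sq : ∀ a s, s ≠ 0 → f (a * s ^ 2) = f a
  map_add : ∀ a b, f a + f b = f (a + b) + f (a * b * (a + b))

namespace IsWittMap

open Polynomial in
lemma exists_eq_mul_sq_add {F : Type*} [Field F] [Fintype F] (hF : ringChar F ≠ 2) {b c : F}
    (hb : b ≠ 0) (hc : c ≠ 0) (x : F) : ∃ s t, x = b * s ^ 2 + c * t ^ 2 := by
  have hodd : Fintype.card F % 2 = 1 := FiniteField.odd_card_of_char_ne_two hF
  obtain ⟨s, t, h⟩ := FiniteField.exists_root_sum_quadratic (f := C b * X ^ 2)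
    (g := C c * X ^ 2 - C x) (degree_C_mul_X_pow 2 hb)
    (by
      rw [degree_sub_C (by rw [degree_C_mul_X_pow 2 hc]; exact (by decide : (0 : WithBot ℕ) < 2))]
      exact degree_C_mul_X_pow 2 hc) hodd
  refine ⟨s, t, ?_⟩
  simp at h
  linear_combination -h

variable {F A : Type*} [Field F] [Fintype F] [AddCommGroup A] {f : F → A}

lemma add_eq (hf : IsWittMap f) (hF : ringChar F ≠ 2) {b c x : F} (hb : b ≠ 0) (hc : c ≠ 0)
    (hx : x ≠ 0) : f b + f c = f x + f (b * c * x) := by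
  obtain ⟨s, t, h⟩ := exists_eq_mul_sq_add hF hb hc x
  by_cases hs : s = 0
  · have ht : t ≠ 0 := by rintro rfl; simp [hs] at h; exact hx h
    rw [hs] at h
    have hx' : x = c * t ^ 2 := by rw [h]; ring
    rw [hx', hf.map_mul_sq _ _ ht, show b * c * (c * t ^ 2) = b * (c * t) ^ 2 by ring,
      hf.map_mul_sq _ _ (mul_ne_zero hc ht), add_comm]
  by_cases ht : t = 0
  · rw [ht] at h
    have hx' : x = b * s ^ 2 := by rw [h]; ring
    rw [hx', hf.map_mul_sq _ _ hs, show b * c * (b * s ^ 2) = c * (b * s) ^ 2 by ring,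
      hf.map_mul_sq _ _ (mul_ne_zero hb hs)]
  · rw [← hf.map_mul_sq b s hs, ← hf.map_mul_sq c t ht, hf.map_add, ← h,
      show b * s ^ 2 * (c * t ^ 2) * x = b * c * x * (s * t) ^ 2 by ring,
      hf.map_mul_sq _ _ (mul_ne_zero hs ht)]

lemma add_add_add_eq_zero (hf : IsWittMap f) (hF : ringChar F ≠ 2) {a b c d : F} (ha : a ≠ 0)
    (hb : b ≠ 0) (hc : c ≠ 0) (hd : d ≠ 0) (h : IsSquare (a * b * c * d)) :
    f a + f b + f c + f d = 0 := by
  obtain ⟨s, hs⟩ := h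
  have hs0 : s ≠ 0 := by
    rintro rfl
    exact mul_ne_zero (mul_ne_zero (mul_ne_zero ha hb) hc) hd (by rw [hs, mul_zero])
  have e : a * b * c = d * (s / d) ^ 2 := by
    field_simp
    rw [hs]; ring
  rw [hf.add_eq hF ha hb (neg_ne_zero.mpr hc), mul_neg, hf.map_neg, hf.map_neg, e,
    hf.map_mul_sq _ _ (div_ne_zero hs0 hd)]
  abel

/-- Every element of the subgroup generated by the classes of one-dimensional forms has an
anisotropic representative of dimension at most two. -/
lemma mem_closure (hf : IsWittMap f) (h0 : f 0 = 0) (hF : ringChar F ≠ 2) {x : A}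
    (hx : x ∈ AddSubgroup.closure (Set.range f)) :
    x = 0 ∨ (∃ a, a ≠ 0 ∧ x = f a) ∨
      ∃ a b, a ≠ 0 ∧ b ≠ 0 ∧ ¬ IsSquare (-(a * b)) ∧ x = f a + f b := by
  have key : ∀ c y, (y = 0 ∨ (∃ a, a ≠ 0 ∧ y = f a) ∨
      ∃ a b, a ≠ 0 ∧ b ≠ 0 ∧ ¬ IsSquare (-(a * b)) ∧ y = f a + f b) →
      (f c + y = 0 ∨ (∃ a, a ≠ 0 ∧ f c + y = f a) ∨
      ∃ a b, a ≠ 0 ∧ b ≠ 0 ∧ ¬ IsSquare (-(a * b)) ∧ f c + y = f a + f b) := by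
    intro c y hy
    by_cases hc : c = 0
    · rwa [hc, h0, zero_add]
    rcases hy with rfl | ⟨a, ha, rfl⟩ | ⟨a, b, ha, hb, hab, rfl⟩
    · exact Or.inr (Or.inl ⟨c, hc, add_zero _⟩)
    · by_cases hsq : IsSquare (-(c * a))
      · left
        obtain ⟨s, hs⟩ := hsq
        have hs0 : s ≠ 0 := by
          rintro rfl
          exact mul_ne_zero hc ha (by rw [mul_zero] at hs; exact neg_eq_zero.mp hs)
        have : c = -(a * (s / a) ^ 2) := by
          field_simp
          linear_combination -hs
        rw [this, hf.map_neg, hf.map_mul_sq _ _ (div_ne_zero hs0 ha), neg_add_cancel]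
      · exact Or.inr (Or.inr ⟨c, a, hc, ha, hsq, rfl⟩)
    · right; left
      refine ⟨a * b * -c, mul_ne_zero (mul_ne_zero ha hb) (neg_ne_zero.mpr hc), ?_⟩
      rw [hf.add_eq hF ha hb (neg_ne_zero.mpr hc), hf.map_neg c, add_neg_cancel_left]
  induction hx using AddSubgroup.closure_induction_left with
  | zero => exact Or.inl rfl
  | add_left x hx y _ ih => obtain ⟨c, rfl⟩ := hx; exact key c y ih
  | neg_add_cancel x hx y _ ih =>
    obtain ⟨c, rfl⟩ := hx
    rw [← hf.map_neg]
    exact key (-c) y ih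

end IsWittMap

namespace WittQ

/-- The map `a ↦ ⟨p a⟩` on `𝔽_p`, modulo a subgroup. -/
def residue (p : ℕ) (H : AddSubgroup WittQ) (a : ZMod p) : WittQ ⧸ H :=
  QuotientAddGroup.mk (of ((p * (a.val : ℤ) : ℤ) : ℚ))

variable {p : ℕ} [hp : Fact p.Prime] {H : AddSubgroup WittQ}

lemma mk_of_eq_residue (hH : smoothSub p ≤ H) {m : ℤ} (hm : IsSmoothInt p m) :
    (QuotientAddGroup.mk (of ((p * m : ℤ) : ℚ)) : WittQ ⧸ H) = residue p H m := by
  rw [residue, QuotientAddGroup.eq_iff_sub_mem]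
  refine hH (of_mul_prime_sub_mem hp.out _ le_rfl hm ?_ ?_)
  · rw [Nat.abs_cast]; exact_mod_cast ZMod.val_lt _
  · rw [← ZMod.intCast_zmod_eq_zero_iff_dvd]; simp

lemma isSmoothInt_val {a : ZMod p} (ha : a ≠ 0) : IsSmoothInt p (a.val : ℤ) :=
  IsSmoothInt.of_abs_lt (by exact_mod_cast (ZMod.val_ne_zero a).mpr ha)
    (by rw [Nat.abs_cast]; exact_mod_cast ZMod.val_lt _)

lemma residue_zero : residue p H 0 = 0 := by simp [residue, of_zero]

lemma isWittMap_residue (hH : smoothSub p ≤ H) : IsWittMap (residue p H) where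
  map_neg a := by
    by_cases ha : a = 0
    · rw [ha, neg_zero, residue_zero, neg_zero]
    have h := isSmoothInt_val ha
    have hn : IsSmoothInt p (-(a.val : ℤ)) := ⟨neg_ne_zero.mpr h.1, fun q hq hd =>
      h.2 q hq ((dvd_neg).mp hd)⟩
    have e := mk_of_eq_residue hH hn
    have : ((-(a.val : ℤ) : ℤ) : ZMod p) = -a := by simp
    rw [this] at e
    rw [← e, residue, ← QuotientAddGroup.mk_neg, ← of_neg]
    push_cast
    ring_nf
  map_mul_sq a s hs := by
    by_cases ha : a = 0
    · rw [ha, zero_mul]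
    have h := (isSmoothInt_val ha).mul ((isSmoothInt_val hs).mul (isSmoothInt_val hs))
    have e := mk_of_eq_residue hH h
    have : (((a.val : ℤ) * ((s.val : ℤ) * (s.val : ℤ)) : ℤ) : ZMod p) = a * s ^ 2 := by
      simp [sq]
    rw [this] at e
    rw [← e, residue, ← of_mul_sq ((p * (a.val : ℤ) : ℤ) : ℚ)
      (show (s.val : ℚ) ≠ 0 by exact_mod_cast (ZMod.val_ne_zero s).mpr hs)]
    push_cast
    ring_nf
  map_add a b := by
    by_cases ha : a = 0
    · rw [ha, zero_mul, zero_mul, zero_add, add_comm]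
    by_cases hb : b = 0
    · rw [hb, mul_zero, zero_mul, add_zero]
    have hap := ZMod.val_lt a
    have hbp := ZMod.val_lt b
    have hb0 := (ZMod.val_ne_zero b).mpr hb
    have hsa := isSmoothInt_val ha
    obtain ⟨r, hr, hrp, hrb⟩ : ∃ r : ℤ, IsSmoothInt p r ∧ |(a.val : ℤ) + r| < p ∧
        (r : ZMod p) = b := by
      by_cases h : a.val + b.val < p
      · exact ⟨b.val, isSmoothInt_val hb, by rw [abs_of_nonneg (by positivity)]; exact_mod_cast h,
          by simp⟩
      · refine ⟨b.val - p, IsSmoothInt.of_abs_lt (by omega) ?_, ?_, by simp⟩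
        · rw [abs_lt]; omega
        · rw [abs_lt]; omega
    have ea := mk_of_eq_residue hH hsa
    have eb := mk_of_eq_residue hH hr
    rw [hrb] at eb
    rw [Int.cast_natCast, ZMod.natCast_zmod_val] at ea
    rw [← ea, ← eb]
    by_cases h0 : (a.val : ℤ) + r = 0
    · have hr' : r = -(a.val : ℤ) := by omega
      have : a + b = 0 := by rw [← hrb, hr']; simp
      rw [this, mul_zero, residue_zero, hr', ← QuotientAddGroup.mk_add, mul_neg, Int.cast_neg,
        of_neg, add_neg_cancel]
      exact (add_zero (0 : WittQ ⧸ H)).symm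
    · have hs := IsSmoothInt.of_abs_lt h0 hrp
      have es := mk_of_eq_residue hH hs
      have et := mk_of_eq_residue hH ((hsa.mul hr).mul hs)
      push_cast at es et
      rw [hrb, ZMod.natCast_zmod_val] at es et
      rw [← es, ← et, ← QuotientAddGroup.mk_add, ← QuotientAddGroup.mk_add, of_add,
        ← of_mul_sq ((p : ℚ) * (a.val * r * (a.val + r)))
          (show (p : ℚ) ≠ 0 by exact_mod_cast hp.out.ne_zero)]
      push_cast
      ring_nf

end WittQ

namespace WittQ

lemma exists_of_eq {p : ℕ} (hp : p.Prime) {a : ℤ} (ha : a ≠ 0) :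
    ∃ m s : ℤ, ¬ (p : ℤ) ∣ m ∧ s ≠ 0 ∧ (a = m * s ^ 2 ∨ a = p * m * s ^ 2) ∧ m ∣ a := by
  have hpp := Nat.prime_iff_prime_int.mp hp
  obtain ⟨k, m, hm, h⟩ := (FiniteMultiplicity.of_prime_left hpp ha).exists_eq_pow_mul_and_not_dvd
    |> fun ⟨m, h, hm⟩ => (⟨_, m, hm, h⟩ : ∃ k m, ¬ (p : ℤ) ∣ m ∧ a = (p : ℤ) ^ (k : ℕ) * m)
  rcases Nat.even_or_odd' k with ⟨l, rfl | rfl⟩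
  · exact ⟨m, p ^ l, hm, pow_ne_zero _ hpp.ne_zero, Or.inl (by rw [h]; ring),
      h ▸ dvd_mul_left _ _⟩
  · exact ⟨m, p ^ l, hm, pow_ne_zero _ hpp.ne_zero, Or.inr (by rw [h]; ring),
      h ▸ dvd_mul_left _ _⟩

lemma of_int_mul_sq (a : ℤ) {s : ℤ} (hs : s ≠ 0) : of ((a * s ^ 2 : ℤ) : ℚ) = of a := by
  push_cast
  exact of_mul_sq _ (by exact_mod_cast hs)

/-- No anisotropic residue form of dimension one or two occurs at `p`. -/
def Unramified (p : ℕ) (x : WittQ) : Prop :=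
  (∀ a : ℤ, ¬ (p : ℤ) ∣ a → x - of ((p * a : ℤ) : ℚ) ∉ unitSub p) ∧
  (p ≠ 2 → ∀ a b : ℤ, ¬ (p : ℤ) ∣ a → ¬ (p : ℤ) ∣ b → ¬ IsSquare (-(a * b) : ZMod p) →
    x - of ((p * a : ℤ) : ℚ) - of ((p * b : ℤ) : ℚ) ∉ unitSub p)

lemma not_dvd_val {p : ℕ} [Fact p.Prime] {a : ZMod p} (ha : a ≠ 0) : ¬ (p : ℤ) ∣ (a.val : ℤ) := by
  rw [← ZMod.intCast_zmod_eq_zero_iff_dvd]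
  simpa using ha

lemma mem_smoothSub_of_unramified {p : ℕ} [hp : Fact p.Prime] (hp2 : p ≠ 2) {x : WittQ}
    (hx : x ∈ smoothSub (p + 1)) (hu : Unramified p x) : x ∈ smoothSub p := by
  have hle : smoothSub (p + 1) ≤ (AddSubgroup.closure (Set.range (residue p (smoothSub p)))).comap
      (QuotientAddGroup.mk' (smoothSub p)) := by
    rw [smoothSub, AddSubgroup.closure_le]
    rintro x ⟨a, ha, rfl⟩
    obtain ⟨m, s, hm, hs, h, hma⟩ := exists_of_eq hp.out ha.1
    have hsm : IsSmoothInt p m := by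
      refine ⟨fun h0 => hm (h0 ▸ dvd_zero _), fun q hq hqm => ?_⟩
      refine lt_of_le_of_ne (Nat.lt_succ_iff.mp (ha.2 q hq (hqm.trans hma))) ?_
      rintro rfl
      exact hm hqm
    change (QuotientAddGroup.mk (of (a : ℚ)) : WittQ ⧸ smoothSub p) ∈
      AddSubgroup.closure (Set.range (residue p (smoothSub p)))
    rcases h with rfl | rfl
    · rw [of_int_mul_sq _ hs, (QuotientAddGroup.eq_zero_iff _).mpr (of_mem_smoothSub hsm)]
      exact zero_mem _
    · rw [of_int_mul_sq _ hs, mk_of_eq_residue le_rfl hsm]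
      exact AddSubgroup.subset_closure ⟨_, rfl⟩
  have hchar : ringChar (ZMod p) ≠ 2 := by rwa [ZMod.ringChar_zmod_n]
  have hsub := smoothSub_le_unitSub hp.out
  rcases (isWittMap_residue le_rfl).mem_closure residue_zero hchar (hle hx) with
    h | ⟨a, ha, h⟩ | ⟨a, b, ha, hb, hab, h⟩
  · exact (QuotientAddGroup.eq_zero_iff _).mp h
  · exact absurd (hsub (QuotientAddGroup.eq_iff_sub_mem.mp h)) (hu.1 _ (not_dvd_val ha))
  · refine absurd (hsub (QuotientAddGroup.eq_iff_sub_mem.mp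
      (h.trans (QuotientAddGroup.mk_add _ _ _).symm))) ?_
    rw [← sub_sub]
    exact hu.2 hp2 _ _ (not_dvd_val ha) (not_dvd_val hb) (by simpa using hab)

lemma exists_mem_smoothSub (x : WittQ) : ∃ N, x ∈ smoothSub N := by
  induction x using WittQ.induction with
  | h0 => exact ⟨0, zero_mem _⟩
  | ha a x ih =>
    obtain ⟨N, hN⟩ := ih
    by_cases ha : a = 0
    · exact ⟨N, by rwa [ha, of_zero, zero_add]⟩
    have hz : a.num * a.den ≠ 0 := mul_ne_zero (Rat.num_ne_zero.mpr ha) (by exact_mod_cast a.den_ne_zero)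
    have e : of a = of ((a.num * a.den : ℤ) : ℚ) := by
      have hd : (a.den : ℚ) ≠ 0 := by exact_mod_cast a.den_ne_zero
      rw [← of_mul_sq a hd]
      congr 1
      push_cast
      nth_rewrite 1 [← Rat.num_div_den a]
      field_simp
    refine ⟨max N ((a.num * a.den).natAbs + 1), add_mem ?_ (smoothSub_mono (le_max_left _ _) hN)⟩
    rw [e]
    refine smoothSub_mono (le_max_right _ _) (of_mem_smoothSub (IsSmoothInt.of_abs_lt hz ?_))
    rw [Int.abs_eq_natAbs]
    omega

lemma two_eq : of 1 + of 1 = of 2 + of 2 := by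
  have := of_add 1 1
  norm_num at this
  exact this

/-- An element of the Witt group of `ℚ` of signature zero and with no residues vanishes. -/
theorem eq_zero_of_unramified {x : WittQ} (hs : sig x = 0)
    (hu : ∀ p : ℕ, p.Prime → Unramified p x) : x = 0 := by
  have h3 : ∀ N, x ∈ smoothSub N → x ∈ smoothSub 3 := by
    intro N
    induction N with
    | zero => exact fun h => smoothSub_mono (by omega) h
    | succ N ih =>
      intro h
      by_cases hN : N ≤ 2
      · exact smoothSub_mono (by omega) h
      by_cases hp : N.Prime
      · have := Fact.mk hp
        exact ih (mem_smoothSub_of_unramified (by omega) h (hu N hp))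
      · refine ih ?_
        have : smoothSub (N + 1) ≤ smoothSub N := by
          rw [smoothSub, AddSubgroup.closure_le]
          rintro x ⟨a, ha, rfl⟩
          refine of_mem_smoothSub ⟨ha.1, fun q hq hd => ?_⟩
          refine lt_of_le_of_ne (Nat.lt_succ_iff.mp (ha.2 q hq hd)) ?_
          rintro rfl
          exact hp hq
        exact this h
  obtain ⟨N, hN⟩ := exists_mem_smoothSub x
  have hx := h3 N hN
  have hform : smoothSub 3 ≤ AddSubgroup.closure {of 1, of 2} := by
    rw [smoothSub, AddSubgroup.closure_le]
    rintro x ⟨a, ha, rfl⟩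
    obtain ⟨m, s, hm, hs, h, hma⟩ := exists_of_eq Nat.prime_two ha.1
    have hm1 : m.natAbs = 1 := by
      by_contra h1
      obtain ⟨q, hq, hqm⟩ := Nat.exists_prime_and_dvd h1
      have hqm' : (q : ℤ) ∣ m := Int.natCast_dvd.mpr hqm
      have := ha.2 q hq (hqm'.trans hma)
      have := hq.two_le
      obtain rfl : q = 2 := by omega
      exact hm hqm'
    have hm1' : m = 1 ∨ m = -1 := by omega
    have m1 : of 1 ∈ AddSubgroup.closure {of 1, of 2} := AddSubgroup.subset_closure (by simp)
    have m2 : of 2 ∈ AddSubgroup.closure {of 1, of 2} := AddSubgroup.subset_closure (by simp)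
    rw [SetLike.mem_coe]
    rcases h with rfl | rfl <;> rw [of_int_mul_sq _ hs] <;> rcases hm1' with rfl | rfl
    · simpa using m1
    · rw [Int.cast_neg, of_neg]; simpa using m1
    · simpa using m2
    · rw [mul_neg, Int.cast_neg, of_neg]; simpa using m2
  obtain ⟨a, b, hab⟩ := AddSubgroup.mem_closure_pair.mp (hform hx)
  have h1 : of 1 ∈ unitSub 2 := by
    have := of_mem_unitSub (p := 2) (a := 1) (by norm_num)
    simpa using this
  have hb : Even b := by
    by_contra hb
    rw [Int.not_even_iff_odd] at hb
    obtain ⟨k, rfl⟩ := hb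
    refine (hu 2 Nat.prime_two).1 1 (by norm_num) ?_
    have : x - of ((((2 : ℕ) : ℤ) * 1 : ℤ) : ℚ) = (a + 2 * k) • of 1 := by
      have e : of ((((2 : ℕ) : ℤ) * 1 : ℤ) : ℚ) = of 2 := by norm_num
      have h2 : (2 * k) • of 1 = k • (of 2 + of 2) := by rw [mul_zsmul', two_zsmul, two_eq]
      rw [e, ← hab, add_zsmul, add_zsmul, h2, one_zsmul, mul_zsmul', two_zsmul]
      abel
    rw [this]
    exact zsmul_mem h1 _
  obtain ⟨k, rfl⟩ := hb
  have hx1 : x = (a + 2 * k) • of 1 := by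
    rw [← hab, add_zsmul, add_zsmul, mul_zsmul', two_zsmul, two_eq, zsmul_add]
  rw [hx1, map_zsmul, sig_of] at hs
  simp at hs
  rw [hx1, hs, zero_zsmul]

end WittQ

section Metabolic

variable {V W : Type*} [AddCommGroup V] [Module ℚ V] [AddCommGroup W] [Module ℚ W]

/-- A (possibly degenerate) form is metabolic if it has a subspace equal to its orthogonal. -/
def Metabolic (B : BilinForm ℚ V) : Prop := ∃ Λ : Submodule ℚ V, B.orthogonal Λ = Λ

/-- The orthogonal sum of two bilinear forms. -/
def prodForm (B : BilinForm ℚ V) (C : BilinForm ℚ W) : BilinForm ℚ (V × W) :=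
  B.compl₁₂ (.fst ℚ V W) (.fst ℚ V W) + C.compl₁₂ (.snd ℚ V W) (.snd ℚ V W)

@[simp] lemma prodForm_apply (B : BilinForm ℚ V) (C : BilinForm ℚ W) (x y : V × W) :
    prodForm B C x y = B x.1 y.1 + C x.2 y.2 := rfl

lemma prodForm_isSymm {B : BilinForm ℚ V} {C : BilinForm ℚ W} (hB : B.IsSymm) (hC : C.IsSymm) :
    (prodForm B C).IsSymm :=
  ⟨fun x y => by simp [hB.eq x.1 y.1, hC.eq x.2 y.2]⟩

lemma Metabolic.of_equiv {B : BilinForm ℚ V} {C : BilinForm ℚ W} (e : V ≃ₗ[ℚ] W)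
    (he : ∀ x y, C (e x) (e y) = B x y) (h : Metabolic B) : Metabolic C := by
  obtain ⟨Λ, hΛ⟩ := h
  refine ⟨Λ.map (e : V →ₗ[ℚ] W), ?_⟩
  ext w
  obtain ⟨v, rfl⟩ := e.surjective w
  have h1 : v ∈ Λ ↔ ∀ n ∈ Λ, B n v = 0 := by
    conv_lhs => rw [← hΛ]
    rfl
  rw [BilinForm.mem_orthogonal_iff]
  constructor
  · exact fun h => ⟨v, h1.mpr fun n hn => (he n v).symm.trans (h (e n) ⟨n, hn, rfl⟩), rfl⟩
  · rintro ⟨v', hv', h⟩ _ ⟨n, hn, rfl⟩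
    obtain rfl : v' = v := e.injective h
    exact (he n v').trans (h1.mp hv' n hn)

lemma Metabolic.prod {B : BilinForm ℚ V} {C : BilinForm ℚ W} (hB : Metabolic B)
    (hC : Metabolic C) : Metabolic (prodForm B C) := by
  obtain ⟨Λ, hΛ⟩ := hB
  obtain ⟨Γ, hΓ⟩ := hC
  refine ⟨Λ.prod Γ, ?_⟩
  ext ⟨v, w⟩
  have h1 : v ∈ Λ ↔ ∀ n ∈ Λ, B n v = 0 := by
    conv_lhs => rw [← hΛ]
    rfl
  have h2 : w ∈ Γ ↔ ∀ n ∈ Γ, C n w = 0 := by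
    conv_lhs => rw [← hΓ]
    rfl
  simp only [BilinForm.mem_orthogonal_iff, prodForm_apply,
    Submodule.mem_prod, Prod.forall]
  constructor
  · intro h
    exact ⟨h1.mpr fun n hn => by simpa using h n 0 ⟨hn, zero_mem _⟩,
      h2.mpr fun n hn => by simpa using h 0 n ⟨zero_mem _, hn⟩⟩
  · rintro ⟨hv, hw⟩ a b ⟨ha, hb⟩
    rw [h1.mp hv a ha, h2.mp hw b hb, add_zero]

lemma orthogonal_orthogonal_of_radical_le [FiniteDimensional ℚ V] {B : BilinForm ℚ V}
    (hB : B.IsSymm) {U : Submodule ℚ V} (hU : B.orthogonal ⊤ ≤ U) :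
    B.orthogonal (B.orthogonal U) = U := by
  have h1 := BilinForm.finrank_add_finrank_orthogonal hB.isRefl U
  have h2 := BilinForm.finrank_add_finrank_orthogonal hB.isRefl (B.orthogonal U)
  rw [inf_eq_right.mpr hU] at h1
  rw [inf_eq_right.mpr (BilinForm.orthogonal_le le_top)] at h2
  exact (Submodule.eq_of_le_of_finrank_eq (BilinForm.le_orthogonal_orthogonal hB.isRefl)
    (by omega)).symm

lemma Metabolic.cancel [FiniteDimensional ℚ V] [FiniteDimensional ℚ W] {B : BilinForm ℚ V}
    {C : BilinForm ℚ W} (hB : B.IsSymm) (hC : C.IsSymm) (h : Metabolic (prodForm B C))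
    (h' : Metabolic C) : Metabolic B := by
  obtain ⟨Λ, hΛ⟩ := h
  obtain ⟨Γ, hΓ⟩ := h'
  have h1 : ∀ x, x ∈ Λ ↔ ∀ n ∈ Λ, prodForm B C n x = 0 := by
    intro x
    conv_lhs => rw [← hΛ]
    rfl
  have h2 : ∀ w, w ∈ Γ ↔ ∀ n ∈ Γ, C n w = 0 := by
    intro w
    conv_lhs => rw [← hΓ]
    rfl
  have hdd : (prodForm B C).orthogonal ((prodForm B C).orthogonal
      (Λ ⊔ Submodule.prod ⊥ Γ)) = Λ ⊔ Submodule.prod ⊥ Γ := by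
    refine orthogonal_orthogonal_of_radical_le (prodForm_isSymm hB hC) (le_trans ?_ le_sup_left)
    conv_rhs => rw [← hΛ]
    exact BilinForm.orthogonal_le le_top
  refine ⟨(Λ ⊓ Submodule.prod ⊤ Γ).map (.fst ℚ V W), ?_⟩
  ext x
  constructor
  · intro hx
    have hm : ((x, 0) : V × W) ∈ Λ ⊔ Submodule.prod ⊥ Γ := by
      rw [← hdd]
      rintro ⟨a, b⟩ hab
      have ha : (a, b) ∈ Λ := (h1 _).mpr fun n hn => hab n (Submodule.mem_sup_left hn)
      have hb : b ∈ Γ := (h2 _).mpr fun n hn => by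
        have := hab (0, n) (Submodule.mem_sup_right ⟨Submodule.zero_mem _, hn⟩)
        simpa using this
      have := hx a ⟨(a, b), ⟨ha, trivial, hb⟩, rfl⟩
      simpa using this
    obtain ⟨l, hl, ⟨g1, g2⟩, ⟨hg1, hg2⟩, hs⟩ := Submodule.mem_sup.mp hm
    obtain rfl : g1 = 0 := hg1
    obtain ⟨l1, l2⟩ := l
    simp only [Prod.mk_add_mk, add_zero, Prod.mk.injEq] at hs
    refine ⟨(l1, l2), ⟨hl, trivial, ?_⟩, hs.1⟩
    rw [eq_neg_of_add_eq_zero_left hs.2]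
    exact neg_mem hg2
  · rintro ⟨⟨a, b⟩, ⟨ha, -, hb⟩, rfl⟩ n ⟨⟨c, d⟩, ⟨hc, -, hd⟩, rfl⟩
    have e1 := (h1 _).mp ha _ hc
    have e2 := (h2 _).mp hb _ hd
    simpa [e2] using e1

end Metabolic

section Diagonal

variable {ι κ : Type*} [Fintype ι] [Fintype κ]

/-- The diagonal form with coefficients `f`. -/
def diagForm (f : ι → ℚ) : BilinForm ℚ (ι → ℚ) :=
  LinearMap.mk₂ ℚ (fun x y => ∑ i, f i * x i * y i)
    (fun x x' y => by simp [mul_add, add_mul, Finset.sum_add_distrib])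
    (fun c x y => by simp [Finset.mul_sum]; exact Finset.sum_congr rfl fun i _ => by ring)
    (fun x y y' => by simp [mul_add, Finset.sum_add_distrib])
    (fun c x y => by simp [Finset.mul_sum]; exact Finset.sum_congr rfl fun i _ => by ring)

@[simp] lemma diagForm_apply (f x y : ι → ℚ) : diagForm f x y = ∑ i, f i * x i * y i := rfl

lemma diagForm_isSymm (f : ι → ℚ) : (diagForm f).IsSymm :=
  ⟨fun x y => by simp; exact Finset.sum_congr rfl fun i _ => by ring⟩

lemma metabolic_diagForm_comp (e : κ ≃ ι) (f : ι → ℚ) :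
    Metabolic (diagForm (f ∘ e)) ↔ Metabolic (diagForm f) := by
  have h : ∀ x y : ι → ℚ, diagForm (f ∘ e) (x ∘ e) (y ∘ e) = diagForm f x y := fun x y =>
    e.sum_comp (fun i => f i * x i * y i)
  constructor
  · refine Metabolic.of_equiv (LinearEquiv.funCongrLeft ℚ ℚ e.symm) fun x y => ?_
    rw [← h]
    congr 1
    · congr 1
      ext i
      simp [LinearMap.funLeft_apply, LinearEquiv.funCongrLeft_apply]
    · ext i
      simp [LinearMap.funLeft_apply, LinearEquiv.funCongrLeft_apply]
  · exact Metabolic.of_equiv (LinearEquiv.funCongrLeft ℚ ℚ e) fun x y => h x y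

lemma metabolic_diagForm_sumElim (f : ι → ℚ) (g : κ → ℚ) :
    Metabolic (diagForm (Sum.elim f g)) ↔ Metabolic (prodForm (diagForm f) (diagForm g)) := by
  constructor
  · exact Metabolic.of_equiv (LinearEquiv.sumArrowLequivProdArrow ι κ ℚ ℚ) fun x y => by
      simp [Fintype.sum_sum_type]
  · exact Metabolic.of_equiv (LinearEquiv.sumArrowLequivProdArrow ι κ ℚ ℚ).symm fun x y => by
      simp only [diagForm_apply, Fintype.sum_sum_type, Sum.elim_inl, Sum.elim_inr,
        prodForm_apply]
      rfl

end Diagonal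

/-- The diagonal form with the given multiset of coefficients is metabolic. -/
def Met (s : Multiset ℚ) : Prop := Metabolic (diagForm (fun x : s => (x.1 : ℚ)))

lemma met_map_iff {ι : Type*} [Fintype ι] (f : ι → ℚ) :
    Met (Finset.univ.val.map f) ↔ Metabolic (diagForm f) := by
  set s := Finset.univ.val.map f with hs
  have h1 : Finset.univ.val.map (fun x : s => (x.1 : ℚ)) = Finset.univ.val.map f := by
    rw [Multiset.map_univ_coe]
  have h2 : ∃ e : s ≃ ι, f ∘ e = fun x : s => (x.1 : ℚ) := by
    classical
    have hc : ∀ a : ℚ, Nonempty ({x : s // (x.1 : ℚ) = a} ≃ {i // f i = a}) := by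
      intro a
      refine Fintype.card_eq.mp ?_
      have := congrArg (Multiset.count a) h1
      rw [Multiset.count_map, Multiset.count_map] at this
      rw [Fintype.card_subtype, Fintype.card_subtype, Finset.card_def, Finset.card_def,
        Finset.filter_val, Finset.filter_val]
      simpa only [eq_comm] using this
    let e := fun a => (hc a).some
    refine ⟨(Equiv.sigmaFiberEquiv _).symm.trans
      ((Equiv.sigmaCongrRight e).trans (Equiv.sigmaFiberEquiv f)), ?_⟩
    ext x
    simp only [Function.comp, Equiv.trans_apply]
    exact (e _ _).2
  obtain ⟨e, he⟩ := h2
  rw [Met, ← he, metabolic_diagForm_comp]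

lemma met_add_iff (s t : Multiset ℚ) :
    Met (s + t) ↔ Metabolic (prodForm (diagForm (fun x : s => (x.1 : ℚ)))
      (diagForm (fun x : t => (x.1 : ℚ)))) := by
  rw [← metabolic_diagForm_sumElim, ← met_map_iff]
  have : Finset.univ.val.map (Sum.elim (fun x : s => (x.1 : ℚ)) (fun x : t => (x.1 : ℚ)))
      = s + t := by
    rw [← Finset.univ_disjSum_univ, Finset.val_disjSum, Multiset.disjSum, Multiset.map_add,
      Multiset.map_map, Multiset.map_map]
    exact congrArg₂ (· + ·) (Multiset.map_univ_coe s) (Multiset.map_univ_coe t)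
  rw [this]

lemma Met.add {s t : Multiset ℚ} (hs : Met s) (ht : Met t) : Met (s + t) :=
  (met_add_iff s t).mpr (Metabolic.prod hs ht)

lemma Met.cancel {s t : Multiset ℚ} (h : Met (s + t)) (ht : Met t) : Met s :=
  Metabolic.cancel (diagForm_isSymm _) (diagForm_isSymm _) ((met_add_iff s t).mp h) ht

lemma Met.neg {s : Multiset ℚ} (hs : Met s) : Met (s.map Neg.neg) := by
  obtain ⟨Λ, hΛ⟩ := hs
  have h : Multiset.map Neg.neg s = Finset.univ.val.map (fun x : s => -(x.1 : ℚ)) := by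
    conv_lhs => rw [← Multiset.map_univ_coe s]
    rw [Multiset.map_map]
    rfl
  rw [h, met_map_iff]
  refine ⟨Λ, ?_⟩
  conv_rhs => rw [← hΛ]
  ext x
  simp [BilinForm.mem_orthogonal_iff]

lemma met_zero : Met 0 :=
  (met_map_iff (fun x : Empty => (x.elim : ℚ))).mpr
    ⟨⊤, by ext; simp [BilinForm.mem_orthogonal_iff]⟩

lemma met_singleton_zero : Met {0} := by
  have := (met_map_iff (fun _ : Unit => (0 : ℚ))).mpr
    ⟨⊤, by ext; simp [BilinForm.mem_orthogonal_iff]⟩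
  simpa using this

lemma met_pair (a : ℚ) {s : ℚ} (hs : s ≠ 0) : Met {a * s ^ 2, -a} := by
  by_cases ha : a = 0
  · simpa [ha] using met_singleton_zero.add met_singleton_zero
  have := (met_map_iff ![a * s ^ 2, -a]).mpr ⟨Submodule.span ℚ {![1, s]}, by
    ext x
    rw [Submodule.mem_span_singleton]
    constructor
    · intro h
      have h1 := h ![1, s] (Submodule.mem_span_singleton_self _)
      simp [Fin.sum_univ_two] at h1
      have h2 : x 1 = s * x 0 := by
        have : a * s * (s * x 0 - x 1) = 0 := by linear_combination h1
        rcases mul_eq_zero.mp this with h | h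
        · simp [ha, hs] at h
        · linear_combination -h
      refine ⟨x 0, ?_⟩
      ext i
      fin_cases i <;> simp [h2, mul_comm]
    · rintro ⟨c, rfl⟩ y hy
      obtain ⟨d, rfl⟩ := Submodule.mem_span_singleton.mp hy
      simp [Fin.sum_univ_two]
      ring⟩
  exact this

lemma met_pair_neg (a : ℚ) : Met {a, -a} := by
  simpa using met_pair a one_ne_zero

lemma met_relation (a b : ℚ) : Met {a, b, -(a + b), -(a * b * (a + b))} := by
  by_cases hab : a + b = 0
  · obtain rfl : b = -a := by linear_combination hab
    have := (met_pair_neg a).add (met_singleton_zero.add met_singleton_zero)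
    have e : ({a, -a} + ({0} + {0}) : Multiset ℚ) =
        {a, -a, -(a + -a), -(a * -a * (a + -a))} := by
      simp [Multiset.insert_eq_cons, ← Multiset.singleton_add]
      abel
    rwa [e] at this
  by_cases ha : a = 0
  · subst ha
    have := (met_pair_neg b).add (met_singleton_zero.add met_singleton_zero)
    have e : ({b, -b} + ({0} + {0}) : Multiset ℚ) = {0, b, -(0 + b), -(0 * b * (0 + b))} := by
      simp [Multiset.insert_eq_cons, ← Multiset.singleton_add]
      abel
    rwa [e] at this
  by_cases hb : b = 0
  · subst hb
    have := (met_pair_neg a).add (met_singleton_zero.add met_singleton_zero)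
    have e : ({a, -a} + ({0} + {0}) : Multiset ℚ) = {a, 0, -(a + 0), -(a * 0 * (a + 0))} := by
      simp [Multiset.insert_eq_cons, ← Multiset.singleton_add]
      abel
    rwa [e] at this
  have := (met_map_iff ![a, b, -(a + b), -(a * b * (a + b))]).mpr
    ⟨Submodule.span ℚ {![1, 1, 1, 0], ![b, -a, 0, 1]}, by
    ext x
    rw [Submodule.mem_span_pair]
    constructor
    · intro h
      have h1 := h ![1, 1, 1, 0] (Submodule.subset_span (by simp))
      have h2 := h ![b, -a, 0, 1] (Submodule.subset_span (by simp))
      simp [Fin.sum_univ_four] at h1 h2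
      have h3 : x 0 - x 1 = (a + b) * x 3 := by
        have : a * b * (x 0 - x 1 - (a + b) * x 3) = 0 := by linear_combination h2
        rcases mul_eq_zero.mp this with h | h
        · simp [ha, hb] at h
        · linear_combination h
      have h4 : x 0 = x 2 + b * x 3 := by
        have : (a + b) * (x 0 - x 2 - b * x 3) = 0 := by linear_combination h1 + b * h3
        rcases mul_eq_zero.mp this with h | h
        · exact absurd h hab
        · linear_combination h
      have h5 : x 1 = x 2 - a * x 3 := by linear_combination h4 - h3
      refine ⟨x 2, x 3, ?_⟩
      ext i
      fin_cases i <;> simp [h4, h5] <;> ring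
    · rintro ⟨c, d, rfl⟩ y hy
      obtain ⟨c', d', rfl⟩ := Submodule.mem_span_pair.mp hy
      simp [Fin.sum_univ_four]
      ring⟩
  exact this

lemma met_add_neg (s : Multiset ℚ) : Met (s + s.map Neg.neg) := by
  induction s using Multiset.induction with
  | empty => exact met_zero
  | cons a s ih =>
    have := (met_pair_neg a).add ih
    have e : ({a, -a} + (s + s.map Neg.neg) : Multiset ℚ) = a ::ₘ s + (a ::ₘ s).map Neg.neg := by
      rw [Multiset.map_cons, Multiset.insert_eq_cons, ← Multiset.singleton_add,
        ← Multiset.singleton_add a s, ← Multiset.singleton_add (-a)]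
      abel
    rwa [e] at this

/-- The formal sum of a multiset of coefficients. -/
def formalSum (s : Multiset ℚ) : FreeAbelianGroup ℚ := (s.map FreeAbelianGroup.of).sum

lemma formalSum_add (s t : Multiset ℚ) : formalSum (s + t) = formalSum s + formalSum t := by
  simp [formalSum]

lemma formalSum_injective : Function.Injective formalSum := by
  classical
  intro s t h
  ext a
  have key : ∀ s : Multiset ℚ,
      FreeAbelianGroup.lift (fun b => if a = b then (1 : ℤ) else 0) (formalSum s) = s.count a := by
    intro s
    induction s using Multiset.induction with
    | empty => simp [formalSum]
    | cons b s ih =>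
      rw [← Multiset.singleton_add, formalSum_add, map_add, ih, Multiset.count_add]
      simp [formalSum, Multiset.count_singleton]
  have := congrArg (FreeAbelianGroup.lift (fun b => if a = b then (1 : ℤ) else 0)) h
  rw [key, key] at this
  exact_mod_cast this

/-- The subgroup of differences of formal sums representing metabolic forms. -/
def metSub : AddSubgroup (FreeAbelianGroup ℚ) where
  carrier := {x | ∃ s t : Multiset ℚ, x = formalSum s - formalSum t ∧ Met (s + t.map Neg.neg)}
  zero_mem' := ⟨0, 0, by simp, met_zero⟩
  add_mem' := by
    rintro _ _ ⟨s, t, rfl, h⟩ ⟨s', t', rfl, h'⟩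
    refine ⟨s + s', t + t', by rw [formalSum_add, formalSum_add]; abel, ?_⟩
    have := h.add h'
    rwa [add_add_add_comm, ← Multiset.map_add] at this
  neg_mem' := by
    rintro _ ⟨s, t, rfl, h⟩
    refine ⟨t, s, by abel, ?_⟩
    have := h.neg
    rwa [Multiset.map_add, Multiset.map_map, add_comm, show Neg.neg ∘ Neg.neg = (id : ℚ → ℚ) from
      funext neg_neg, Multiset.map_id] at this

/-- A diagonal form whose class in the Witt group vanishes is metabolic. -/
theorem met_of_sum_eq_zero (s : Multiset ℚ) (h : (s.map WittQ.of).sum = 0) : Met s := by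
  have hle : AddSubgroup.closure {x | WittRel x} ≤ metSub := by
    rw [AddSubgroup.closure_le]
    rintro x (_ | a | ⟨a, c, hc⟩ | ⟨a, b⟩)
    · exact ⟨{0}, 0, by simp [formalSum], by simpa using met_singleton_zero⟩
    · exact ⟨{a, -a}, 0, by simp [formalSum], by simpa using met_pair_neg a⟩
    · exact ⟨{a * c ^ 2}, {a}, by simp [formalSum], by simpa using met_pair a hc⟩
    · exact ⟨{a, b}, {a + b, a * b * (a + b)}, by simp [formalSum]; abel,
        met_relation a b⟩
  have hmk : ∀ s, (QuotientAddGroup.mk (formalSum s) : WittQ) = (s.map WittQ.of).sum := by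
    intro s
    induction s using Multiset.induction with
    | empty => rfl
    | cons a s ih =>
      rw [← Multiset.singleton_add, formalSum_add, Multiset.map_add, Multiset.sum_add]
      rw [← ih]
      simp [formalSum, WittQ.of]
  obtain ⟨s', t', e, hm⟩ := hle ((QuotientAddGroup.eq_zero_iff _).mp ((hmk s).trans h))
  have : s + t' = s' := formalSum_injective (by rw [formalSum_add, e]; abel)
  rw [← this, add_assoc] at hm
  exact hm.cancel (met_add_neg t')

section IntegralPoints

variable {N : Type*}

/-- The inclusion `ℤᴺ → ℚᴺ`. -/
def castVec (N : Type*) : (N → ℤ) →ₗ[ℤ] (N → ℚ) where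
  toFun w i := w i
  map_add' _ _ := by ext; simp
  map_smul' _ _ := by ext; simp

@[simp] lemma castVec_apply (w : N → ℤ) (i : N) : castVec N w i = w i := rfl

lemma castVec_injective : Function.Injective (castVec N) := fun a b h => by
  ext i
  exact Int.cast_injective (α := ℚ) (congrFun h i)

lemma exists_smul_eq_castVec [Fintype N] (v : N → ℚ) :
    ∃ d : ℤ, d ≠ 0 ∧ ∃ w : N → ℤ, (d : ℚ) • v = castVec N w := by
  classical
  refine ⟨∏ i, ((v i).den : ℤ), Finset.prod_ne_zero_iff.mpr fun i _ => by
    exact_mod_cast (v i).den_ne_zero, fun i => (v i).num * ∏ j ∈ Finset.univ.erase i,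
    ((v j).den : ℤ), ?_⟩
  ext i
  have hd : ((v i).den : ℚ) ≠ 0 := by exact_mod_cast (v i).den_ne_zero
  rw [Pi.smul_apply, smul_eq_mul, castVec_apply,
    ← Finset.mul_prod_erase _ _ (Finset.mem_univ i)]
  push_cast
  nth_rewrite 2 [← Rat.num_div_den (v i)]
  field_simp

/-- The integral points of a rational subspace have a basis, of the expected rank. -/
lemma exists_integral_basis [Fintype N] (Λ : Submodule ℚ (N → ℚ)) :
    ∃ b : Fin (Module.finrank ℚ Λ) → N → ℤ, LinearIndependent ℤ b ∧ (∀ i, castVec N (b i) ∈ Λ) ∧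
      ∀ w, castVec N w ∈ Λ → ∃ c : Fin (Module.finrank ℚ Λ) → ℤ, w = ∑ i, c i • b i := by
  set Λ' : Submodule ℤ (N → ℤ) := (Λ.restrictScalars ℤ).comap (castVec N) with hΛ'
  have B := Module.finBasis ℤ Λ'
  set k := Module.finrank ℤ Λ'
  have hind : LinearIndependent ℤ fun i => ((B i : Λ') : N → ℤ) :=
    B.linearIndependent.map' Λ'.subtype (Submodule.ker_subtype _)
  have hindQ : LinearIndependent ℚ fun i => castVec N (B i) := by
    rw [← LinearIndependent.iff_fractionRing ℤ ℚ]
    exact hind.map' (castVec N) (LinearMap.ker_eq_bot.mpr castVec_injective)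
  have hspan : ∀ w, castVec N w ∈ Λ → ∃ c : Fin k → ℤ, w = ∑ i, c i • (B i : N → ℤ) := by
    intro w hw
    refine ⟨B.repr ⟨w, hw⟩, ?_⟩
    have := congrArg Λ'.subtype (B.sum_repr ⟨w, hw⟩)
    rw [map_sum] at this
    exact this.symm
  have hs : Submodule.span ℚ (Set.range fun i => castVec N (B i)) = Λ := by
    apply le_antisymm
    · rw [Submodule.span_le]
      rintro _ ⟨i, rfl⟩
      exact (B i).2
    · intro v hv
      obtain ⟨d, hd, w, hw⟩ := exists_smul_eq_castVec v
      obtain ⟨c, hc⟩ := hspan w (hw ▸ Λ.smul_mem _ hv)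
      have hd' : (d : ℚ) ≠ 0 := by exact_mod_cast hd
      rw [← inv_smul_smul₀ hd' v, hw, hc, map_sum]
      refine Submodule.smul_mem _ _ (Submodule.sum_mem _ fun i _ => ?_)
      rw [map_smul]
      exact zsmul_mem (Submodule.subset_span (Set.mem_range_self i)) _
  have hk : k = Module.finrank ℚ Λ := by
    have := finrank_span_eq_card hindQ
    rw [hs, Fintype.card_fin] at this
    exact this.symm
  rw [← hk]
  exact ⟨fun i => B i, hind, fun i => (B i).2, hspan⟩

lemma dvd_coeff_of_dvd {k : ℕ} {Λ : Submodule ℚ (N → ℚ)} {b : Fin k → N → ℤ}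
    (hb : LinearIndependent ℤ b) (hbΛ : ∀ i, castVec N (b i) ∈ Λ)
    (hs : ∀ w, castVec N w ∈ Λ → ∃ c : Fin k → ℤ, w = ∑ i, c i • b i) {p : ℤ} (hp : p ≠ 0)
    {c : Fin k → ℤ} (h : ∀ j, p ∣ (∑ i, c i • b i) j) (i : Fin k) : p ∣ c i := by
  choose w hw using h
  have hw' : ∑ i, c i • b i = p • w := funext hw
  have hmem : castVec N w ∈ Λ := by
    have h1 : (p : ℚ) • castVec N w ∈ Λ := by
      have : (p : ℚ) • castVec N w = castVec N (p • w) := by ext; simp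
      rw [this, ← hw', map_sum]
      exact Submodule.sum_mem _ fun i _ => by rw [map_smul]; exact zsmul_mem (hbΛ i) _
    have hp' : (p : ℚ) ≠ 0 := by exact_mod_cast hp
    simpa [hp'] using Λ.smul_mem (p : ℚ)⁻¹ h1
  obtain ⟨c', hc'⟩ := hs w hmem
  have hz : ∑ i, (c i - p * c' i) • b i = 0 := by
    simp only [sub_smul, Finset.sum_sub_distrib, hw', mul_smul, ← Finset.smul_sum, ← hc', sub_self]
  have := Fintype.linearIndependent_iff.mp hb _ hz i
  exact ⟨c' i, by linear_combination this⟩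

end IntegralPoints

section Obstruction

variable {ι J : Type*} [Fintype ι] [Fintype J] [DecidableEq ι] [DecidableEq J]

/-- The rational bilinear form of an integral matrix. -/
noncomputable abbrev ratForm (H : Matrix ι ι ℤ) : BilinForm ℚ (ι → ℚ) :=
  Matrix.toBilin' (H.map (Int.cast : ℤ → ℚ))

lemma ratForm_castVec (H : Matrix ι ι ℤ) (x y : ι → ℤ) :
    ratForm H (castVec ι x) (castVec ι y) = (Matrix.toBilin' H x y : ℤ) := by
  simp [Matrix.toBilin'_apply]

lemma toBilin'_isSymm {R : Type*} [CommRing R] {H : Matrix ι ι R} (hH : H.IsSymm) :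
    (Matrix.toBilin' H).IsSymm := by
  refine ⟨fun x y => ?_⟩
  rw [Matrix.toBilin'_apply', Matrix.toBilin'_apply', dotProduct_comm,
    ← Matrix.vecMul_transpose, hH.eq, Matrix.dotProduct_mulVec]

lemma finrank_of_isotropic {K : Type*} [Field K] {H : Matrix ι ι K} (hd : H.det ≠ 0) {U : Submodule K (ι → K)}
    (hU : ∀ x ∈ U, ∀ y ∈ U, Matrix.toBilin' H x y = 0) :
    2 * Module.finrank K U ≤ Fintype.card ι := by
  have hn : (Matrix.toBilin' H).Nondegenerate := LinearMap.BilinForm.nondegenerate_toBilin'_of_det_ne_zero' _ hd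
  have h1 := BilinForm.finrank_orthogonal hn U
  have h2 := Submodule.finrank_mono (show U ≤ (Matrix.toBilin' H).orthogonal U from
    fun x hx y hy => hU y hy x hx)
  have h3 := Submodule.finrank_le U
  rw [Module.finrank_fintype_fun_eq_card] at h1 h3
  omega

/-- A unimodular form plus `p` times a form which is anisotropic modulo `p` is not metabolic. -/
theorem not_metabolic_of_anisotropic [Nonempty J] {p : ℕ} [Fact p.Prime] {F : Matrix ι ι ℤ}
    (hd : ¬ (p : ℤ) ∣ F.det) {a : J → ℤ}
    (ha : ∀ r : J → ℤ, (p : ℤ) ∣ ∑ j, a j * r j ^ 2 → ∀ j, (p : ℤ) ∣ r j) :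
    ¬ Metabolic (ratForm (Matrix.fromBlocks F 0 0 (Matrix.diagonal fun j => (p : ℤ) * a j))) := by
  rintro ⟨Λ, hΛ⟩
  have hp0 : (p : ℤ) ≠ 0 := by exact_mod_cast (Fact.out : p.Prime).ne_zero
  set H := Matrix.fromBlocks F 0 0 (Matrix.diagonal fun j => (p : ℤ) * a j) with hHdef
  have ha0 : ∀ j, a j ≠ 0 := by
    intro j h
    have := ha (Pi.single j 1) (by
      rw [Finset.sum_eq_single j] <;> simp +contextual [h]) j
    rw [Pi.single_eq_same, Int.natCast_dvd_ofNat] at this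
    exact (Fact.out : p.Prime).one_lt.ne' (Nat.dvd_one.mp this)
  have hHd : H.det ≠ 0 := by
    rw [hHdef, Matrix.det_fromBlocks_zero₂₁, Matrix.det_diagonal]
    exact mul_ne_zero (fun h => hd (h ▸ dvd_zero _))
      (Finset.prod_ne_zero_iff.mpr fun j _ => mul_ne_zero hp0 (ha0 j))
  have hHdQ : (H.map (Int.cast : ℤ → ℚ)).det ≠ 0 := by
    have := Int.cast_det (R := ℚ) H
    rw [← this]
    exact_mod_cast hHd
  have hn := LinearMap.BilinForm.nondegenerate_toBilin'_of_det_ne_zero' _ hHdQ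
  have hdim := BilinForm.finrank_orthogonal hn Λ
  rw [hΛ, Module.finrank_fintype_fun_eq_card, Fintype.card_sum] at hdim
  have hJ : 0 < Fintype.card J := Fintype.card_pos
  have hB := exists_integral_basis Λ
  generalize Module.finrank ℚ Λ = k at hdim hB
  obtain ⟨b, hb, hbΛ, hs⟩ := hB
  have hiso : ∀ v ∈ Λ, ∀ w ∈ Λ, ratForm H v w = 0 := fun v hv w hw => by
    rw [← hΛ] at hw
    exact hw v hv
  have hHf : ∀ x y : ι ⊕ J → ℤ, Matrix.toBilin' H x y =
      Matrix.toBilin' F (x ∘ Sum.inl) (y ∘ Sum.inl) + p * ∑ j, a j * (x (.inr j) * y (.inr j)) := by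
    intro x y
    simp only [Matrix.toBilin'_apply', hHdef, Matrix.fromBlocks_mulVec, dotProduct,
      Fintype.sum_sum_type, Sum.elim_inl, Sum.elim_inr, Matrix.zero_mulVec, add_zero, zero_add,
      Function.comp_apply, Matrix.mulVec_diagonal, Finset.mul_sum]
    congr 1
    exact Finset.sum_congr rfl fun j _ => by ring
  let T : (Fin k → ZMod p) →ₗ[ZMod p] (ι → ZMod p) :=
    Fintype.linearCombination (ZMod p) (fun i j => ((b i (.inl j) : ℤ) : ZMod p))
  have hTint : ∀ c : Fin k → ℤ, T (fun i => (c i : ZMod p)) =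
      fun j => (((∑ i, c i • b i) (.inl j) : ℤ) : ZMod p) := by
    intro c
    ext j
    simp [T, Fintype.linearCombination_apply]
  have hlift : ∀ c : Fin k → ZMod p, ∃ c' : Fin k → ℤ, c = fun i => (c' i : ZMod p) := fun c =>
    ⟨fun i => (c i).val, by ext; simp⟩
  have hmem : ∀ c : Fin k → ℤ, castVec _ (∑ i, c i • b i) ∈ Λ := fun c => by
    rw [map_sum]
    exact Submodule.sum_mem _ fun i _ => by rw [map_smul]; exact zsmul_mem (hbΛ i) _
  have hzero : ∀ c c' : Fin k → ℤ, Matrix.toBilin' H (∑ i, c i • b i) (∑ i, c' i • b i) = 0 := by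
    intro c c'
    have := hiso _ (hmem c) _ (hmem c')
    rw [ratForm_castVec] at this
    exact_mod_cast this
  have hFd : (F.map (Int.cast : ℤ → ZMod p)).det ≠ 0 := by
    have := Int.cast_det (R := ZMod p) F
    rw [← this]
    rwa [Ne, ZMod.intCast_zmod_eq_zero_iff_dvd]
  have hrange := finrank_of_isotropic (U := LinearMap.range T) hFd (by
    rintro _ ⟨c, rfl⟩ _ ⟨c', rfl⟩
    obtain ⟨c, rfl⟩ := hlift c
    obtain ⟨c', rfl⟩ := hlift c'
    have h0 := hzero c c'
    rw [hHf] at h0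
    have h1 := congrArg (Int.cast : ℤ → ZMod p) h0
    rw [hTint, hTint]
    simp only [Int.cast_add, Int.cast_mul, Int.cast_natCast, CharP.cast_eq_zero, zero_mul, add_zero,
      Int.cast_zero] at h1
    rw [← h1]
    simp [Matrix.toBilin'_apply])
  have hrn := T.finrank_range_add_finrank_ker
  rw [Module.finrank_fintype_fun_eq_card, Fintype.card_fin] at hrn
  have hker : LinearMap.ker T ≠ ⊥ := by
    intro h
    rw [h, finrank_bot] at hrn
    omega
  obtain ⟨c, hc, hc0⟩ := Submodule.exists_mem_ne_zero_of_ne_bot hker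
  obtain ⟨c, rfl⟩ := hlift c
  set x := ∑ i, c i • b i with hx
  have hx1 : ∀ j, (p : ℤ) ∣ x (.inl j) := fun j => by
    rw [← ZMod.intCast_zmod_eq_zero_iff_dvd]
    have := hTint c
    rw [LinearMap.mem_ker.mp hc] at this
    exact (congrFun this j).symm
  have hx2 : ∀ j, (p : ℤ) ∣ x (.inr j) := by
    apply ha (fun j => x (.inr j))
    choose z hz using hx1
    have h0 := hzero c c
    rw [hHf, ← hx, show x ∘ Sum.inl = (p : ℤ) • z from funext hz] at h0
    simp only [map_smul, LinearMap.smul_apply, smul_eq_mul] at h0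
    have h1 : ∑ j, a j * (x (.inr j) * x (.inr j)) = p * (-(Matrix.toBilin' F z z)) := by
      refine mul_left_cancel₀ hp0 ?_
      linear_combination h0
    exact ⟨_, by rw [← h1]; exact Finset.sum_congr rfl fun j _ => by ring⟩
  apply hc0
  ext i
  have := dvd_coeff_of_dvd hb hbΛ hs hp0 (c := c) (by rintro (j | j); exacts [hx1 j, hx2 j]) i
  rw [Pi.zero_apply, ZMod.intCast_zmod_eq_zero_iff_dvd]
  exact this

end Obstruction

/-- Two rational bilinear forms are isometric. -/
def Isom {V W : Type*} [AddCommGroup V] [Module ℚ V] [AddCommGroup W] [Module ℚ W]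
    (B : BilinForm ℚ V) (C : BilinForm ℚ W) : Prop :=
  ∃ e : V ≃ₗ[ℚ] W, ∀ x y, C (e x) (e y) = B x y

namespace Isom

variable {V W V' W' : Type*} [AddCommGroup V] [Module ℚ V] [AddCommGroup W] [Module ℚ W]
  [AddCommGroup V'] [Module ℚ V'] [AddCommGroup W'] [Module ℚ W']
  {B : BilinForm ℚ V} {C : BilinForm ℚ W} {B' : BilinForm ℚ V'} {C' : BilinForm ℚ W'}

lemma symm (h : Isom B C) : Isom C B := by
  obtain ⟨e, he⟩ := h
  exact ⟨e.symm, fun x y => by rw [← he, e.apply_symm_apply, e.apply_symm_apply]⟩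

lemma trans (h : Isom B C) (h' : Isom C B') : Isom B B' := by
  obtain ⟨e, he⟩ := h
  obtain ⟨f, hf⟩ := h'
  exact ⟨e.trans f, fun x y => by simp [hf, he]⟩

lemma prod (h : Isom B C) (h' : Isom B' C') : Isom (prodForm B B') (prodForm C C') := by
  obtain ⟨e, he⟩ := h
  obtain ⟨f, hf⟩ := h'
  exact ⟨e.prodCongr f, fun x y => by simp [hf, he]⟩

lemma metabolic (h : Isom B C) (hB : Metabolic B) : Metabolic C := by
  obtain ⟨e, he⟩ := h
  exact hB.of_equiv e he

end Isom

section

variable {ι κ J : Type*} [Fintype ι] [Fintype κ] [Fintype J]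

lemma isom_diagForm_sumElim (f : ι → ℚ) (g : κ → ℚ) :
    Isom (diagForm (Sum.elim f g)) (prodForm (diagForm f) (diagForm g)) :=
  ⟨LinearEquiv.sumArrowLequivProdArrow ι κ ℚ ℚ, fun x y => by simp [Fintype.sum_sum_type]⟩

variable [DecidableEq ι] [DecidableEq κ] [DecidableEq J]

lemma isom_ratForm_fromBlocks (A : Matrix ι ι ℤ) (D : Matrix κ κ ℤ) :
    Isom (ratForm (Matrix.fromBlocks A 0 0 D)) (prodForm (ratForm A) (ratForm D)) := by
  refine ⟨LinearEquiv.sumArrowLequivProdArrow ι κ ℚ ℚ, fun x y => ?_⟩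
  simp only [prodForm_apply, Matrix.toBilin'_apply, Fintype.sum_sum_type, Matrix.map_apply,
    Matrix.fromBlocks_apply₁₁, Matrix.fromBlocks_apply₁₂, Matrix.fromBlocks_apply₂₁,
    Matrix.fromBlocks_apply₂₂, Matrix.zero_apply, Int.cast_zero, mul_zero, zero_mul,
    Finset.sum_const_zero, add_zero, zero_add]
  rfl

lemma isom_ratForm_diagonal (u : ι → ℤ) :
    Isom (ratForm (Matrix.diagonal u)) (diagForm fun i => (u i : ℚ)) := by
  refine ⟨.refl ℚ _, fun x y => ?_⟩
  simp only [diagForm_apply, LinearEquiv.refl_apply, Matrix.toBilin'_apply, Matrix.map_apply]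
  refine Finset.sum_congr rfl fun i _ => ?_
  rw [Finset.sum_eq_single i (fun j _ h => by simp [Matrix.diagonal_apply_ne _ h.symm])
    (by simp), Matrix.diagonal_apply_eq]
  ring

omit [DecidableEq ι] in
lemma met_of_sum_of_eq_zero (f : ι → ℚ) (h : ∑ i, WittQ.of (f i) = 0) :
    Metabolic (diagForm f) := by
  rw [← met_map_iff]
  apply met_of_sum_eq_zero
  rw [Multiset.map_map]
  exact h

open WittQ in
lemma exists_eq_sum_of_mem_unitSub {p : ℕ} {x : WittQ} (hx : x ∈ unitSub p) :
    ∃ (k : ℕ) (u : Fin k → ℤ), (∀ i, ¬ (p : ℤ) ∣ u i) ∧ x = ∑ i, of (u i) := by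
  rw [unitSub] at hx
  induction hx using AddSubgroup.closure_induction with
  | mem x h =>
    obtain ⟨a, ha, rfl⟩ := h
    exact ⟨1, ![a], by simpa using ha, by simp⟩
  | zero => exact ⟨0, ![], by simp, by simp⟩
  | add x y _ _ hx hy =>
    obtain ⟨k, u, hu, rfl⟩ := hx
    obtain ⟨l, v, hv, rfl⟩ := hy
    refine ⟨k + l, Fin.append u v, fun i => ?_, by simp [Fin.sum_univ_add]⟩
    refine Fin.addCases (fun i => ?_) (fun i => ?_) i
    · simpa using hu i
    · simpa using hv i
  | neg x _ hx =>
    obtain ⟨k, u, hu, rfl⟩ := hx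
    exact ⟨k, fun i => -u i, fun i => by simpa using hu i, by simp [of_neg]⟩

omit [DecidableEq ι] in
open WittQ in
lemma sub_sum_notMem_unitSub [Nonempty J] {p : ℕ} (hp : p.Prime) {E : Matrix κ κ ℤ}
    (hE : ¬ (p : ℤ) ∣ E.det) {f : ι → ℚ} (hf : Isom (diagForm f) (ratForm E)) {a : J → ℤ}
    (ha : ∀ r : J → ℤ, (p : ℤ) ∣ ∑ j, a j * r j ^ 2 → ∀ j, (p : ℤ) ∣ r j) :
    ∑ i, of (f i) - ∑ j, of ((p * a j : ℤ) : ℚ) ∉ unitSub p := by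
  intro h
  have := Fact.mk hp
  obtain ⟨k, u, hu, h⟩ := exists_eq_sum_of_mem_unitSub h
  have h0 : ∑ i, of (Sum.elim (Sum.elim f fun i => ((-u i : ℤ) : ℚ))
      (fun j => ((p * -a j : ℤ) : ℚ)) i) = 0 := by
    simp only [Fintype.sum_sum_type, Sum.elim_inl, Sum.elim_inr]
    have e1 : ∀ i, of ((-u i : ℤ) : ℚ) = -of (u i) := fun i => by rw [Int.cast_neg, of_neg]
    have e2 : ∀ j, of ((p * -a j : ℤ) : ℚ) = -of ((p * a j : ℤ) : ℚ) := fun j => by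
      rw [mul_neg, Int.cast_neg, of_neg]
    simp only [e1, e2, Finset.sum_neg_distrib, ← h]
    abel
  have hm := met_of_sum_of_eq_zero _ h0
  refine not_metabolic_of_anisotropic (F := Matrix.fromBlocks E 0 0 (Matrix.diagonal fun i => -u i))
    (a := fun j => -a j) (p := p) ?_ ?_ ?_
  · rw [Matrix.det_fromBlocks_zero₂₁, Matrix.det_diagonal]
    have hpp := Nat.prime_iff_prime_int.mp hp
    intro h
    rcases hpp.dvd_or_dvd h with h | h
    · exact hE h
    · obtain ⟨i, -, hi⟩ := (hpp.dvd_finsetProd_iff _).mp h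
      exact hu i (by simpa using hi)
  · intro r hr
    refine ha r ?_
    simpa [Finset.sum_neg_distrib] using hr
  · refine Isom.metabolic ?_ hm
    refine (isom_diagForm_sumElim _ _).trans (.trans (.prod ?_ ?_)
      (isom_ratForm_fromBlocks _ _).symm)
    · exact (isom_diagForm_sumElim _ _).trans (.trans (.prod hf (isom_ratForm_diagonal _).symm)
        (isom_ratForm_fromBlocks _ _).symm)
    · exact (isom_ratForm_diagonal _).symm

omit [DecidableEq ι] in
/-- A form which is unimodular at `p` is unramified at `p`. -/
theorem unramified_of_isom {p : ℕ} (hp : p.Prime) {E : Matrix κ κ ℤ}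
    (hE : ¬ (p : ℤ) ∣ E.det) {f : ι → ℚ} (hf : Isom (diagForm f) (ratForm E)) :
    WittQ.Unramified p (∑ i, WittQ.of (f i)) := by
  have := Fact.mk hp
  have hpp := Nat.prime_iff_prime_int.mp hp
  constructor
  · intro a ha
    have := sub_sum_notMem_unitSub (a := ![a]) hp hE hf (fun r hr j => by
      simp only [Finset.univ_unique, Fin.default_eq_zero, Finset.sum_singleton,
        Matrix.cons_val_zero] at hr
      rw [Subsingleton.elim j 0]
      exact hpp.dvd_of_dvd_pow ((hpp.dvd_or_dvd hr).resolve_left ha))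
    simpa using this
  · intro _ a b ha hb hab
    have := sub_sum_notMem_unitSub (a := ![a, b]) hp hE hf (fun r hr => by
      simp only [Fin.sum_univ_two, Matrix.cons_val_zero, Matrix.cons_val_one] at hr
      have h1 : (p : ℤ) ∣ r 1 := by
        by_contra h1
        refine hab ⟨a * r 0 / r 1, ?_⟩
        rw [← ZMod.intCast_zmod_eq_zero_iff_dvd] at hr h1
        push_cast at hr
        field_simp
        linear_combination (-a : ZMod p) * hr
      have h0 : (p : ℤ) ∣ r 0 := by
        have : (p : ℤ) ∣ a * r 0 ^ 2 :=
          (dvd_add_left ((h1.trans (dvd_pow_self _ two_ne_zero)).mul_left b)).mp hr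
        exact hpp.dvd_of_dvd_pow ((hpp.dvd_or_dvd this).resolve_left ha)
      intro j
      fin_cases j
      exacts [h0, h1])
    simpa [Fin.sum_univ_two, sub_sub] using this

lemma unramified_of_mem_unitSub {p : ℕ} (hp : p.Prime) {x : WittQ} (hx : x ∈ WittQ.unitSub p) :
    WittQ.Unramified p x := by
  obtain ⟨k, u, hu, rfl⟩ := exists_eq_sum_of_mem_unitSub hx
  refine unramified_of_isom (E := Matrix.diagonal u) hp ?_ (isom_ratForm_diagonal u).symm
  rw [Matrix.det_diagonal]
  intro h
  obtain ⟨i, -, hi⟩ := ((Nat.prime_iff_prime_int.mp hp).dvd_finsetProd_iff _).mp h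
  exact hu i hi

end

namespace WittQ

section

variable {p : ℕ} [hp : Fact p.Prime]

lemma mk_of_eq_residue_unitSub {m : ℤ} (hm : ¬ (p : ℤ) ∣ m) :
    (QuotientAddGroup.mk (of ((p * m : ℤ) : ℚ)) : WittQ ⧸ unitSub p) =
      residue p (unitSub p) m := by
  have hpp := Nat.prime_iff_prime_int.mp hp.out
  have aux : ∀ {m r l : ℤ}, m = r + p * l → ¬ (p : ℤ) ∣ m → ¬ (p : ℤ) ∣ l →
      of ((p * m : ℤ) : ℚ) - of ((p * r : ℤ) : ℚ) ∈ unitSub p := by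
    intro m r l h hm hl
    have hr : ¬ (p : ℤ) ∣ r := fun hr => hm (h ▸ dvd_add hr (dvd_mul_right _ _))
    refine of_mul_prime_sub_mem_aux hp.out.ne_zero _ h (of_mem_unitSub hl) ?_
    refine of_mem_unitSub fun hd => ?_
    rcases hpp.dvd_or_dvd hd with hd | hd
    · rcases hpp.dvd_or_dvd hd with hd | hd <;> contradiction
    · contradiction
  rw [residue, QuotientAddGroup.eq_iff_sub_mem]
  set r : ℤ := ((m : ZMod p).val : ℤ) with hr
  obtain ⟨l, hl⟩ : (p : ℤ) ∣ m - r := by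
    rw [← ZMod.intCast_zmod_eq_zero_iff_dvd]; simp [hr]
  by_cases hpl : (p : ℤ) ∣ l
  · have h1 : of ((p * m : ℤ) : ℚ) - of ((p * (r + p) : ℤ) : ℚ) ∈ unitSub p :=
      aux (l := l - 1) (by linear_combination hl) hm fun h =>
        hpp.not_dvd_one (by simpa using dvd_sub hpl h)
    have h2 : of ((p * (r + p) : ℤ) : ℚ) - of ((p * r : ℤ) : ℚ) ∈ unitSub p :=
      aux (l := 1) (by ring) (fun h => hm (by
        have : m = (r + p) + p * (l - 1) := by linear_combination hl
        rw [this]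
        exact dvd_add h (dvd_mul_right _ _))) hpp.not_dvd_one
    simpa using add_mem h1 h2
  · exact aux (by linear_combination hl) hm hpl

lemma residue_add_eq_zero (hp2 : p ≠ 2) {a b c d : ℤ} (ha : ¬ (p : ℤ) ∣ a) (hb : ¬ (p : ℤ) ∣ b)
    (hc : ¬ (p : ℤ) ∣ c) (hd : ¬ (p : ℤ) ∣ d) {s : ℤ} (h : a * b * c * d = s ^ 2) :
    residue p (unitSub p) a + residue p (unitSub p) b + residue p (unitSub p) c +
      residue p (unitSub p) d = 0 := by
  have hW := isWittMap_residue (smoothSub_le_unitSub hp.out)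
  rw [← ZMod.intCast_zmod_eq_zero_iff_dvd] at ha hb hc hd
  refine hW.add_add_add_eq_zero (by rwa [ZMod.ringChar_zmod_n]) ha hb hc hd ⟨s, ?_⟩
  rw [← sq]
  exact_mod_cast congrArg (Int.cast : ℤ → ZMod p) h

lemma residue_sub_eq_zero (hp2 : p ≠ 2) {a b c d : ℤ} (ha : ¬ (p : ℤ) ∣ a) (hb : ¬ (p : ℤ) ∣ b)
    (hc : ¬ (p : ℤ) ∣ c) (hd : ¬ (p : ℤ) ∣ d) {s : ℤ} (h : a * b * c * d = s ^ 2) :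
    residue p (unitSub p) a + residue p (unitSub p) b - residue p (unitSub p) c -
      residue p (unitSub p) d = 0 := by
  have hW := isWittMap_residue (smoothSub_le_unitSub hp.out)
  have := residue_add_eq_zero hp2 ha hb (c := -c) (d := -d) (by simpa using hc) (by simpa using hd)
    (s := s) (by linear_combination h)
  rw [Int.cast_neg, Int.cast_neg, hW.map_neg, hW.map_neg] at this
  rw [← this]
  abel

lemma mk_of_pow_mul {e : ℕ} {m s : ℤ} (hm : ¬ (p : ℤ) ∣ m) (hs : s ≠ 0) :
    (QuotientAddGroup.mk (of ((p ^ e * m * s ^ 2 : ℤ) : ℚ)) : WittQ ⧸ unitSub p) =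
      if Even e then 0 else residue p (unitSub p) m := by
  have hp0 : (p : ℤ) ≠ 0 := by exact_mod_cast hp.out.ne_zero
  rw [of_int_mul_sq _ hs]
  split_ifs with he
  · obtain ⟨k, rfl⟩ := he
    rw [show (p : ℤ) ^ (k + k) * m = m * (p ^ k) ^ 2 by ring,
      of_int_mul_sq _ (pow_ne_zero _ hp0), QuotientAddGroup.eq_zero_iff]
    exact of_mem_unitSub hm
  · obtain ⟨k, rfl⟩ := Nat.not_even_iff_odd.mp he
    rw [show (p : ℤ) ^ (2 * k + 1) * m = p * m * (p ^ k) ^ 2 by ring,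
      of_int_mul_sq _ (pow_ne_zero _ hp0), mk_of_eq_residue_unitSub hm]

lemma exists_eq_pow_mul {a : ℤ} (ha : a ≠ 0) :
    ∃ (e : ℕ) (m s : ℤ), e < 2 ∧ ¬ (p : ℤ) ∣ m ∧ s ≠ 0 ∧ a = p ^ e * m * s ^ 2 := by
  obtain ⟨m, s, hm, hs, h | h, -⟩ := exists_of_eq hp.out ha
  · exact ⟨0, m, s, by omega, hm, hs, by simpa using h⟩
  · exact ⟨1, m, s, by omega, hm, hs, by simpa using h⟩

end

/-- The difference of the norm form with coefficients `c₁, c₂` and its multiple by `n`. -/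
def normDiff (c₁ c₂ n : ℤ) : WittQ :=
  of (1 : ℤ) + of c₁ + of c₂ + of (c₁ * c₂ : ℤ) -
    (of n + of (n * c₁ : ℤ) + of (n * c₂ : ℤ) + of (n * (c₁ * c₂) : ℤ))

lemma normDiff_mem_unitSub {p : ℕ} [hp : Fact p.Prime] (hp2 : p ≠ 2) {c₁ c₂ n : ℤ} (h1 : c₁ ≠ 0)
    (h2 : c₂ ≠ 0) (hn : n ≠ 0) : normDiff c₁ c₂ n ∈ unitSub p := by
  have hpp := Nat.prime_iff_prime_int.mp hp.out
  have hmul : ∀ {a b : ℤ}, ¬ (p : ℤ) ∣ a → ¬ (p : ℤ) ∣ b → ¬ (p : ℤ) ∣ a * b := fun ha hb h =>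
    (hpp.dvd_or_dvd h).elim ha hb
  obtain ⟨e, m, s, he, hm, hs, rfl⟩ := exists_eq_pow_mul (p := p) h1
  obtain ⟨f, l, t, hf, hl, ht, rfl⟩ := exists_eq_pow_mul (p := p) h2
  obtain ⟨g, k, u, hg, hk, hu, rfl⟩ := exists_eq_pow_mul (p := p) hn
  have hp1 : ¬ (p : ℤ) ∣ 1 := hpp.not_dvd_one
  rw [← QuotientAddGroup.eq_zero_iff, normDiff]
  simp only [QuotientAddGroup.mk_sub, QuotientAddGroup.mk_add]
  rw [show (1 : ℤ) = p ^ 0 * 1 * 1 ^ 2 by ring,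
    show (p : ℤ) ^ e * m * s ^ 2 * (p ^ f * l * t ^ 2) = p ^ (e + f) * (m * l) * (s * t) ^ 2 by ring,
    show (p : ℤ) ^ g * k * u ^ 2 * (p ^ e * m * s ^ 2) = p ^ (g + e) * (k * m) * (u * s) ^ 2 by ring,
    show (p : ℤ) ^ g * k * u ^ 2 * (p ^ f * l * t ^ 2) = p ^ (g + f) * (k * l) * (u * t) ^ 2 by ring,
    show (p : ℤ) ^ g * k * u ^ 2 * (p ^ (e + f) * (m * l) * (s * t) ^ 2) =
      p ^ (g + (e + f)) * (k * (m * l)) * (u * (s * t)) ^ 2 by ring,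
    mk_of_pow_mul hp1 one_ne_zero, mk_of_pow_mul hm hs, mk_of_pow_mul hl ht, mk_of_pow_mul hk hu,
    mk_of_pow_mul (hmul hm hl) (mul_ne_zero hs ht), mk_of_pow_mul (hmul hk hm) (mul_ne_zero hu hs),
    mk_of_pow_mul (hmul hk hl) (mul_ne_zero hu ht),
    mk_of_pow_mul (hmul hk (hmul hm hl)) (mul_ne_zero hu (mul_ne_zero hs ht))]
  have key : ∀ {a b c d : ℤ}, ¬ (p : ℤ) ∣ a → ¬ (p : ℤ) ∣ b → ¬ (p : ℤ) ∣ c → ¬ (p : ℤ) ∣ d →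
      ∀ s, a * b * c * d = s ^ 2 → residue p (unitSub p) a + residue p (unitSub p) b -
        residue p (unitSub p) c - residue p (unitSub p) d = 0 :=
    fun ha hb hc hd s h => residue_sub_eq_zero hp2 ha hb hc hd h
  interval_cases e <;> interval_cases f <;> interval_cases g <;>
    simp only [Nat.reduceAdd, if_true, if_false, Nat.even_iff, Nat.reduceMod,
      zero_add, add_zero, Nat.one_ne_zero, sub_self, Nat.zero_mod]
  · rw [residue_add_eq_zero hp2 hk (hmul hk hm) (hmul hk hl) (hmul hk (hmul hm hl))
      (s := k ^ 2 * m * l) (by ring), sub_zero]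
    abel
  · exact Eq.trans (by abel)
      (key hl (hmul hm hl) (hmul hk hl) (hmul hk (hmul hm hl)) (k * m * l ^ 2) (by ring))
  · exact Eq.trans (by abel) (key hl (hmul hm hl) hk (hmul hk hm) (k * m * l) (by ring))
  · exact Eq.trans (by abel)
      (key hm (hmul hm hl) (hmul hk hm) (hmul hk (hmul hm hl)) (k * m ^ 2 * l) (by ring))
  · exact Eq.trans (by abel) (key hm (hmul hm hl) hk (hmul hk hl) (k * m * l) (by ring))
  · exact Eq.trans (by abel) (key hm hl (hmul hk hm) (hmul hk hl) (k * m * l) (by ring))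
  · exact Eq.trans (by abel) (key hm hl hk (hmul hk (hmul hm hl)) (k * m * l) (by ring))

lemma parity_mem_unitSub {p : ℕ} [hp : Fact p.Prime] {x : WittQ} (hx : x ∈ unitSub p) :
    parity p x = 0 := by
  have : unitSub p ≤ (parity p).ker := by
    rw [unitSub, AddSubgroup.closure_le]
    rintro x ⟨a, ha, rfl⟩
    change parity p (of a) = 0
    rw [parity_of, padicValRat.of_int, padicValInt.eq_zero_of_not_dvd ha]
    rfl
  exact this hx

lemma normDiff_eq_zero {c₁ c₂ n : ℤ} (h1 : c₁ ≠ 0) (h2 : c₂ ≠ 0) (hn : 0 < n) :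
    normDiff c₁ c₂ n = 0 := by
  apply eq_zero_of_unramified
  · have hn' : (0 : ℚ) < n := by exact_mod_cast hn
    simp only [normDiff, map_add, map_sub, sig_of, Int.cast_mul, sign_mul, sign_pos hn', one_mul,
      Int.cast_one, sign_one]
    simp
  · intro p hp
    have := Fact.mk hp
    by_cases hp2 : p = 2
    · refine ⟨fun a ha h => ?_, fun h => absurd hp2 h⟩
      have h' := parity_mem_unitSub h
      have hp0 : (p : ℚ) ≠ 0 := by exact_mod_cast hp.ne_zero
      have ha0 : (a : ℚ) ≠ 0 := by rintro h; apply ha; simp_all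
      have h1' : (c₁ : ℚ) ≠ 0 := by exact_mod_cast h1
      have h2' : (c₂ : ℚ) ≠ 0 := by exact_mod_cast h2
      have hn' : (n : ℚ) ≠ 0 := by exact_mod_cast hn.ne'
      have hv : padicValRat p (a : ℚ) = 0 := by
        rw [padicValRat.of_int, padicValInt.eq_zero_of_not_dvd ha]; rfl
      have hvp : padicValRat p (p : ℚ) = 1 := by
        rw [padicValRat.of_nat, padicValNat_self]; rfl
      rw [normDiff] at h'
      simp only [map_add, map_sub, parity_of, Int.cast_mul, Int.cast_natCast] at h'
      rw [padicValRat.mul hp0 ha0, padicValRat.mul h1' h2', padicValRat.mul hn' h1',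
        padicValRat.mul hn' h2', padicValRat.mul hn' (mul_ne_zero h1' h2'),
        padicValRat.mul h1' h2', hv, hvp, Int.cast_one, padicValRat.one] at h'
      push_cast at h'
      generalize (padicValRat p (c₁ : ℚ) : ZMod 2) = x at h'
      generalize (padicValRat p (c₂ : ℚ) : ZMod 2) = y at h'
      generalize (padicValRat p (n : ℚ) : ZMod 2) = z at h'
      revert x y z
      decide
    · exact unramified_of_mem_unitSub hp (normDiff_mem_unitSub hp2 h1 h2 hn.ne')

end WittQ

open WittQ in
/-- Every positive integer is a quotient of two values of a norm form. -/
theorem exists_norm_eq_mul_norm {c₁ c₂ n : ℤ} (h1 : c₁ ≠ 0) (h2 : c₂ ≠ 0) (hn : 0 < n) :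
    ∃ x y : Fin 4 → ℤ, (x ≠ 0 ∨ y ≠ 0) ∧
      x 0 ^ 2 + c₁ * x 1 ^ 2 + c₂ * x 2 ^ 2 + c₁ * c₂ * x 3 ^ 2 =
        n * (y 0 ^ 2 + c₁ * y 1 ^ 2 + c₂ * y 2 ^ 2 + c₁ * c₂ * y 3 ^ 2) := by
  have h := normDiff_eq_zero h1 h2 hn
  set f : Fin 4 → ℤ := ![1, c₁, c₂, c₁ * c₂] with hf
  set g : Fin 4 → ℤ := ![-n, -(n * c₁), -(n * c₂), -(n * (c₁ * c₂))] with hg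
  obtain ⟨Λ, hΛ⟩ := met_of_sum_of_eq_zero (fun i => ((Sum.elim f g i : ℤ) : ℚ)) (by
    rw [← h, normDiff]
    simp only [Fintype.sum_sum_type, Sum.elim_inl, Sum.elim_inr, Fin.sum_univ_four, hf, hg,
      Matrix.cons_val, Int.cast_neg, of_neg]
    abel)
  have hΛ0 : Λ ≠ ⊥ := by
    rintro rfl
    rw [LinearMap.BilinForm.orthogonal_bot] at hΛ
    exact top_ne_bot hΛ
  obtain ⟨v, hv, hv0⟩ := Submodule.exists_mem_ne_zero_of_ne_bot hΛ0
  obtain ⟨d, hd, w, hw⟩ := exists_smul_eq_castVec v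
  have hd' : (d : ℚ) ≠ 0 := by exact_mod_cast hd
  have hwΛ : castVec _ w ∈ Λ := hw ▸ Λ.smul_mem _ hv
  have hw0 : w ≠ 0 := by
    rintro rfl
    rw [map_zero] at hw
    exact hv0 ((smul_eq_zero.mp hw).resolve_left hd')
  have hq : diagForm (fun i => ((Sum.elim f g i : ℤ) : ℚ)) (castVec _ w) (castVec _ w) = 0 :=
    (hΛ.symm ▸ hwΛ : castVec _ w ∈ (diagForm fun i => ((Sum.elim f g i : ℤ) : ℚ)).orthogonal Λ)
      _ hwΛ
  refine ⟨fun i => w (.inl i), fun i => w (.inr i), ?_, ?_⟩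
  · by_contra! hc
    apply hw0
    ext (i | i)
    exacts [congrFun hc.1 i, congrFun hc.2 i]
  · simp only [diagForm_apply, castVec_apply, Fintype.sum_sum_type, Sum.elim_inl, Sum.elim_inr,
      Fin.sum_univ_four, hf, hg, Matrix.cons_val] at hq
    have : ((w (.inl 0) ^ 2 + c₁ * w (.inl 1) ^ 2 + c₂ * w (.inl 2) ^ 2 +
      c₁ * c₂ * w (.inl 3) ^ 2 : ℤ) : ℚ) = ((n * (w (.inr 0) ^ 2 + c₁ * w (.inr 1) ^ 2 +
        c₂ * w (.inr 2) ^ 2 + c₁ * c₂ * w (.inr 3) ^ 2) : ℤ) : ℚ) := by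
      push_cast at hq ⊢
      linear_combination hq
    exact_mod_cast this

/-- Coefficients of a ternary quadratic form
`a x² + b y² + c z² + u y z + v x z + w x y`. -/
structure TernaryForm (R : Type*) where
  (a b c u v w : R)

namespace TernaryForm

variable {R S : Type*} [CommRing R] [CommRing S]

/-- The value of the ternary form. -/
def val (t : TernaryForm R) (x : Fin 3 → R) : R :=
  t.a * x 0 ^ 2 + t.b * x 1 ^ 2 + t.c * x 2 ^ 2 + t.u * (x 1 * x 2) + t.v * (x 0 * x 2) +
    t.w * (x 0 * x 1)

/-- The gradient of the ternary form, i.e. its Gram matrix applied to a vector. -/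
def grad (t : TernaryForm R) (x : Fin 3 → R) : Fin 3 → R :=
  ![2 * t.a * x 0 + t.w * x 1 + t.v * x 2, t.w * x 0 + 2 * t.b * x 1 + t.u * x 2,
    t.v * x 0 + t.u * x 1 + 2 * t.c * x 2]

/-- The polar bilinear form. -/
def polar (t : TernaryForm R) (x y : Fin 3 → R) : R :=
  x 0 * t.grad y 0 + x 1 * t.grad y 1 + x 2 * t.grad y 2

/-- The half-discriminant of a ternary form. -/
def disc (t : TernaryForm R) : R :=
  4 * t.a * t.b * t.c + t.u * t.v * t.w - t.a * t.u ^ 2 - t.b * t.v ^ 2 - t.c * t.w ^ 2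

/-- Base change of a ternary form. -/
def map (f : R →+* S) (t : TernaryForm R) : TernaryForm S :=
  ⟨f t.a, f t.b, f t.c, f t.u, f t.v, f t.w⟩

/-- The adjugate of the Gram matrix of a ternary form, applied to a vector. -/
def adjGrad (t : TernaryForm R) (x : Fin 3 → R) : Fin 3 → R :=
  ![(4 * t.b * t.c - t.u ^ 2) * x 0 + (t.u * t.v - 2 * t.c * t.w) * x 1 +
      (t.u * t.w - 2 * t.b * t.v) * x 2,
    (t.u * t.v - 2 * t.c * t.w) * x 0 + (4 * t.a * t.c - t.v ^ 2) * x 1 +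
      (t.v * t.w - 2 * t.a * t.u) * x 2,
    (t.u * t.w - 2 * t.b * t.v) * x 0 + (t.v * t.w - 2 * t.a * t.u) * x 1 +
      (4 * t.a * t.b - t.w ^ 2) * x 2]

lemma grad_adjGrad (t : TernaryForm R) (x : Fin 3 → R) :
    t.grad (t.adjGrad x) = (2 * t.disc) • x := by
  ext i; fin_cases i <;> simp [grad, adjGrad, disc] <;> ring

lemma adjGrad_grad (t : TernaryForm R) (x : Fin 3 → R) :
    t.adjGrad (t.grad x) = (2 * t.disc) • x := by
  ext i; fin_cases i <;> simp [grad, adjGrad, disc] <;> ring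

lemma val_add (t : TernaryForm R) (x y : Fin 3 → R) :
    t.val (x + y) = t.val x + t.polar x y + t.val y := by
  simp [val, polar, grad]; ring

end TernaryForm

/-- The even Clifford algebra of a ternary quadratic form, with basis `1, e₂e₃, e₃e₁, e₁e₂`. -/
@[ext] structure EvenClifford {R : Type*} (t : TernaryForm R) where
  (re i j k : R)

namespace EvenClifford

variable {R S : Type*} [CommRing R] [CommRing S] {t : TernaryForm R}

instance : Zero (EvenClifford t) := ⟨⟨0, 0, 0, 0⟩⟩
instance : One (EvenClifford t) := ⟨⟨1, 0, 0, 0⟩⟩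
instance : Add (EvenClifford t) := ⟨fun x y => ⟨x.re + y.re, x.i + y.i, x.j + y.j, x.k + y.k⟩⟩
instance : Neg (EvenClifford t) := ⟨fun x => ⟨-x.re, -x.i, -x.j, -x.k⟩⟩
instance : Sub (EvenClifford t) := ⟨fun x y => ⟨x.re - y.re, x.i - y.i, x.j - y.j, x.k - y.k⟩⟩
instance : SMul R (EvenClifford t) := ⟨fun r x => ⟨r * x.re, r * x.i, r * x.j, r * x.k⟩⟩
instance : Mul (EvenClifford t) := ⟨fun x y =>
  ⟨x.re * y.re - t.b * t.c * (x.i * y.i) - t.a * t.c * (x.j * y.j) - t.a * t.b * (x.k * y.k)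
      + t.a * t.u * (x.j * y.k) - t.w * t.v * (x.k * y.j)
      + t.b * t.v * (x.k * y.i) - t.u * t.w * (x.i * y.k)
      + t.c * t.w * (x.i * y.j) - t.u * t.v * (x.j * y.i),
    x.re * y.i + x.i * y.re + t.u * (x.i * y.i) - t.a * (x.j * y.k) + t.a * (x.k * y.j)
      + t.w * (x.i * y.k) + t.v * (x.j * y.i),
    x.re * y.j + x.j * y.re + t.v * (x.j * y.j) - t.b * (x.k * y.i) + t.b * (x.i * y.k)
      + t.w * (x.k * y.j) + t.u * (x.j * y.i),
    x.re * y.k + x.k * y.re + t.w * (x.k * y.k) - t.c * (x.i * y.j) + t.c * (x.j * y.i)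
      + t.v * (x.k * y.j) + t.u * (x.i * y.k)⟩⟩

lemma zero_def : (0 : EvenClifford t) = ⟨0, 0, 0, 0⟩ := rfl
lemma one_def : (1 : EvenClifford t) = ⟨1, 0, 0, 0⟩ := rfl
lemma add_def (x y : EvenClifford t) :
    x + y = ⟨x.re + y.re, x.i + y.i, x.j + y.j, x.k + y.k⟩ := rfl
lemma neg_def (x : EvenClifford t) : -x = ⟨-x.re, -x.i, -x.j, -x.k⟩ := rfl
lemma sub_def (x y : EvenClifford t) :
    x - y = ⟨x.re - y.re, x.i - y.i, x.j - y.j, x.k - y.k⟩ := rfl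
lemma smul_def (r : R) (x : EvenClifford t) :
    r • x = ⟨r * x.re, r * x.i, r * x.j, r * x.k⟩ := rfl
lemma mul_def (x y : EvenClifford t) : x * y =
  ⟨x.re * y.re - t.b * t.c * (x.i * y.i) - t.a * t.c * (x.j * y.j) - t.a * t.b * (x.k * y.k)
      + t.a * t.u * (x.j * y.k) - t.w * t.v * (x.k * y.j)
      + t.b * t.v * (x.k * y.i) - t.u * t.w * (x.i * y.k)
      + t.c * t.w * (x.i * y.j) - t.u * t.v * (x.j * y.i),
    x.re * y.i + x.i * y.re + t.u * (x.i * y.i) - t.a * (x.j * y.k) + t.a * (x.k * y.j)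
      + t.w * (x.i * y.k) + t.v * (x.j * y.i),
    x.re * y.j + x.j * y.re + t.v * (x.j * y.j) - t.b * (x.k * y.i) + t.b * (x.i * y.k)
      + t.w * (x.k * y.j) + t.u * (x.j * y.i),
    x.re * y.k + x.k * y.re + t.w * (x.k * y.k) - t.c * (x.i * y.j) + t.c * (x.j * y.i)
      + t.v * (x.k * y.j) + t.u * (x.i * y.k)⟩ := rfl

instance : AddCommGroup (EvenClifford t) where
  add_assoc x y z := by simp only [add_def, add_assoc]
  zero_add x := by simp only [add_def, zero_def, zero_add]
  add_zero x := by simp only [add_def, zero_def, add_zero]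
  add_comm x y := by simp only [add_def, add_comm]
  neg_add_cancel x := by simp only [add_def, neg_def, zero_def, neg_add_cancel]
  sub_eq_add_neg x y := by simp only [add_def, neg_def, sub_def, sub_eq_add_neg]
  nsmul := nsmulRec
  zsmul n x := ⟨n • x.re, n • x.i, n • x.j, n • x.k⟩
  zsmul_zero' x := EvenClifford.ext (SubNegMonoid.zsmul_zero' _) (SubNegMonoid.zsmul_zero' _)
    (SubNegMonoid.zsmul_zero' _) (SubNegMonoid.zsmul_zero' _)
  zsmul_succ' n x := EvenClifford.ext (SubNegMonoid.zsmul_succ' n _) (SubNegMonoid.zsmul_succ' n _)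
    (SubNegMonoid.zsmul_succ' n _) (SubNegMonoid.zsmul_succ' n _)
  zsmul_neg' n x := EvenClifford.ext (SubNegMonoid.zsmul_neg' n _) (SubNegMonoid.zsmul_neg' n _)
    (SubNegMonoid.zsmul_neg' n _) (SubNegMonoid.zsmul_neg' n _)

instance : Ring (EvenClifford t) where
  left_distrib x y z := by ext <;> simp only [add_def, mul_def] <;> ring
  right_distrib x y z := by ext <;> simp only [add_def, mul_def] <;> ring
  zero_mul x := by ext <;> simp [zero_def, mul_def]
  mul_zero x := by ext <;> simp [zero_def, mul_def]
  mul_assoc x y z := by ext <;> simp only [mul_def] <;> ring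
  one_mul x := by ext <;> simp [one_def, mul_def]
  mul_one x := by ext <;> simp [one_def, mul_def]
  __ := (inferInstance : AddCommGroup (EvenClifford t))

instance : Module R (EvenClifford t) where
  one_smul x := by ext <;> simp [smul_def]
  mul_smul r s x := by ext <;> simp only [smul_def] <;> ring
  smul_zero r := by ext <;> simp [smul_def, zero_def]
  smul_add r x y := by ext <;> simp only [smul_def, add_def] <;> ring
  add_smul r s x := by ext <;> simp only [smul_def, add_def] <;> ring
  zero_smul x := by ext <;> simp [smul_def, zero_def]

instance : Algebra R (EvenClifford t) :=
  Algebra.ofModule (fun r x y => by ext <;> simp only [smul_def, mul_def] <;> ring)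
    (fun r x y => by ext <;> simp only [smul_def, mul_def] <;> ring)

/-- Conjugation. -/
def conj (x : EvenClifford t) : EvenClifford t :=
  ⟨x.re + t.u * x.i + t.v * x.j + t.w * x.k, -x.i, -x.j, -x.k⟩

/-- The reduced trace. -/
def trd (x : EvenClifford t) : R := 2 * x.re + t.u * x.i + t.v * x.j + t.w * x.k

/-- The reduced norm. -/
def nrd (x : EvenClifford t) : R := (x * x.conj).re

/-- The vector `η ξ = ξ₀ e₂e₃ + ξ₁ e₃e₁ + ξ₂ e₁e₂`. -/
def ofDual (t : TernaryForm R) (ξ : Fin 3 → R) : EvenClifford t := ⟨0, ξ 0, ξ 1, ξ 2⟩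

/-- The embedding of the ternary space in the trace zero elements. -/
def ofVec (t : TernaryForm R) (x : Fin 3 → R) : EvenClifford t :=
  ⟨-((t.a * t.u + t.v * t.w) * x 0 + (t.b * t.v + t.u * t.w) * x 1 +
      (t.c * t.w + t.u * t.v) * x 2), t.grad x 0, t.grad x 1, t.grad x 2⟩

/-- The Clifford product of two vectors. -/
def vecMul (t : TernaryForm R) (x y : Fin 3 → R) : EvenClifford t :=
  ⟨t.a * (x 0 * y 0) + t.b * (x 1 * y 1) + t.c * (x 2 * y 2) + t.w * (x 1 * y 0) +
      t.u * (x 2 * y 1) + t.v * (x 0 * y 2),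
    x 1 * y 2 - x 2 * y 1, x 2 * y 0 - x 0 * y 2, x 0 * y 1 - x 1 * y 0⟩

lemma mul_conj (x : EvenClifford t) : x * x.conj = x.nrd • 1 := by
  ext <;> simp only [nrd, conj, mul_def, smul_def, one_def] <;> ring

lemma conj_mul_self (x : EvenClifford t) : x.conj * x = x.nrd • 1 := by
  ext <;> simp only [nrd, conj, mul_def, smul_def, one_def] <;> ring

lemma conj_mul (x y : EvenClifford t) : (x * y).conj = y.conj * x.conj := by
  ext <;> simp only [conj, mul_def] <;> ring

lemma conj_conj (x : EvenClifford t) : x.conj.conj = x := by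
  ext <;> simp only [conj] <;> ring

lemma conj_eq (x : EvenClifford t) : x.conj = x.trd • 1 - x := by
  ext <;> simp only [conj, trd, sub_def, smul_def, one_def] <;> ring

lemma conj_add (x y : EvenClifford t) : (x + y).conj = x.conj + y.conj := by
  ext <;> simp only [conj, add_def] <;> ring

lemma conj_smul (r : R) (x : EvenClifford t) : (r • x).conj = r • x.conj := by
  ext <;> simp only [conj, smul_def] <;> ring

lemma conj_one : (1 : EvenClifford t).conj = 1 := by
  ext <;> simp [conj, one_def]

lemma trd_add (x y : EvenClifford t) : (x + y).trd = x.trd + y.trd := by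
  simp only [trd, add_def]; ring

lemma trd_sub (x y : EvenClifford t) : (x - y).trd = x.trd - y.trd := by
  simp only [trd, sub_def]; ring

lemma trd_smul (r : R) (x : EvenClifford t) : (r • x).trd = r * x.trd := by
  simp only [trd, smul_def]; ring

lemma trd_one : (1 : EvenClifford t).trd = 2 := by simp [trd, one_def]

lemma trd_zero : (0 : EvenClifford t).trd = 0 := by simp [trd, zero_def]

lemma trd_mul_comm (x y : EvenClifford t) : (x * y).trd = (y * x).trd := by
  simp only [trd, mul_def]; ring

lemma trd_conj (x : EvenClifford t) : x.conj.trd = x.trd := by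
  simp only [trd, conj]; ring

lemma nrd_mul (x y : EvenClifford t) : (x * y).nrd = x.nrd * y.nrd := by
  simp only [nrd, conj, mul_def]; ring

lemma nrd_conj (x : EvenClifford t) : x.conj.nrd = x.nrd := by
  simp only [nrd, conj, mul_def]; ring

lemma nrd_one : (1 : EvenClifford t).nrd = 1 := by simp [nrd, conj, mul_def, one_def]

lemma nrd_smul (r : R) (x : EvenClifford t) : (r • x).nrd = r ^ 2 * x.nrd := by
  simp only [nrd, conj, mul_def, smul_def]; ring

lemma nrd_add (x y : EvenClifford t) : (x + y).nrd = x.nrd + (x * y.conj).trd + y.nrd := by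
  simp only [nrd, conj, mul_def, add_def, trd]; ring

lemma mul_mul_self (x y : EvenClifford t) :
    x * y * x = (x * y).trd • x - x.nrd • y.conj := by
  ext <;> simp only [nrd, conj, mul_def, smul_def, trd, sub_def] <;> ring

lemma trd_ofVec (x : Fin 3 → R) : (ofVec t x).trd = 0 := by
  simp [trd, ofVec, TernaryForm.grad]; ring

lemma nrd_ofVec (x : Fin 3 → R) : (ofVec t x).nrd = t.disc * t.val x := by
  simp [nrd, ofVec, TernaryForm.grad, TernaryForm.disc, TernaryForm.val, mul_def, conj]; ring

lemma trd_ofDual_mul_conj_ofVec (ξ x : Fin 3 → R) :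
    (ofDual t ξ * (ofVec t x).conj).trd = t.disc * (x 0 * ξ 0 + x 1 * ξ 1 + x 2 * ξ 2) := by
  simp [trd, ofVec, ofDual, TernaryForm.grad, TernaryForm.disc, mul_def, conj]; ring

lemma nrd_vecMul (x y : Fin 3 → R) : (vecMul t x y).nrd = t.val x * t.val y := by
  simp [nrd, vecMul, TernaryForm.val, mul_def, conj]; ring

lemma vecMul_conjugation (x y ξ : Fin 3 → R) :
    vecMul t x y * ofDual t ξ * (vecMul t x y).conj - (t.val x * t.val y) • ofDual t ξ =
      ofVec t (-(t.val y * (x 0 * ξ 0 + x 1 * ξ 1 + x 2 * ξ 2)) • x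
        - (t.val x * (y 0 * ξ 0 + y 1 * ξ 1 + y 2 * ξ 2)) • y
        + (t.polar x y * (y 0 * ξ 0 + y 1 * ξ 1 + y 2 * ξ 2)) • x) := by
  ext <;> simp [vecMul, ofDual, ofVec, conj, mul_def, sub_def, smul_def, TernaryForm.val,
    TernaryForm.polar, TernaryForm.grad] <;> ring

lemma nrd_zero : (0 : EvenClifford t).nrd = 0 := by simp [nrd, conj, mul_def, zero_def]

/-- Base change of the even Clifford algebra. -/
def mapHom (f : R →+* S) (t : TernaryForm R) : EvenClifford t →+* EvenClifford (t.map f) where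
  toFun x := ⟨f x.re, f x.i, f x.j, f x.k⟩
  map_one' := by ext <;> simp [one_def]
  map_zero' := by ext <;> simp [zero_def]
  map_add' x y := by ext <;> simp [add_def]
  map_mul' x y := by ext <;> simp only [mul_def] <;> simp [TernaryForm.map]

lemma mapHom_apply (f : R →+* S) (x : EvenClifford t) :
    mapHom f t x = ⟨f x.re, f x.i, f x.j, f x.k⟩ := rfl

lemma trd_mapHom (f : R →+* S) (x : EvenClifford t) : (mapHom f t x).trd = f x.trd := by
  change 2 * f x.re + f t.u * f x.i + f t.v * f x.j + f t.w * f x.k =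
    f (2 * x.re + t.u * x.i + t.v * x.j + t.w * x.k)
  simp [show f 2 = 2 from map_ofNat f 2]

lemma conj_mapHom (f : R →+* S) (x : EvenClifford t) :
    (mapHom f t x).conj = mapHom f t x.conj := by
  change (⟨f x.re + f t.u * f x.i + f t.v * f x.j + f t.w * f x.k, -f x.i, -f x.j, -f x.k⟩ :
    EvenClifford (t.map f)) = ⟨f (x.re + t.u * x.i + t.v * x.j + t.w * x.k), f (-x.i), f (-x.j),
      f (-x.k)⟩
  simp

lemma nrd_mapHom (f : R →+* S) (x : EvenClifford t) : (mapHom f t x).nrd = f x.nrd := by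
  rw [nrd, conj_mapHom, ← map_mul]; rfl

lemma mapHom_smul (f : R →+* S) (r : R) (x : EvenClifford t) :
    mapHom f t (r • x) = f r • mapHom f t x := by
  ext <;> simp [mapHom_apply, smul_def]

end EvenClifford

namespace EvenClifford

lemma eq_zero_of_trd_mul_eq_zero {R : Type*} [CommRing R] [IsDomain R] {t : TernaryForm R}
    (ht : t.disc ≠ 0) (y : EvenClifford t)
    (h : ∀ z, (y * z).trd = 0) : y = 0 := by
  have h0 := h 1
  have key : ∀ ξ, (ofDual t ξ * (ofVec t (![1, 0, 0])).conj).trd = t.disc * ξ 0 := by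
    intro ξ; rw [trd_ofDual_mul_conj_ofVec]; simp
  have e1 := h (ofVec t ![1, 0, 0]).conj
  have e2 := h (ofVec t ![0, 1, 0]).conj
  have e3 := h (ofVec t ![0, 0, 1]).conj
  have dec : y = y.re • 1 + ofDual t ![y.i, y.j, y.k] := by
    ext <;> simp [add_def, smul_def, one_def, ofDual]
  have aux : ∀ x : Fin 3 → R, (y * (ofVec t x).conj).trd =
      t.disc * (x 0 * y.i + x 1 * y.j + x 2 * y.k) := by
    intro x
    conv_lhs => rw [dec]
    rw [add_mul, trd_add, trd_ofDual_mul_conj_ofVec, smul_mul_assoc, one_mul, trd_smul, trd_conj,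
      trd_ofVec]
    simp
  rw [aux] at e1 e2 e3
  have hi : y.i = 0 := by simpa [ht] using e1
  have hj : y.j = 0 := by simpa [ht] using e2
  have hk : y.k = 0 := by simpa [ht] using e3
  by_cases h2 : (2 : R) = 0
  · have f1 := h (⟨0, 1, 0, 0⟩)
    have f2 := h (⟨0, 0, 1, 0⟩)
    have f3 := h (⟨0, 0, 0, 1⟩)
    simp [trd, mul_def, hi, hj, hk] at f1 f2 f3
    rcases f1 with f1 | f1
    · by_contra hy
      rcases f2 with f2 | f2
      · rcases f3 with f3 | f3
        · apply ht
          simp only [TernaryForm.disc, f1, f2, f3]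
          have : (4 : R) = 2 * 2 := by norm_num
          rw [this, h2]; ring
        · exact hy (by ext <;> simp [hi, hj, hk, f3, zero_def])
      · exact hy (by ext <;> simp [hi, hj, hk, f2, zero_def])
    · ext <;> simp [hi, hj, hk, f1, zero_def]
  · simp [trd, hi, hj, hk, h2] at h0
    ext <;> simp [hi, hj, hk, h0, zero_def]

section Field

variable {F : Type*} [Field F] {t : TernaryForm F}

lemma sq_eq_of_nrd_eq_zero {x : EvenClifford t} (h : x.nrd = 0) : x * x = x.trd • x := by
  have := mul_mul_self x 1
  simpa [h] using this

lemma exists_conj_mul_mul_ne_zero (ht : t.disc ≠ 0) {c : EvenClifford t} (hc : c.nrd = 0)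
    (hτ : c.trd ≠ 0) : ∃ g : EvenClifford t, c.conj * g * c ≠ 0 := by
  by_contra! H
  have hc0 : c ≠ 0 := by rintro rfl; exact hτ trd_zero
  have h1 : ∀ g, g * c = ((c * g).trd / c.trd) • c := by
    intro g
    have := H g
    rw [conj_eq, sub_mul, sub_mul, mul_mul_self, hc, smul_mul_assoc, one_mul, smul_mul_assoc,
      zero_smul, sub_zero, sub_eq_zero] at this
    rw [div_eq_inv_mul, mul_smul, ← this, smul_smul, inv_mul_cancel₀ hτ, one_smul]
  have h2 : ∀ g h, (g * h - h * g) * c = 0 := by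
    intro g h
    rw [sub_mul, mul_assoc, mul_assoc, h1 h, h1 g, mul_smul_comm, mul_smul_comm, h1 h, h1 g,
      smul_comm, sub_self]
  have h3 : ∀ x, ofVec t x * c = 0 := by
    intro x
    have e : ofVec t x = -(x 0 • ((⟨0, 0, 1, 0⟩ : EvenClifford t) * ⟨0, 0, 0, 1⟩ -
        (⟨0, 0, 0, 1⟩ : EvenClifford t) * ⟨0, 0, 1, 0⟩) +
        x 1 • ((⟨0, 0, 0, 1⟩ : EvenClifford t) * ⟨0, 1, 0, 0⟩ -
        (⟨0, 1, 0, 0⟩ : EvenClifford t) * ⟨0, 0, 0, 1⟩) +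
        x 2 • ((⟨0, 1, 0, 0⟩ : EvenClifford t) * ⟨0, 0, 1, 0⟩ -
        (⟨0, 0, 1, 0⟩ : EvenClifford t) * ⟨0, 1, 0, 0⟩)) := by
      ext <;> simp [ofVec, TernaryForm.grad, add_def, sub_def, neg_def, smul_def, mul_def] <;> ring
    rw [e, neg_mul, add_mul, add_mul, smul_mul_assoc, smul_mul_assoc, smul_mul_assoc, h2, h2, h2]
    simp
  have h4 : ∀ x, t.val x = 0 := by
    intro x
    have h5 : (ofVec t x).conj * (ofVec t x * c) = 0 := by rw [h3, mul_zero]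
    rw [← mul_assoc, conj_mul_self, nrd_ofVec, smul_mul_assoc, one_mul, smul_eq_zero] at h5
    rcases h5 with h5 | h5
    · exact (mul_eq_zero.mp h5).resolve_left ht
    · exact absurd h5 hc0
  have ha := h4 ![1, 0, 0]
  have hb := h4 ![0, 1, 0]
  have hc := h4 ![0, 0, 1]
  have hu := h4 ![0, 1, 1]
  have hv := h4 ![1, 0, 1]
  have hw := h4 ![1, 1, 0]
  simp [TernaryForm.val] at ha hb hc hu hv hw
  simp [ha, hb, hc] at hu hv hw
  apply ht
  simp [TernaryForm.disc, ha, hb, hc, hu]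

/-- The element used to twist `c`. -/
lemma exists_twist (ht : t.disc ≠ 0) {c : EvenClifford t} (hc : c.nrd = 0)
    (hτ : c.trd ≠ 0) : ∃ θ : EvenClifford t, θ.nrd = 0 ∧ θ.trd ≠ 0 ∧ θ.conj * c * θ ≠ 0 := by
  obtain ⟨g, hg⟩ := exists_conj_mul_mul_ne_zero ht hc hτ
  have hcc : c * c.conj = 0 := by rw [mul_conj, hc, zero_smul]
  have hcc' : c.conj * c = 0 := by rw [conj_mul_self, hc, zero_smul]
  refine ⟨c + c.conj * g.conj * c, ?_, ?_, ?_⟩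
  · rw [nrd_add, hc, nrd_mul, hc, conj_mul, conj_mul, conj_conj, conj_conj, ← mul_assoc, hcc]
    simp [trd_zero]
  · rw [trd_add, trd_mul_comm, ← mul_assoc, hcc]
    simpa [trd_zero] using hτ
  · rw [conj_add, conj_mul, conj_mul, conj_conj, conj_conj]
    have : (c.conj + c.conj * (g * c)) * c * (c + c.conj * g.conj * c) =
        (c.trd * c.trd) • (c.conj * g * c) := by
      have e1 : (c.conj + c.conj * (g * c)) * c = c.trd • (c.conj * g * c) := by
        rw [add_mul, hcc', zero_add, mul_assoc, mul_assoc, sq_eq_of_nrd_eq_zero hc, mul_smul_comm,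
          mul_smul_comm, ← mul_assoc]
      rw [e1, smul_mul_assoc, mul_add, mul_assoc _ c c, sq_eq_of_nrd_eq_zero hc]
      have e2 : c.conj * g * c * (c.conj * g.conj * c) = 0 := by
        rw [mul_assoc (c.conj * g), ← mul_assoc c, ← mul_assoc c, hcc]; simp
      rw [e2, add_zero, mul_smul_comm, smul_smul]
    rw [this]
    exact smul_ne_zero (mul_ne_zero hτ hτ) hg

lemma exists_pure (ht : t.disc ≠ 0) (h2 : (2 : F) ≠ 0) {s : EvenClifford t} (hs : s ≠ 0)
    (hs0 : s.trd = 0) (hs1 : s.nrd = 0) (δ : F) :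
    ∃ y : EvenClifford t, y.trd = 0 ∧ (s * y).trd ≠ 0 ∧ -y.nrd = δ := by
  obtain ⟨z, hz⟩ : ∃ z, (s * z).trd ≠ 0 := by
    by_contra! H; exact hs (eq_zero_of_trd_mul_eq_zero ht s H)
  have hss : s * s = 0 := by rw [sq_eq_of_nrd_eq_zero hs1, hs0, zero_smul]
  obtain ⟨y, hy0, hy⟩ : ∃ y : EvenClifford t, y.trd = 0 ∧ (s * y).trd ≠ 0 := by
    refine ⟨z - (z.trd / 2) • 1, ?_, ?_⟩
    · rw [trd_sub, trd_smul, trd_one]; field_simp; simp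
    · rw [mul_sub, trd_sub, mul_smul_comm, mul_one, trd_smul, hs0]; simpa using hz
  have hyc : y.conj = -y := by rw [conj_eq, hy0, zero_smul, zero_sub]
  refine ⟨((δ + y.nrd) / (s * y).trd) • s + y, ?_, ?_, ?_⟩
  · rw [trd_add, trd_smul, hs0, hy0]; simp
  · rw [mul_add, mul_smul_comm, hss]; simpa using hy
  · rw [nrd_add, nrd_smul, hs1, smul_mul_assoc, hyc, trd_smul, mul_neg, ← zero_sub (s * y), trd_sub,
      trd_zero]
    field_simp
    ring

end Field

end EvenClifford

namespace EvenClifford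

section Reduction

variable {t : TernaryForm ℤ} (p : ℕ)

/-- Reduction modulo `p`. -/
def red (p : ℕ) (t : TernaryForm ℤ) :
    EvenClifford t →+* EvenClifford (t.map (Int.castRingHom (ZMod p))) :=
  mapHom (Int.castRingHom (ZMod p)) t

lemma red_surjective : Function.Surjective (red p t) := by
  intro y
  obtain ⟨a, ha⟩ := ZMod.intCast_surjective y.re
  obtain ⟨b, hb⟩ := ZMod.intCast_surjective y.i
  obtain ⟨c, hc⟩ := ZMod.intCast_surjective y.j
  obtain ⟨d, hd⟩ := ZMod.intCast_surjective y.k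
  exact ⟨⟨a, b, c, d⟩, EvenClifford.ext ha hb hc hd⟩

lemma red_smul (r : ℤ) (x : EvenClifford t) : red p t (r • x) = (r : ZMod p) • red p t x :=
  mapHom_smul _ r x

lemma trd_red (x : EvenClifford t) : (red p t x).trd = (x.trd : ZMod p) := trd_mapHom _ x

lemma nrd_red (x : EvenClifford t) : (red p t x).nrd = (x.nrd : ZMod p) := nrd_mapHom _ x

lemma conj_red (x : EvenClifford t) : (red p t x).conj = red p t x.conj := conj_mapHom _ x

lemma red_natCast_smul (x : EvenClifford t) : red p t ((p : ℤ) • x) = 0 := by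
  rw [red_smul]; simp

lemma red_eq_zero_iff [NeZero p] (x : EvenClifford t) :
    red p t x = 0 ↔ ∃ y, x = (p : ℤ) • y := by
  constructor
  · intro h
    have h1 := congrArg EvenClifford.re h
    have h2 := congrArg EvenClifford.i h
    have h3 := congrArg EvenClifford.j h
    have h4 := congrArg EvenClifford.k h
    obtain ⟨a, ha⟩ := (ZMod.intCast_zmod_eq_zero_iff_dvd x.re p).mp h1
    obtain ⟨b, hb⟩ := (ZMod.intCast_zmod_eq_zero_iff_dvd x.i p).mp h2
    obtain ⟨c, hc⟩ := (ZMod.intCast_zmod_eq_zero_iff_dvd x.j p).mp h3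
    obtain ⟨d, hd⟩ := (ZMod.intCast_zmod_eq_zero_iff_dvd x.k p).mp h4
    exact ⟨⟨a, b, c, d⟩, EvenClifford.ext ha hb hc hd⟩
  · rintro ⟨y, rfl⟩; exact red_natCast_smul p y

lemma disc_map_ne_zero [NeZero p] (h : ¬ (p : ℤ) ∣ t.disc) :
    (t.map (Int.castRingHom (ZMod p))).disc ≠ 0 := by
  have : (t.map (Int.castRingHom (ZMod p))).disc = (t.disc : ZMod p) := by
    simp [TernaryForm.map, TernaryForm.disc]
  rwa [this, Ne, ZMod.intCast_zmod_eq_zero_iff_dvd]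

end Reduction

lemma exists_one_add_pow {A : Type*} [Ring A] (x : A) (N : ℕ) :
    ∃ z, (1 + x) ^ N = 1 + (N : ℤ) • x + x * x * z := by
  induction N with
  | zero => exact ⟨0, by simp⟩
  | succ N ih =>
    obtain ⟨z, hz⟩ := ih
    refine ⟨(N : ℤ) • 1 + z * (1 + x), ?_⟩
    rw [pow_succ, hz]
    push_cast
    simp only [mul_add, add_mul, mul_smul_comm, smul_mul_assoc, mul_one, one_mul, mul_assoc]
    module

variable {t : TernaryForm ℤ}

lemma nrd_one_add_smul (a : ℤ) (r : EvenClifford t) :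
    (1 + a • r).nrd = 1 + a * r.trd + a ^ 2 * r.nrd := by
  rw [nrd_add, nrd_smul, nrd_one, one_mul, conj_smul, trd_smul, trd_conj]

/-- Powers of a Pell unit of a quadratic order inside the even Clifford algebra. -/
lemma exists_unit_near_one {p : ℕ} [hp : Fact p.Prime] (hp2 : p ≠ 2) {y : EvenClifford t}
    (hy : y.trd = 0) (hpos : y.nrd < 0) (hsq : ¬ IsSquare (-y.nrd)) {Q : ℤ}
    (hQ : Q ≠ 0) {K : ℕ} (hK : K ≠ 0) :
    ∃ (n : ℕ) (e T : ℤ) (w : EvenClifford t), 1 ≤ n ∧ ¬ (p : ℤ) ∣ e ∧ ¬ (p : ℤ) ∣ T ∧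
      (1 + (((p * K : ℕ) : ℤ) ^ n * (Q * e)) • (T • y + (p : ℤ) • w)).nrd = 1 := by
  have hpp : Prime (p : ℤ) := Nat.prime_iff_prime_int.mp hp.out
  have hp0 : (p : ℤ) ≠ 0 := hpp.ne_zero
  have hK' : (K : ℤ) ≠ 0 := by exact_mod_cast hK
  set M : ℤ := Q * K * p ^ 2 with hM
  have hM0 : M ≠ 0 := by rw [hM]; positivity
  have hyy : y * y = (-y.nrd) • 1 := by
    have h := mul_mul_self y 1
    rw [mul_one, hy, conj_one, zero_smul, zero_sub] at h
    rw [h, neg_smul]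
  obtain ⟨T, U, hTU, hU⟩ := Pell.exists_of_not_isSquare (d := -y.nrd * M ^ 2)
    (mul_pos (by linarith) (by positivity)) (by
      rintro ⟨r, hr⟩
      have : M ∣ r := by
        rw [← Int.pow_dvd_pow_iff two_ne_zero]
        exact ⟨-y.nrd, by rw [sq r, ← hr]; ring⟩
      obtain ⟨s, rfl⟩ := this
      apply hsq
      refine ⟨s, ?_⟩
      have : M ^ 2 * (-y.nrd) = M ^ 2 * (s * s) := by linarith
      exact mul_left_cancel₀ (by positivity) this)
  have hpT : ¬ (p : ℤ) ∣ T := by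
    intro h
    apply hpp.not_isUnit
    rw [isUnit_iff_dvd_one, ← hTU]
    apply dvd_sub (dvd_pow h two_ne_zero)
    refine ⟨-y.nrd * (Q * K) * p * M * U ^ 2, ?_⟩
    rw [hM]; ring
  obtain ⟨v, U', hU', hUv⟩ : ∃ (v : ℕ) (U' : ℤ), U = (p : ℤ) ^ v * U' ∧ ¬ (p : ℤ) ∣ U' :=
    ⟨_, (Int.finiteMultiplicity_iff.mpr ⟨by simpa using hp.out.ne_one, hU⟩ :
      FiniteMultiplicity (p : ℤ) U).exists_eq_pow_mul_and_not_dvd⟩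
  set g : EvenClifford t := T • 1 + (M * U) • y with hg
  have hgn : g.nrd = 1 := by
    rw [hg, nrd_add, nrd_smul, nrd_smul, nrd_one, conj_smul, mul_smul_comm, smul_mul_assoc,
      one_mul, trd_smul, trd_smul, trd_conj, hy]
    linarith
  have hgg : g * g = 1 + (2 * M * U) • ((-y.nrd * M * U) • 1 + T • y) := by
    rw [hg]
    simp only [mul_add, add_mul, mul_smul_comm, smul_mul_assoc, mul_one, one_mul, hyy]
    have : (1 : EvenClifford t) = (T ^ 2 - (-y.nrd) * M ^ 2 * U ^ 2) • 1 := by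
      rw [hTU, one_smul]
    conv_rhs => enter [1]; rw [this]
    module
  have key : ∀ i : ℕ, ∃ w, (g * g) ^ (K ^ i) =
      1 + ((K : ℤ) ^ i * (2 * M * U)) • ((-y.nrd * M * U) • 1 + T • y + (p : ℤ) • w) := by
    intro i
    induction i with
    | zero => exact ⟨0, by rw [pow_zero, pow_one, hgg]; simp⟩
    | succ i ih =>
      obtain ⟨w, hw⟩ := ih
      set r := (-y.nrd * M * U) • 1 + T • y + (p : ℤ) • w
      set A := (K : ℤ) ^ i * (2 * M * U) with hA
      obtain ⟨z, hz⟩ := exists_one_add_pow (A • r) K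
      refine ⟨w + ((K : ℤ) ^ i * (2 * Q * p * U)) • (r * r * z), ?_⟩
      have hr : ∀ X, (-y.nrd * M * U) • 1 + T • y + (p : ℤ) • (w + X) = r + (p : ℤ) • X := by
        intro X; simp only [r]; module
      have e : A * A = K * A * (p * ((K : ℤ) ^ i * (2 * Q * p * U))) := by
        rw [hA]
        nth_rewrite 2 [hM]
        ring
      have e' : (K : ℤ) ^ (i + 1) * (2 * M * U) = K * A := by rw [hA]; ring
      rw [pow_succ, pow_mul, hw, hz, hr, e', smul_mul_assoc A, mul_smul_comm A, smul_mul_assoc A,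
        smul_mul_assoc A, smul_smul A A, e]
      module
  obtain ⟨w, hw⟩ := key (1 + v)
  refine ⟨2 + v, 2 * U', T, w + (-y.nrd * (Q * K * p) * U) • 1, by omega, ?_, hpT, ?_⟩
  · intro h
    rcases hpp.dvd_or_dvd h with h | h
    · have := (Nat.prime_dvd_prime_iff_eq hp.out Nat.prime_two).mp (by exact_mod_cast h)
      exact hp2 this
    · exact hUv h
  · have e1 : (((p * K : ℕ) : ℤ) ^ (2 + v) * (Q * (2 * U'))) =
        (K : ℤ) ^ (1 + v) * (2 * M * U) := by
      rw [hU', hM]; push_cast; ring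
    have e2 : T • y + (p : ℤ) • (w + (-y.nrd * (Q * K * p) * U) • 1) =
        (-y.nrd * M * U) • 1 + T • y + (p : ℤ) • w := by
      rw [hM]; module
    rw [e1, e2, ← hw]
    have : ∀ (x : EvenClifford t) (N : ℕ), x.nrd = 1 → (x ^ N).nrd = 1 := by
      intro x N hx
      induction N with
      | zero => rw [pow_zero, nrd_one]
      | succ N ih => rw [pow_succ, nrd_mul, ih, hx, one_mul]
    exact this _ _ (by rw [nrd_mul, hgn, one_mul])

end EvenClifford

namespace EvenClifford

variable {t : TernaryForm ℤ}

lemma conj_pow (x : EvenClifford t) (n : ℕ) : (x ^ n).conj = x.conj ^ n := by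
  induction n with
  | zero => simp [conj_one]
  | succ n ih => rw [pow_succ, conj_mul, ih, pow_succ']

lemma nrd_pow (x : EvenClifford t) (n : ℕ) : (x ^ n).nrd = x.nrd ^ n := by
  induction n with
  | zero => simp [nrd_one]
  | succ n ih => rw [pow_succ, nrd_mul, ih, pow_succ]

lemma pow_succ_of_nrd_eq_zero {F : Type*} [Field F] {t : TernaryForm F} {x : EvenClifford t}
    (h : x.nrd = 0) (n : ℕ) : x ^ (n + 1) = x.trd ^ n • x := by
  induction n with
  | zero => simp
  | succ n ih =>
    rw [pow_succ, ih, smul_mul_assoc, sq_eq_of_nrd_eq_zero h, smul_smul, ← pow_succ]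

lemma exists_twist_int {p : ℕ} [hp : Fact p.Prime] (hd : ¬ (p : ℤ) ∣ t.disc)
    {c : EvenClifford t} (hc : (p : ℤ) ∣ c.nrd) (hτ : ¬ (p : ℤ) ∣ c.trd) :
    ∃ θ : EvenClifford t, (p : ℤ) ∣ θ.nrd ∧ θ.nrd ≠ 0 ∧ ¬ (p : ℤ) ∣ θ.trd ∧
      red p t (θ.conj * c * θ) ≠ 0 := by
  obtain ⟨θ', h1, h2, h3⟩ := exists_twist (disc_map_ne_zero p hd) (c := red p t c)
    (by rwa [nrd_red, ZMod.intCast_zmod_eq_zero_iff_dvd])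
    (by rwa [trd_red, Ne, ZMod.intCast_zmod_eq_zero_iff_dvd])
  obtain ⟨θ, rfl⟩ := red_surjective p θ'
  rw [nrd_red, ZMod.intCast_zmod_eq_zero_iff_dvd] at h1
  rw [trd_red, Ne, ZMod.intCast_zmod_eq_zero_iff_dvd] at h2
  by_cases h0 : θ.nrd = 0
  · have hn : (θ + (p : ℤ) • 1).nrd = p * (θ.trd + p) := by
      rw [nrd_add, h0, conj_smul, conj_one, mul_smul_comm, mul_one, trd_smul, nrd_smul, nrd_one]
      ring
    refine ⟨θ + (p : ℤ) • 1, by rw [hn]; exact dvd_mul_right _ _, ?_, ?_, ?_⟩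
    · rw [hn]
      refine mul_ne_zero (by exact_mod_cast hp.out.ne_zero) fun h => h2 ?_
      exact ⟨-1, by linarith⟩
    · rw [trd_add, trd_smul]
      rwa [Int.dvd_add_self_mul]
    · rw [map_mul, map_mul, ← conj_red, map_add, red_natCast_smul, add_zero]; exact h3
  · exact ⟨θ, h1, h0, h2, by rw [map_mul, map_mul, ← conj_red]; exact h3⟩

lemma exists_pure_int {p : ℕ} [hp : Fact p.Prime] (hp2 : p ≠ 2) (hd : ¬ (p : ℤ) ∣ t.disc)
    (hneg : ∃ x, t.disc * t.val x < 0) {s : EvenClifford t} (hs : red p t s ≠ 0)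
    (hs0 : (p : ℤ) ∣ s.trd) (hs1 : (p : ℤ) ∣ s.nrd) :
    ∃ y : EvenClifford t, y.trd = 0 ∧ ¬ (p : ℤ) ∣ (s * y).trd ∧ y.nrd < 0 ∧
      ¬ IsSquare (-y.nrd) := by
  have h2 : (2 : ZMod p) ≠ 0 := by
    intro h
    have : ((2 : ℕ) : ZMod p) = 0 := by exact_mod_cast h
    rw [ZMod.natCast_eq_zero_iff] at this
    exact hp2 ((Nat.prime_dvd_prime_iff_eq hp.out Nat.prime_two).mp this)
  obtain ⟨δ, hδ⟩ := FiniteField.exists_nonsquare (F := ZMod p) (by rwa [ZMod.ringChar_zmod_n])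
  obtain ⟨y', hy1, hy2, hy3⟩ := exists_pure (disc_map_ne_zero p hd) h2 hs
    (by rwa [trd_red, ZMod.intCast_zmod_eq_zero_iff_dvd])
    (by rwa [nrd_red, ZMod.intCast_zmod_eq_zero_iff_dvd]) δ
  obtain ⟨z, rfl⟩ := red_surjective p y'
  obtain ⟨x, hx⟩ := hneg
  set y1 := ofVec t x with hy1d
  set z2 : EvenClifford t := (2 : ℤ) • z - z.trd • 1 with hz2
  set B := (z2 * y1.conj).trd with hB
  set T : ℤ := |B| + |z2.nrd| + 1 with hT
  have hTp : 0 < T := by positivity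
  have hrz : red p t z2 = (2 : ZMod p) • red p t z := by
    rw [hz2, map_sub, red_smul, red_smul, ← trd_red, hy1, zero_smul, sub_zero]; simp
  have hry : red p t (z2 + ((p : ℤ) * T) • y1) = (2 : ZMod p) • red p t z := by
    rw [map_add, mul_smul, red_natCast_smul, add_zero, hrz]
  refine ⟨z2 + ((p : ℤ) * T) • y1, ?_, ?_, ?_, ?_⟩
  · rw [trd_add, hz2, trd_sub, trd_smul, trd_smul, trd_smul, trd_ofVec, trd_one]; ring
  · rw [← ZMod.intCast_zmod_eq_zero_iff_dvd, ← trd_red, map_mul, hry, mul_smul_comm, trd_smul]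
    exact mul_ne_zero h2 hy2
  · have hn1 : y1.nrd ≤ -1 := by rw [hy1d, nrd_ofVec]; omega
    rw [nrd_add, conj_smul, mul_smul_comm, trd_smul, nrd_smul, ← hB]
    have hp1 : (1 : ℤ) ≤ p := by exact_mod_cast hp.out.one_lt.le
    set X : ℤ := p * T
    have hX : T ≤ X := by simp only [X]; nlinarith
    have hXB : X * B ≤ X * |B| := mul_le_mul_of_nonneg_left (le_abs_self B) (by linarith)
    have := le_abs_self z2.nrd
    have e1 : X ^ 2 * y1.nrd ≤ - X ^ 2 := by nlinarith [sq_nonneg X]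
    have e2 : X * T ≤ X ^ 2 := by nlinarith
    have e3 : X * T = X * |B| + X * |z2.nrd| + X := by rw [hT]; ring
    have e4 : |z2.nrd| ≤ X * |z2.nrd| := le_mul_of_one_le_left (abs_nonneg _) (by linarith)
    linarith
  · rintro ⟨r, hr⟩
    have h := congrArg (fun n : ℤ => (n : ZMod p)) hr
    simp only [Int.cast_neg, Int.cast_mul] at h
    rw [← nrd_red, hry, nrd_smul] at h
    apply hδ
    refine ⟨(r : ZMod p) / 2, ?_⟩
    rw [← hy3]
    field_simp
    linear_combination h

/-- Local modification by a unit of reduced norm one. -/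
theorem exists_unit_trace_dvd {p : ℕ} [hp : Fact p.Prime] (hp2 : p ≠ 2)
    (hd : ¬ (p : ℤ) ∣ t.disc) (hneg : ∃ x, t.disc * t.val x < 0) {c : EvenClifford t}
    (hc : (p : ℤ) ∣ c.nrd) (hτ : ¬ (p : ℤ) ∣ c.trd) {Q : ℤ} (hQ : ¬ (p : ℤ) ∣ Q) :
    ∃ ν : EvenClifford t, (1 + Q • ν).nrd = 1 ∧ (p : ℤ) ∣ (c * (1 + Q • ν)).trd := by
  have hpp : Prime (p : ℤ) := Nat.prime_iff_prime_int.mp hp.out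
  obtain ⟨θ, hθ1, hθ0, hθt, hs⟩ := exists_twist_int hd hc hτ
  obtain ⟨k, hk⟩ := hθ1
  have hk0 : k ≠ 0 := by rintro rfl; exact hθ0 (by simpa using hk)
  have hθr : (red p t θ).nrd = 0 := by rw [nrd_red, hk]; simp
  have hθc : (red p t θ).conj.nrd = 0 := by rw [nrd_conj, hθr]
  have hθθ : red p t θ * (red p t θ).conj = 0 := by rw [mul_conj, hθr, zero_smul]
  have hs0 : (p : ℤ) ∣ (θ.conj * c * θ).trd := by
    rw [trd_mul_comm, ← mul_assoc, mul_conj, smul_mul_assoc, one_mul, trd_smul, hk]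
    exact ⟨k * c.trd, by ring⟩
  have hs1 : (p : ℤ) ∣ (θ.conj * c * θ).nrd := by
    rw [nrd_mul, nrd_mul, hk]
    exact ⟨θ.conj.nrd * c.nrd * k, by ring⟩
  obtain ⟨y, hy0, hyp, hyn, hysq⟩ := exists_pure_int hp2 hd hneg hs hs0 hs1
  obtain ⟨n, e, T, w, hn, he, hT, hr⟩ := exists_unit_near_one hp2 hy0 hyn hysq
    (Q := Q) (by rintro rfl; simp at hQ) (K := k.natAbs) (by simpa using hk0)
  obtain ⟨e', he', hee⟩ : ∃ e' : ℤ, ¬ (p : ℤ) ∣ e' ∧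
      ((p * k.natAbs : ℕ) : ℤ) ^ n * (Q * e) = θ.nrd ^ n * (Q * e') := by
    push_cast
    rw [hk, mul_pow, mul_pow, ← abs_pow]
    rcases abs_choice (k ^ n) with h | h
    · exact ⟨e, he, by rw [h]⟩
    · exact ⟨-e, by rwa [dvd_neg], by rw [h]; ring⟩
  rw [hee] at hr
  set r := T • y + (p : ℤ) • w with hrd
  set ν1 : EvenClifford t := e' • (θ ^ n * r * θ.conj ^ n) with hν1
  have hcp : θ.conj ^ n = (θ ^ n).conj := (conj_pow θ n).symm
  have hnn : (θ ^ n).conj * θ ^ n = (θ.nrd ^ n) • 1 := by rw [conj_mul_self, nrd_pow]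
  have hγ1 : (1 + Q • ν1).nrd = 1 := by
    rw [nrd_one_add_smul] at hr
    rw [hν1, smul_smul, nrd_one_add_smul, nrd_mul, nrd_mul, hcp, nrd_conj, nrd_pow,
      trd_mul_comm, ← mul_assoc, hnn, smul_mul_assoc, one_mul, trd_smul]
    linear_combination hr
  have hsqz : red p t ν1 * red p t ν1 = 0 := by
    have : θ.conj ^ n * θ ^ n = (θ.nrd ^ n) • 1 := by rw [hcp, hnn]
    rw [← map_mul, hν1, smul_mul_smul_comm, mul_assoc (θ ^ n * r), mul_assoc (θ ^ n),
      ← mul_assoc (θ.conj ^ n), ← mul_assoc (θ.conj ^ n), this, red_smul, map_mul, map_mul,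
      map_mul, map_mul, red_smul, hk, mul_pow]
    obtain ⟨m, rfl⟩ := Nat.exists_eq_succ_of_ne_zero (by omega : n ≠ 0)
    simp
  have hlam : ((c * ν1).trd : ZMod p) ≠ 0 := by
    obtain ⟨m, rfl⟩ := Nat.exists_eq_succ_of_ne_zero (by omega : n ≠ 0)
    rw [← trd_red, map_mul, hν1, red_smul, mul_smul_comm, trd_smul, map_mul, map_mul, map_pow,
      map_pow, ← conj_red, Nat.succ_eq_add_one, pow_succ_of_nrd_eq_zero hθr,
      pow_succ_of_nrd_eq_zero hθc,
      ← mul_assoc, trd_mul_comm]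
    simp only [smul_mul_assoc, mul_smul_comm, trd_smul]
    have hrr : red p t r = (T : ZMod p) • red p t y := by
      rw [hrd, map_add, red_natCast_smul, add_zero, red_smul]
    have : ((red p t θ).conj * (red p t c * (red p t θ * red p t r))).trd =
        (T : ZMod p) * ((θ.conj * c * θ * y).trd : ZMod p) := by
      rw [hrr, ← trd_red, ← trd_smul, map_mul, map_mul, map_mul, ← conj_red]
      simp only [mul_smul_comm, mul_assoc]
    rw [this, trd_conj, trd_red]
    have n1 : ∀ a : ℤ, ¬ (p : ℤ) ∣ a → (a : ZMod p) ≠ 0 := by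
      intro a ha; rwa [Ne, ZMod.intCast_zmod_eq_zero_iff_dvd]
    have := n1 _ hθt
    exact mul_ne_zero (n1 _ he') (mul_ne_zero (pow_ne_zero _ this) (mul_ne_zero (pow_ne_zero _ this)
      (mul_ne_zero (n1 _ hT) (n1 _ hyp))))
  have hQ' : (Q : ZMod p) ≠ 0 := by rwa [Ne, ZMod.intCast_zmod_eq_zero_iff_dvd]
  set K : ZMod p := -(c.trd : ZMod p) / (Q * ((c * ν1).trd : ZMod p)) with hK
  obtain ⟨z, hz⟩ := exists_one_add_pow (Q • ν1) K.val
  have hK' : ((K.val : ℤ) : ZMod p) = K := by simp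
  have hz' : (1 + Q • ν1) ^ K.val = 1 + Q • ((K.val : ℤ) • ν1 + Q • (ν1 * ν1 * z)) := by
    rw [hz, smul_mul_smul_comm, smul_mul_assoc]; module
  clear_value ν1
  refine ⟨(K.val : ℤ) • ν1 + Q • (ν1 * ν1 * z), ?_, ?_⟩
  · rw [← hz', nrd_pow, hγ1, one_pow]
  · rw [← ZMod.intCast_zmod_eq_zero_iff_dvd, ← trd_red, map_mul, map_add, map_one, red_smul,
      map_add, red_smul, red_smul, map_mul, map_mul, hsqz, zero_mul, smul_zero, add_zero, mul_add,
      mul_one, trd_add, mul_smul_comm, mul_smul_comm, trd_smul, trd_smul, trd_red, ← map_mul,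
      trd_red, hK', hK]
    field_simp
    ring

end EvenClifford

namespace EvenClifford

variable {t : TernaryForm ℤ}

/-- The twisted conjugation by `α` differs from a scalar by vectors, up to denominators prime to
the discriminant. -/
def TwistStable (α : EvenClifford t) : Prop :=
  ∃ d : ℤ, IsCoprime d (2 * t.disc) ∧ ∀ ξ, ∃ v,
    d • (α * ofDual t ξ * α.conj - α.nrd • ofDual t ξ) = ofVec t v

lemma ofVec_add (x y : Fin 3 → ℤ) : ofVec t (x + y) = ofVec t x + ofVec t y := by
  ext <;> simp [ofVec, add_def, TernaryForm.grad] <;> ring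

lemma ofVec_smul (r : ℤ) (x : Fin 3 → ℤ) : ofVec t (r • x) = r • ofVec t x := by
  ext <;> simp [ofVec, smul_def, TernaryForm.grad] <;> ring

lemma ofVec_eq (x : Fin 3 → ℤ) : ofVec t x = (ofVec t x).re • 1 + ofDual t (t.grad x) := by
  ext <;> simp [ofVec, add_def, smul_def, one_def, ofDual]

lemma conj_ofVec (x : Fin 3 → ℤ) : (ofVec t x).conj = -ofVec t x := by
  rw [conj_eq, trd_ofVec, zero_smul, zero_sub]

lemma two_disc_smul_eq_ofVec {y : EvenClifford t} (hy : y.trd = 0) :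
    ∃ v, (2 * t.disc) • y = ofVec t v := by
  refine ⟨t.adjGrad ![y.i, y.j, y.k], ?_⟩
  have h := t.grad_adjGrad ![y.i, y.j, y.k]
  have h1 := congrFun h 0
  have h2 := congrFun h 1
  have h3 := congrFun h 2
  have ht := trd_ofVec (t := t) (t.adjGrad ![y.i, y.j, y.k])
  simp at h1 h2 h3
  have e1 : (ofVec t (t.adjGrad ![y.i, y.j, y.k])).i = 2 * t.disc * y.i := h1
  have e2 : (ofVec t (t.adjGrad ![y.i, y.j, y.k])).j = 2 * t.disc * y.j := h2
  have e3 : (ofVec t (t.adjGrad ![y.i, y.j, y.k])).k = 2 * t.disc * y.k := h3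
  rw [trd, e1, e2, e3] at ht
  rw [trd] at hy
  ext
  · simp only [smul_def]
    have : 2 * (2 * t.disc * y.re) = 2 * (ofVec t (t.adjGrad ![y.i, y.j, y.k])).re := by
      linear_combination (2 * t.disc) * hy - ht
    linarith
  · rw [e1]; rfl
  · rw [e2]; rfl
  · rw [e3]; rfl

lemma trd_twist (α η : EvenClifford t) : (α * η * α.conj - α.nrd • η).trd = 0 := by
  rw [trd_sub, trd_mul_comm, ← mul_assoc, conj_mul_self, smul_mul_assoc, one_mul, sub_self]

lemma TwistStable.mul {α β : EvenClifford t} (hα : TwistStable α) (hβ : TwistStable β) :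
    TwistStable (α * β) := by
  obtain ⟨d, hd, h⟩ := hα
  obtain ⟨d', hd', h'⟩ := hβ
  refine ⟨d * d', hd.mul_left hd', fun ξ => ?_⟩
  obtain ⟨v, hv⟩ := h' ξ
  obtain ⟨u, hu⟩ := h (t.grad v)
  obtain ⟨w, hw⟩ := h ξ
  refine ⟨(d * α.nrd) • v + u + (d' * β.nrd) • w, ?_⟩
  have e : (d * d') • (α * β * ofDual t ξ * (α * β).conj - (α * β).nrd • ofDual t ξ) =
      d • (α * (d' • (β * ofDual t ξ * β.conj - β.nrd • ofDual t ξ)) * α.conj) +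
        (d' * β.nrd) • (d • (α * ofDual t ξ * α.conj - α.nrd • ofDual t ξ)) := by
    rw [conj_mul, nrd_mul]
    simp only [mul_sub, sub_mul, smul_sub, mul_smul_comm, smul_mul_assoc, mul_assoc]
    module
  have e2 : d • (α * ofVec t v * α.conj) = (d * α.nrd) • ofVec t v +
      d • (α * ofDual t (t.grad v) * α.conj - α.nrd • ofDual t (t.grad v)) := by
    rw [ofVec_eq, mul_add, add_mul, mul_smul_comm, mul_one, smul_mul_assoc, mul_conj]
    module
  rw [e, hv, e2, hu, hw, ofVec_add, ofVec_add, ofVec_smul, ofVec_smul]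

lemma twistStable_smul_iff {k : ℤ} (hk : IsCoprime k (2 * t.disc)) {α : EvenClifford t} :
    TwistStable (k • α) ↔ TwistStable α := by
  have e : ∀ (d : ℤ) ξ, d • (k • α * ofDual t ξ * (k • α).conj - (k • α).nrd • ofDual t ξ) =
      (d * k ^ 2) • (α * ofDual t ξ * α.conj - α.nrd • ofDual t ξ) := by
    intro d ξ
    rw [conj_smul, nrd_smul]
    simp only [smul_sub, mul_smul_comm, smul_mul_assoc]
    module
  constructor
  · rintro ⟨d, hd, h⟩
    refine ⟨d * k ^ 2, hd.mul_left (hk.pow_left), fun ξ => ?_⟩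
    obtain ⟨v, hv⟩ := h ξ
    exact ⟨v, by rw [← e, hv]⟩
  · rintro ⟨d, hd, h⟩
    refine ⟨d, hd, fun ξ => ?_⟩
    obtain ⟨v, hv⟩ := h ξ
    exact ⟨k ^ 2 • v, by rw [e, ofVec_smul, ← hv]; module⟩

lemma twistStable_add_smul (A : ℤ) (z : EvenClifford t) :
    TwistStable (A • 1 + (2 * t.disc) • z) := by
  refine ⟨1, isCoprime_one_left, fun ξ => ?_⟩
  have h1 : (z * ofDual t ξ - ofDual t ξ * z).trd = 0 := by
    rw [trd_sub, trd_mul_comm, sub_self]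
  obtain ⟨v, hv⟩ := two_disc_smul_eq_ofVec h1
  obtain ⟨w, hw⟩ := two_disc_smul_eq_ofVec (trd_twist z (ofDual t ξ))
  refine ⟨A • v + (2 * t.disc) • w, ?_⟩
  rw [ofVec_add, ofVec_smul, ofVec_smul, ← hv, ← hw, one_smul, conj_add, nrd_add, conj_smul,
    conj_smul, conj_one, nrd_smul, nrd_smul, nrd_one, smul_mul_smul_comm, one_mul, trd_smul,
    trd_conj]
  have : z.conj = z.trd • 1 - z := conj_eq z
  simp only [mul_add, add_mul, smul_sub, mul_smul_comm, smul_mul_assoc, mul_one, one_mul]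
  rw [this]
  simp only [mul_sub, mul_smul_comm, mul_one]
  module

lemma twistStable_vecMul (x y : Fin 3 → ℤ) : TwistStable (vecMul t x y) :=
  ⟨1, isCoprime_one_left, fun ξ => ⟨_, by
    rw [one_smul, nrd_vecMul]; exact vecMul_conjugation x y ξ⟩⟩

/-- Membership in the right ideal generated by `X` and `m`. -/
def InIdeal (m : ℤ) (X a : EvenClifford t) : Prop := ∃ z w, a = X * z + m • w

section InIdeal

variable {m : ℤ} {X a b : EvenClifford t}

lemma InIdeal.add (ha : InIdeal m X a) (hb : InIdeal m X b) : InIdeal m X (a + b) := by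
  obtain ⟨z, w, rfl⟩ := ha
  obtain ⟨z', w', rfl⟩ := hb
  exact ⟨z + z', w + w', by rw [mul_add]; module⟩

lemma InIdeal.smul (r : ℤ) (ha : InIdeal m X a) : InIdeal m X (r • a) := by
  obtain ⟨z, w, rfl⟩ := ha
  exact ⟨r • z, r • w, by rw [mul_smul_comm]; module⟩

lemma InIdeal.mul_right (ha : InIdeal m X a) (y : EvenClifford t) : InIdeal m X (a * y) := by
  obtain ⟨z, w, rfl⟩ := ha
  exact ⟨z * y, w * y, by rw [add_mul, mul_assoc, smul_mul_assoc]⟩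

lemma inIdeal_smul (y : EvenClifford t) : InIdeal m X (m • y) := ⟨0, y, by simp⟩

lemma InIdeal.conj_mul (hX : m ∣ X.nrd) (ha : InIdeal m X a) (hb : InIdeal m X b) :
    ∃ y, a.conj * b = m • y := by
  obtain ⟨z, w, rfl⟩ := ha
  obtain ⟨z', w', rfl⟩ := hb
  obtain ⟨k, hk⟩ := hX
  refine ⟨k • (z.conj * z') + z.conj * X.conj * w' + w.conj * X * z' + m • (w.conj * w'), ?_⟩
  rw [conj_add, EvenClifford.conj_mul, conj_smul]
  have : z.conj * X.conj * X * z' = (m * k) • (z.conj * z') := by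
    rw [mul_assoc z.conj, conj_mul_self, mul_smul_comm, mul_one, hk, smul_mul_assoc]
  simp only [mul_add, add_mul, this, mul_smul_comm, smul_mul_assoc, ← mul_assoc]
  module

end InIdeal

lemma smul_right_cancel {k : ℤ} (hk : k ≠ 0) {x y : EvenClifford t} (h : k • x = k • y) :
    x = y := by
  have h1 := congrArg EvenClifford.re h
  have h2 := congrArg EvenClifford.i h
  have h3 := congrArg EvenClifford.j h
  have h4 := congrArg EvenClifford.k h
  simp only [smul_def] at h1 h2 h3 h4
  exact EvenClifford.ext (mul_left_cancel₀ hk h1) (mul_left_cancel₀ hk h2)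
    (mul_left_cancel₀ hk h3) (mul_left_cancel₀ hk h4)

lemma InIdeal.of_coprime_smul {m : ℤ} {X a y : EvenClifford t} {p g : ℤ} (hgp : IsCoprime g p)
    (ha : InIdeal m X a) (hy : InIdeal m X y) (h : g • a = p • y) :
    ∃ a', InIdeal m X a' ∧ a = p • a' := by
  obtain ⟨u, v, huv⟩ := hgp
  refine ⟨u • y + v • a, (hy.smul u).add (ha.smul v), ?_⟩
  calc a = (u * g + v * p) • a := by rw [huv, one_smul]
    _ = u • (g • a) + (v * p) • a := by module
    _ = _ := by rw [h]; module

end EvenClifford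

namespace EvenClifford

variable {t : TernaryForm ℤ}

lemma _root_.TernaryForm.adjGrad_smul (t : TernaryForm ℤ) (r : ℤ) (x : Fin 3 → ℤ) :
    t.adjGrad (r • x) = r • t.adjGrad x := by
  ext i
  fin_cases i <;> simp [TernaryForm.adjGrad] <;> ring

lemma exists_trd_mul_not_dvd {p : ℕ} [hp : Fact p.Prime] (hd : ¬ (p : ℤ) ∣ t.disc)
    {b : EvenClifford t} (hb : ¬ ∃ y, b = (p : ℤ) • y) :
    ∃ y, ¬ (p : ℤ) ∣ (b * y).trd := by
  by_contra! H
  apply hb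
  rw [← red_eq_zero_iff]
  apply eq_zero_of_trd_mul_eq_zero (disc_map_ne_zero p hd)
  intro z
  obtain ⟨z, rfl⟩ := red_surjective p z
  rw [← map_mul, trd_red, ZMod.intCast_zmod_eq_zero_iff_dvd]
  exact H z

lemma exists_inIdeal_nrd {p : ℕ} [hp : Fact p.Prime] (hd : ¬ (p : ℤ) ∣ 2 * t.disc) {m : ℤ}
    (hm : m ≠ 0) {x : Fin 3 → ℤ} (hx : m ^ 2 ∣ t.val x)
    (hxp : (p : ℤ) ∣ m → ¬ ∃ y, x = (p : ℤ) • y) :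
    ∃ (w : EvenClifford t) (F : ℤ), InIdeal m (ofVec t x) w ∧ w.nrd = m * F ∧ ¬ (p : ℤ) ∣ F := by
  by_cases hpm : (p : ℤ) ∣ m
  · have hpp : Prime (p : ℤ) := Nat.prime_iff_prime_int.mp hp.out
    have hd' : ¬ (p : ℤ) ∣ t.disc := fun h => hd (h.mul_left 2)
    have : ¬ ∃ y, ofVec t x = (p : ℤ) • y := by
      rintro ⟨y, hy⟩
      apply hxp hpm
      have h := t.adjGrad_grad x
      have hg : t.grad x = (p : ℤ) • ![y.i, y.j, y.k] := by
        have h1 := congrArg EvenClifford.i hy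
        have h2 := congrArg EvenClifford.j hy
        have h3 := congrArg EvenClifford.k hy
        simp only [smul_def] at h1 h2 h3
        ext i
        fin_cases i
        · exact h1
        · exact h2
        · exact h3
      have hdvd : ∀ i, (p : ℤ) ∣ x i := by
        intro i
        have : (p : ℤ) ∣ 2 * t.disc * x i := by
          have h' := congrFun h i
          rw [Pi.smul_apply, smul_eq_mul] at h'
          rw [← h', hg, TernaryForm.adjGrad_smul]
          exact dvd_mul_right _ _
        exact (hpp.dvd_or_dvd this).resolve_left hd
      choose y hy using hdvd
      exact ⟨y, funext hy⟩
    obtain ⟨z, hz⟩ := exists_trd_mul_not_dvd hd' this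
    obtain ⟨k, hk⟩ := hx
    refine ⟨ofVec t x * z + m • 1, m * t.disc * k * z.nrd + (ofVec t x * z).trd + m,
      ⟨z, 1, rfl⟩, ?_, ?_⟩
    · rw [nrd_add, nrd_mul, nrd_ofVec, hk, conj_smul, conj_one, mul_smul_comm, mul_one, trd_smul,
        nrd_smul, nrd_one]
      ring
    · intro h
      apply hz
      obtain ⟨l, rfl⟩ := hpm
      obtain ⟨r, hr⟩ := h
      exact ⟨r - (l * t.disc * k * z.nrd + l), by linear_combination hr⟩
  · exact ⟨m • 1, m, inIdeal_smul 1, by rw [nrd_smul, nrd_one]; ring, hpm⟩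

lemma descent_identity {α y w0 b γ : EvenClifford t} {F p S l : ℤ} (hFα : F • α = w0 * b)
    (hnb : b.nrd = F * (p * S) ^ 2) (hl : (b * y * γ).trd = p * l) :
    F • ((α * y + p • w0) * γ * ((p * S ^ 2) • y.conj + b)) =
      p • (F • (w0 * γ * ((p * S ^ 2) • y.conj + b)) + (F * S ^ 2) • (α * y * γ * y.conj) +
        w0 * (l • b) - (F * p * S ^ 2) • (w0 * (y * γ).conj)) := by
  have hbb : b * (y * γ) * b = (p * l) • b - (F * (p * S) ^ 2) • (y * γ).conj := by
    rw [mul_mul_self, ← mul_assoc, hl, hnb]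
  have hk : F • (α * y * γ * b) = w0 * ((p * l) • b - (F * (p * S) ^ 2) • (y * γ).conj) := by
    rw [← hbb, mul_assoc α, mul_assoc α, ← smul_mul_assoc, hFα]
    simp only [mul_assoc]
  generalize ha' : (p * S ^ 2) • y.conj + b = a'
  have hw : (α * y + p • w0) * γ * a' = α * y * γ * b + (p * S ^ 2) • (α * y * γ * y.conj) +
      p • (w0 * γ * a') := by
    have h : α * y * γ * a' = α * y * γ * b + (p * S ^ 2) • (α * y * γ * y.conj) := by
      rw [← ha', mul_add, mul_smul_comm, add_comm]
    rw [add_mul, add_mul, smul_mul_assoc, smul_mul_assoc, h]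
  rw [hw, smul_add, smul_add, hk, mul_sub, mul_smul_comm, mul_smul_comm, mul_smul_comm]
  generalize w0 * γ * a' = A
  generalize α * y * γ * y.conj = B
  generalize w0 * b = C
  generalize w0 * (y * γ).conj = D
  clear hw ha' hk hbb hFα
  match_scalars <;> ring

/-- One step of the descent: removing a prime from the norm of an element of the ideal. -/
lemma descent_step {p : ℕ} [hp : Fact p.Prime] (hd : ¬ (p : ℤ) ∣ 2 * t.disc)
    (hneg : ∃ x, t.disc * t.val x < 0) {m : ℤ}
    (hm : m ≠ 0) (hmd : IsCoprime m (2 * t.disc)) {x : Fin 3 → ℤ} (hx : m ^ 2 ∣ t.val x)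
    (hxp : (p : ℤ) ∣ m → ¬ ∃ y, x = (p : ℤ) • y) {S : ℤ} {α : EvenClifford t}
    (hα : InIdeal m (ofVec t x) α) (hn : α.nrd = m * (p * S) ^ 2) (hst : TwistStable α) :
    ∃ β : EvenClifford t, InIdeal m (ofVec t x) β ∧ β.nrd = m * S ^ 2 ∧ TwistStable β := by
  have hpp : Prime (p : ℤ) := Nat.prime_iff_prime_int.mp hp.out
  have hp0 : (p : ℤ) ≠ 0 := hpp.ne_zero
  have hd' : ¬ (p : ℤ) ∣ t.disc := fun h => hd (h.mul_left 2)
  have hp2 : p ≠ 2 := by rintro rfl; exact hd (dvd_mul_right _ _)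
  have hcop : ∀ a : ℤ, ¬ (p : ℤ) ∣ a → IsCoprime a p := fun a ha =>
    ((Prime.coprime_iff_not_dvd hpp).mpr ha).symm
  have hX : m ∣ (ofVec t x).nrd := by
    rw [nrd_ofVec]; exact ((dvd_pow_self m two_ne_zero).trans hx).mul_left _
  suffices H : ∃ ρ : EvenClifford t, InIdeal m (ofVec t x) ρ ∧ ρ.nrd = m * (p * S) ^ 2 ∧
      TwistStable ρ ∧ ∃ g y, ¬ (p : ℤ) ∣ g ∧ InIdeal m (ofVec t x) y ∧ g • ρ = (p : ℤ) • y by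
    obtain ⟨ρ, h1, h2, h3, g, y, hg, hy, h⟩ := H
    obtain ⟨β, hβ, rfl⟩ := h1.of_coprime_smul (hcop g hg) hy h
    refine ⟨β, hβ, ?_, (twistStable_smul_iff (hcop _ hd).symm).mp h3⟩
    rw [nrd_smul] at h2
    have : (p : ℤ) ^ 2 * β.nrd = p ^ 2 * (m * S ^ 2) := by rw [h2]; ring
    exact mul_left_cancel₀ (pow_ne_zero 2 hp0) this
  obtain ⟨w0, F, hw0, hwF, hF⟩ := exists_inIdeal_nrd hd hm hx hxp
  obtain ⟨b, hb⟩ := hw0.conj_mul hX hα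
  have hFα : F • α = w0 * b := by
    apply smul_right_cancel hm
    rw [← mul_smul_comm, ← hb, ← mul_assoc, mul_conj, hwF, smul_mul_assoc, one_mul, smul_smul]
  have hnb : b.nrd = F * (p * S) ^ 2 := by
    have h := congrArg nrd hb
    rw [nrd_mul, nrd_conj, nrd_smul, hwF, hn] at h
    have : m ^ 2 * b.nrd = m ^ 2 * (F * (p * S) ^ 2) := by rw [← h]; ring
    exact mul_left_cancel₀ (pow_ne_zero 2 hm) this
  by_cases hbp : ∃ b', b = (p : ℤ) • b'
  · obtain ⟨b', rfl⟩ := hbp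
    exact ⟨α, hα, hn, hst, F, w0 * b', hF, hw0.mul_right b', by rw [hFα, mul_smul_comm]⟩
  obtain ⟨y, hy⟩ := exists_trd_mul_not_dvd hd' hbp
  set w1 := α * y + (p : ℤ) • w0 with hw1
  set g : ℤ := p * S ^ 2 * y.nrd + (b * y).trd + p * F with hg
  have hgp : ¬ (p : ℤ) ∣ g := by
    intro h
    apply hy
    obtain ⟨r, hr⟩ := h
    exact ⟨r - (S ^ 2 * y.nrd + F), by linear_combination hr - hg⟩
  set a' := (p * S ^ 2) • y.conj + b with ha'
  have hw1n : w1.nrd = m * p * g := by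
    have : (α * y * w0.conj).trd = m * (b * y).trd := by
      rw [trd_mul_comm, ← mul_assoc, hb, smul_mul_assoc, trd_smul]
    rw [hw1, nrd_add, nrd_mul, nrd_smul, conj_smul, mul_smul_comm, trd_smul, this, hn, hwF, hg]
    ring
  have hw1a : w1.conj * α = (m * p) • a' := by
    rw [hw1, conj_add, conj_mul, conj_smul, add_mul, mul_assoc, conj_mul_self, smul_mul_assoc, hb,
      hn, ha', mul_smul_comm, mul_one]
    module
  have hmp : m * p ≠ 0 := mul_ne_zero hm hp0
  have hgα : w1 * a' = g • α := by
    apply smul_right_cancel hmp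
    rw [← mul_smul_comm, ← hw1a, ← mul_assoc, mul_conj, hw1n, smul_mul_assoc, one_mul, smul_smul]
  have ha'n : (p : ℤ) * a'.nrd = p * (g * (p * S ^ 2)) := by
    have h := congrArg nrd hw1a
    rw [nrd_mul, nrd_conj, nrd_smul, hw1n, hn] at h
    have : (m ^ 2 * p) * (p * a'.nrd) = (m ^ 2 * p) * (p * (g * (p * S ^ 2))) := by
      linear_combination -h
    exact mul_left_cancel₀ (mul_ne_zero (pow_ne_zero 2 hm) hp0) this
  clear_value w1 a' g
  have ha'n := mul_left_cancel₀ hp0 ha'n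
  have hQ : ¬ (p : ℤ) ∣ g * (2 * t.disc) := fun h => (hpp.dvd_or_dvd h).elim hgp hd
  obtain ⟨ν, hν1, hν2⟩ := exists_unit_trace_dvd hp2 hd' hneg (c := b * y)
    (by rw [nrd_mul, hnb]; exact ⟨F * (p * S ^ 2) * y.nrd, by ring⟩) hy hQ
  set γ := 1 + (g * (2 * t.disc)) • ν with hγ
  have hnum : g • (α + (2 * t.disc) • (w1 * ν * a')) = w1 * γ * a' := by
    rw [hγ, mul_add w1, add_mul (w1 * 1), mul_one, hgα, mul_smul_comm, smul_mul_assoc]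
    module
  obtain ⟨l, hl⟩ := hν2
  refine ⟨α + (2 * t.disc) • (w1 * ν * a'), ?_, ?_, ?_, F * g,
    F • (w0 * γ * ((p * S ^ 2) • y.conj + b)) + (F * S ^ 2) • (α * y * γ * y.conj) + w0 * (l • b) -
      (F * p * S ^ 2) • (w0 * (y * γ).conj), ?_, ?_, ?_⟩
  · have : InIdeal m (ofVec t x) w1 := hw1 ▸ (hα.mul_right y).add (hw0.smul _)
    exact hα.add (((this.mul_right ν).mul_right a').smul _)
  · have h := congrArg nrd hnum
    rw [nrd_smul, nrd_mul, nrd_mul, hν1, hw1n, ha'n] at h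
    have hg0 : g ≠ 0 := by rintro h0; rw [h0] at hgp; exact hgp (dvd_zero _)
    have : g ^ 2 * (α + (2 * t.disc) • (w1 * ν * a')).nrd = g ^ 2 * (m * (p * S) ^ 2) := by
      rw [h]; ring
    exact mul_left_cancel₀ (pow_ne_zero 2 hg0) this
  · rw [← twistStable_smul_iff (hmd.mul_left (hcop _ hd).symm)]
    have : (m * p) • (α + (2 * t.disc) • (w1 * ν * a')) =
        ((m * p) • 1 + (2 * t.disc) • (w1 * ν * w1.conj)) * α := by
      rw [add_mul, smul_mul_assoc, one_mul, smul_mul_assoc, mul_assoc _ w1.conj, hw1a,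
        mul_smul_comm (m * p : ℤ)]
      module
    rw [this]
    exact (twistStable_add_smul _ _).mul hst
  · exact fun h => (hpp.dvd_or_dvd h).elim hF hgp
  · rw [sub_eq_add_neg, ← neg_smul]
    exact ((((hw0.mul_right γ).mul_right _).smul _).add
      ((((hα.mul_right y).mul_right γ).mul_right _).smul _)).add (hw0.mul_right _) |>.add
      ((hw0.mul_right _).smul _)
  · rw [mul_smul, hnum, hw1, ha']
    exact descent_identity hFα hnb hl

lemma descent (hneg : ∃ x, t.disc * t.val x < 0) {m : ℤ}
    (hm : m ≠ 0) (hmd : IsCoprime m (2 * t.disc)) {x : Fin 3 → ℤ} (hx : m ^ 2 ∣ t.val x)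
    (hxp : ∀ p : ℕ, p.Prime → (p : ℤ) ∣ m → ¬ ∃ y, x = (p : ℤ) • y) (S : ℕ) :
    ∀ α : EvenClifford t, IsCoprime (S : ℤ) (2 * t.disc) →
    InIdeal m (ofVec t x) α → α.nrd = m * (S : ℤ) ^ 2 → TwistStable α →
    ∃ β : EvenClifford t, InIdeal m (ofVec t x) β ∧ β.nrd = m ∧ TwistStable β := by
  induction S using induction_on_primes with
  | zero =>
    intro α hc hα hn hs
    exfalso
    rw [Nat.cast_zero, isCoprime_zero_left, Int.isUnit_iff] at hc
    omega
  | one => exact fun α _ hα hn hs => ⟨α, hα, by rw [hn]; simp, hs⟩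
  | prime_mul p a hp ih =>
    intro α hc hα hn hs
    have := Fact.mk hp
    have hpp : Prime (p : ℤ) := Nat.prime_iff_prime_int.mp hp
    rw [Nat.cast_mul] at hc hn
    obtain ⟨β, h1, h2, h3⟩ := descent_step
      ((Prime.coprime_iff_not_dvd hpp).mp hc.of_mul_left_left) hneg hm hmd hx
      (hxp p hp) (S := a) hα hn hs
    exact ih β hc.of_mul_left_right h1 h2 h3

end EvenClifford

namespace EvenClifford

variable {t : TernaryForm ℤ}

lemma exists_smul_of_ofVec_eq_smul {m : ℤ} (hmd : IsCoprime m (2 * t.disc)) {x : Fin 3 → ℤ}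
    {y : EvenClifford t} (h : ofVec t x = m • y) : ∃ v, x = m • v := by
  have hg : t.grad x = m • ![y.i, y.j, y.k] := by
    have h1 := congrArg EvenClifford.i h
    have h2 := congrArg EvenClifford.j h
    have h3 := congrArg EvenClifford.k h
    simp only [smul_def] at h1 h2 h3
    ext i
    fin_cases i
    · exact h1
    · exact h2
    · exact h3
  have hd : ∀ i, m ∣ x i := by
    intro i
    have h' := congrFun (t.adjGrad_grad x) i
    rw [hg, TernaryForm.adjGrad_smul, Pi.smul_apply, Pi.smul_apply, smul_eq_mul, smul_eq_mul] at h'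
    exact hmd.dvd_of_dvd_mul_left (h' ▸ dvd_mul_right _ _)
  choose v hv using hd
  exact ⟨v, funext hv⟩

lemma ofVec_injective (hd : t.disc ≠ 0) : Function.Injective (ofVec t) := by
  intro x y h
  have hg : t.grad x = t.grad y := by
    have h1 := congrArg EvenClifford.i h
    have h2 := congrArg EvenClifford.j h
    have h3 := congrArg EvenClifford.k h
    ext i
    fin_cases i
    · exact h1
    · exact h2
    · exact h3
  have := t.adjGrad_grad x
  rw [hg, t.adjGrad_grad] at this
  exact (smul_right_injective _ (mul_ne_zero two_ne_zero hd) this).symm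

lemma ofDual_add (x y : Fin 3 → ℤ) : ofDual t (x + y) = ofDual t x + ofDual t y := by
  ext <;> simp [ofDual, add_def]

lemma ofDual_smul (r : ℤ) (x : Fin 3 → ℤ) : ofDual t (r • x) = r • ofDual t x := by
  ext <;> simp [ofDual, smul_def]

lemma trd_conj_ofVec_mul_ofVec (x y : Fin 3 → ℤ) :
    ((ofVec t x).conj * ofVec t y).trd = t.disc * t.polar x y := by
  have h := nrd_ofVec (t := t) (x + y)
  rw [ofVec_add, nrd_add, nrd_ofVec, nrd_ofVec, t.val_add, trd_mul_comm, conj_ofVec] at h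
  rw [conj_ofVec, neg_mul, ← mul_neg, trd_mul_comm]
  linear_combination h

/-- An element of the ideal `(X, m)` of norm `m` normalizing the lattice of vectors gives an
endomorphism with the properties used to build a rational isometry of denominator `m`. -/
theorem exists_linearMap_of_nrd_eq (hd : t.disc ≠ 0) {m : ℤ}
    (hmd : IsCoprime m (2 * t.disc)) {x : Fin 3 → ℤ} (hx : m ^ 2 ∣ t.val x)
    {a : EvenClifford t} (ha : InIdeal m (ofVec t x) a) (hn : a.nrd = m) (hst : TwistStable a) :
    ∃ C : (Fin 3 → ℤ) →ₗ[ℤ] (Fin 3 → ℤ),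
      (∀ ξ, m * (C ξ 0 * ξ 0 + C ξ 1 * ξ 1 + C ξ 2 * ξ 2) + t.val (C ξ) = 0) ∧
      (∀ ξ, ∃ (s : ℤ) (v : Fin 3 → ℤ), C ξ = s • x + m • v) ∧
      ∀ ξ, m ^ 2 ∣ m * (x 0 * ξ 0 + x 1 * ξ 1 + x 2 * ξ 2) + t.polar x (C ξ) := by
  have hinj := ofVec_injective hd
  have key : ∀ ξ, ∃ v, ofVec t v = a * ofDual t ξ * a.conj - m • ofDual t ξ := by
    intro ξ
    obtain ⟨d, ⟨u, w, huw⟩, H⟩ := hst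
    obtain ⟨v1, h1⟩ := H ξ
    obtain ⟨v2, h2⟩ := two_disc_smul_eq_ofVec (trd_twist a (ofDual t ξ))
    rw [hn] at h1 h2
    refine ⟨u • v1 + w • v2, ?_⟩
    rw [ofVec_add, ofVec_smul, ofVec_smul, ← h1, ← h2, smul_smul, smul_smul, ← add_smul, huw,
      one_smul]
  choose c hc using key
  let C : (Fin 3 → ℤ) →ₗ[ℤ] (Fin 3 → ℤ) :=
    { toFun := c
      map_add' := fun ξ ζ => hinj (by
        rw [ofVec_add, hc, hc, hc, ofDual_add, mul_add, add_mul, smul_add]; abel)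
      map_smul' := fun r ξ => hinj (by
        rw [ofVec_smul, hc, RingHom.id_apply, hc, ofDual_smul, mul_smul_comm, smul_mul_assoc,
          smul_sub, smul_comm m]) }
  have hC : ∀ ξ, ofVec t (C ξ) = a * ofDual t ξ * a.conj - m • ofDual t ξ := hc
  clear_value C
  clear hc c
  have hC' : ∀ ξ, a * ofDual t ξ * a.conj = m • ofDual t ξ + ofVec t (C ξ) := fun ξ => by
    rw [hC]; abel
  obtain ⟨k, hk⟩ := hx
  obtain ⟨z, w, rfl⟩ := ha
  have hX : (ofVec t x).nrd = m ^ 2 * (t.disc * k) := by rw [nrd_ofVec, hk]; ring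
  refine ⟨C, fun ξ => ?_, fun ξ => ?_, fun ξ => ?_⟩
  · have h := congrArg nrd (hC' ξ)
    rw [nrd_add, nrd_mul, nrd_mul, nrd_conj, hn, nrd_smul, smul_mul_assoc, trd_smul,
      trd_ofDual_mul_conj_ofVec, nrd_ofVec] at h
    apply mul_left_cancel₀ hd
    linear_combination -h
  · set X := ofVec t x with hXdef
    have hXc : X.conj = -X := conj_ofVec x
    set T := z * ofDual t ξ * z.conj with hT
    have h1 : X * z * ofDual t ξ * (X * z).conj =
        -((X * T).trd • X) + (m ^ 2 * (t.disc * k)) • T.conj := by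
      have : X * z * ofDual t ξ * (X * z).conj = -(X * T * X) := by
        rw [conj_mul, hXc, hT]
        simp only [mul_assoc, mul_neg]
      rw [this, mul_mul_self, hX]
      abel
    have h2 : ofVec t (C ξ + (X * T).trd • x) = m • ((m * (t.disc * k)) • T.conj +
        X * z * ofDual t ξ * w.conj + w * ofDual t ξ * (X * z).conj +
        m • (w * ofDual t ξ * w.conj) - ofDual t ξ) := by
      rw [ofVec_add, ofVec_smul, ← hXdef, hC, conj_add, conj_smul]
      simp only [add_mul, mul_add, smul_mul_assoc, mul_smul_comm]
      rw [h1]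
      generalize X * z * ofDual t ξ * w.conj = A
      generalize w * ofDual t ξ * (X * z).conj = B
      generalize w * ofDual t ξ * w.conj = D
      generalize (X * T).trd = e
      generalize T.conj = F
      clear_value X
      match_scalars <;> ring
    obtain ⟨v, hv⟩ := exists_smul_of_ofVec_eq_smul hmd h2
    refine ⟨-(X * T).trd, v, ?_⟩
    rw [← hv]
    module
  · set X := ofVec t x with hXdef
    have hXc : X.conj = -X := conj_ofVec x
    set a := X * z + m • w with hadef
    have h1 : X.conj * a = m • ((m * (t.disc * k)) • z + X.conj * w) := by
      rw [hadef, mul_add, ← mul_assoc, conj_mul_self, hX, smul_mul_assoc, one_mul, mul_smul_comm,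
        smul_add, smul_smul]
      congr 2; ring
    have h2 : ∃ Y, a.conj * (X.conj * a) = (m ^ 2) • Y := by
      refine ⟨(t.disc * k) • (z.conj * X.conj * z) - (m * (t.disc * k)) • (z.conj * w) +
        w.conj * ((m * (t.disc * k)) • z + X.conj * w), ?_⟩
      have e : z.conj * X.conj * (X.conj * w) = -((m ^ 2 * (t.disc * k)) • (z.conj * w)) := by
        have : X.conj * (X.conj * w) = -((m ^ 2 * (t.disc * k)) • w) := by
          rw [← mul_assoc]
          nth_rewrite 2 [hXc]
          rw [mul_neg, conj_mul_self, hX, neg_mul, smul_mul_assoc, one_mul]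
        rw [mul_assoc, this, mul_neg, mul_smul_comm]
      rw [h1, hadef, conj_add, conj_mul, conj_smul, mul_smul_comm, add_mul, mul_add, e,
        mul_smul_comm, smul_mul_assoc m w.conj]
      generalize w.conj * ((m * (t.disc * k)) • z + X.conj * w) = A
      generalize z.conj * X.conj * z = B
      generalize z.conj * w = D
      clear_value X
      match_scalars <;> ring
    obtain ⟨Y, hY⟩ := h2
    have h3 : (a.conj * (X.conj * a) * ofDual t ξ).trd =
        t.disc * (m * (x 0 * ξ 0 + x 1 * ξ 1 + x 2 * ξ 2) + t.polar x (C ξ)) := by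
      rw [mul_assoc, trd_mul_comm, mul_assoc, mul_assoc, ← mul_assoc a, hC', mul_add, trd_add,
        mul_smul_comm, trd_smul, trd_conj_ofVec_mul_ofVec, trd_mul_comm, hXdef,
        trd_ofDual_mul_conj_ofVec]
      ring
    have h4 : m ^ 2 ∣ t.disc * (m * (x 0 * ξ 0 + x 1 * ξ 1 + x 2 * ξ 2) + t.polar x (C ξ)) := by
      rw [← h3, hY, smul_mul_assoc, trd_smul]
      exact dvd_mul_right _ _
    exact (IsCoprime.pow_left hmd.of_mul_right_right).dvd_of_dvd_mul_left h4

end EvenClifford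

lemma exists_crt {M : Type*} [AddCommGroup M] (N k : ℕ) (f : ℕ → M) :
    ∃ x : M, ∀ p : ℕ, p.Prime → p ∣ N → N ≠ 0 → ∃ y, x - f p = ((p : ℤ) ^ k) • y := by
  classical
  suffices h : ∀ S : Finset ℕ, (∀ p ∈ S, p.Prime) →
      ∃ x : M, ∀ p ∈ S, ∃ y, x - f p = ((p : ℤ) ^ k) • y by
    obtain ⟨x, hx⟩ := h N.primeFactors fun p hp => Nat.prime_of_mem_primeFactors hp
    exact ⟨x, fun p hp hpN hN => hx p (Nat.mem_primeFactors.2 ⟨hp, hpN, hN⟩)⟩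
  intro S
  induction S using Finset.induction_on with
  | empty => exact fun _ => ⟨0, by simp⟩
  | insert q S hq ih =>
    intro hS
    obtain ⟨x, hx⟩ := ih fun p hp => hS p (Finset.mem_insert_of_mem hp)
    have hc : IsCoprime ((q : ℤ) ^ k) (∏ p ∈ S, (p : ℤ) ^ k) := by
      refine IsCoprime.prod_right fun p hp => IsCoprime.pow ?_
      rw [Nat.isCoprime_iff_coprime]
      exact (Nat.coprime_primes (hS q (Finset.mem_insert_self _ _))
        (hS p (Finset.mem_insert_of_mem hp))).2 (fun h => hq (h ▸ hp))
    obtain ⟨a, b, hab⟩ := hc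
    refine ⟨(b * ∏ p ∈ S, (p : ℤ) ^ k) • f q + (a * (q : ℤ) ^ k) • x, fun p hp => ?_⟩
    rcases Finset.mem_insert.1 hp with rfl | hp
    · refine ⟨a • (x - f p), ?_⟩
      rw [show b * ∏ p ∈ S, (p : ℤ) ^ k = 1 - a * (p : ℤ) ^ k by linarith]
      module
    · obtain ⟨y, hy⟩ := hx p hp
      obtain ⟨c, hc⟩ : (p : ℤ) ^ k ∣ ∏ p ∈ S, (p : ℤ) ^ k := Finset.dvd_prod_of_mem _ hp
      refine ⟨y + (b * c) • (f q - x), ?_⟩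
      rw [smul_add, ← hy, show a * (q : ℤ) ^ k = 1 - b * ∏ p ∈ S, (p : ℤ) ^ k by linarith, hc]
      module

lemma exists_crt_pair {M : Type*} [AddCommGroup M] {a b : ℤ} (h : IsCoprime a b) (u v : M) :
    ∃ x y z : M, x = u + a • y ∧ x = v + b • z := by
  obtain ⟨r, s, h⟩ := h
  refine ⟨(s * b) • u + (r * a) • v, r • (v - u), s • (u - v), ?_, ?_⟩
  · rw [show s * b = 1 - r * a by linarith]; module
  · rw [show r * a = 1 - s * b by linarith]; module

lemma dvd_of_forall_prime_pow_dvd {M : ℕ} (hM : M ≠ 0) {x : ℤ}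
    (h : ∀ p : ℕ, p.Prime → p ∣ M → (p : ℤ) ^ M ∣ x) : (M : ℤ) ∣ x := by
  rw [Int.natCast_dvd, Nat.dvd_iff_prime_pow_dvd_dvd]
  intro p k hp hk
  rcases Nat.eq_zero_or_pos k with rfl | hk0
  · simp
  have hpM : p ∣ M := (dvd_pow_self p hk0.ne').trans hk
  have hkM : k ≤ M :=
    (Nat.lt_pow_self hp.one_lt).le.trans (Nat.le_of_dvd (Nat.pos_of_ne_zero hM) hk)
  have := h p hp hpM
  rw [← Nat.cast_pow, Int.natCast_dvd] at this
  exact (pow_dvd_pow p hkM).trans this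

lemma isCoprime_of_forall_prime {a b : ℤ}
    (h : ∀ p : ℕ, p.Prime → (p : ℤ) ∣ b → ¬(p : ℤ) ∣ a) : IsCoprime a b := by
  rw [Int.isCoprime_iff_gcd_eq_one]
  by_contra hg
  obtain ⟨p, hp, hpd⟩ := Nat.exists_prime_and_dvd hg
  exact h p hp ((Int.natCast_dvd_natCast.2 hpd).trans (Int.gcd_dvd_right a b))
    ((Int.natCast_dvd_natCast.2 hpd).trans (Int.gcd_dvd_left a b))

lemma not_dvd_of_isCoprime {a b : ℤ} (h : IsCoprime a b) {p : ℕ} (hp : p.Prime)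
    (hb : (p : ℤ) ∣ b) : ¬(p : ℤ) ∣ a := fun ha =>
  (Nat.prime_iff_prime_int.1 hp).not_isUnit (h.isUnit_of_dvd' ha hb)

/-- Newton iteration for an integral quadratic polynomial with invertible derivative. -/
lemma exists_quadratic_root {P a b c : ℤ} (hb : IsCoprime b P) (hc : P ∣ c) (k : ℕ) :
    ∃ h, P ∣ h ∧ P ^ k ∣ a * h ^ 2 + b * h + c := by
  induction k with
  | zero => exact ⟨0, by simp, by simp⟩
  | succ k ih =>
    rcases Nat.eq_zero_or_pos k with rfl | hk
    · exact ⟨0, by simp, by simpa using hc⟩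
    obtain ⟨h, ⟨g, rfl⟩, e, he⟩ := ih
    have hu : IsCoprime (2 * a * (P * g) + b) P := by
      rw [show 2 * a * (P * g) + b = b + (2 * a * g) * P by ring]
      exact hb.add_mul_right_left _
    obtain ⟨u, v, huv⟩ := hu
    obtain ⟨j, rfl⟩ : ∃ j, k = j + 1 := ⟨k - 1, by omega⟩
    refine ⟨P * g - P ^ (j + 1) * (u * e), ⟨g - P ^ j * (u * e), by ring⟩,
      e * v + a * P ^ j * (u * e) ^ 2, ?_⟩
    linear_combination he - e * P ^ (j + 1) * huv

lemma exists_sq_dvd_sub {N n : ℤ} (hn : 4 * N ∣ n - 1) (k : ℕ) :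
    ∃ c, N ^ k ∣ c ^ 2 - n ∧ IsCoprime c N := by
  obtain ⟨w, hw⟩ := hn
  obtain ⟨h, ⟨g, hg⟩, e, he⟩ := exists_quadratic_root (P := N) (a := 1) (b := 1) (c := -N * w)
    isCoprime_one_left (by simp) k
  refine ⟨1 + 2 * h, ⟨4 * e, ?_⟩, ⟨1, -2 * g, ?_⟩⟩
  · linear_combination 4 * he - hw
  · rw [hg]; ring

lemma exists_quadratic_pos {a : ℤ} (ha : 0 < a) (b c : ℤ) : ∃ k, 0 < a * k ^ 2 + b * k + c := by
  refine ⟨|b| + |c| + 1, ?_⟩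
  have h1 := neg_abs_le b
  have h2 := neg_abs_le c
  have h3 := abs_nonneg b
  have h4 := abs_nonneg c
  nlinarith [mul_nonneg (by linarith : 0 ≤ b + |b|) (by linarith : 0 ≤ |b| + |c| + 1),
    mul_nonneg (by linarith : 0 ≤ a - 1) (sq_nonneg (|b| + |c| + 1)), mul_nonneg h4 h4,
    mul_nonneg h3 h4]

set_option synthInstance.maxHeartbeats 200000 in
set_option synthInstance.maxSize 1000 in
lemma exists_binary_eq_zmod_two : ∀ a b c r : ZMod 2, 4 * a * c - b ^ 2 ≠ 0 → r ≠ 0 →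
    ∃ X Y, a * X ^ 2 + b * (X * Y) + c * Y ^ 2 = r ∧
      (2 * a * X + b * Y ≠ 0 ∨ b * X + 2 * c * Y ≠ 0) := by decide

lemma exists_binary_eq_zmod {p : ℕ} [Fact p.Prime] {a b c r : ZMod p} (hd : 4 * a * c - b ^ 2 ≠ 0)
    (hr : r ≠ 0) : ∃ X Y, a * X ^ 2 + b * (X * Y) + c * Y ^ 2 = r ∧
      (2 * a * X + b * Y ≠ 0 ∨ b * X + 2 * c * Y ≠ 0) := by
  have hp : p.Prime := Fact.out
  rcases hp.eq_two_or_odd with rfl | hodd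
  · exact exists_binary_eq_zmod_two a b c r hd hr
  have h2 : (2 : ZMod p) ≠ 0 := by
    intro h
    have : ((2 : ℕ) : ZMod p) = 0 := by exact_mod_cast h
    rw [ZMod.natCast_eq_zero_iff] at this
    have := (Nat.prime_dvd_prime_iff_eq hp Nat.prime_two).1 this
    omega
  suffices h : ∃ X Y, a * X ^ 2 + b * (X * Y) + c * Y ^ 2 = r by
    obtain ⟨X, Y, h⟩ := h
    refine ⟨X, Y, h, ?_⟩
    by_contra! hc
    refine mul_ne_zero h2 hr ?_
    linear_combination (-2) * h + X * hc.1 + Y * hc.2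
  by_cases ha : a = 0
  · subst ha
    have hb : b ≠ 0 := by rintro rfl; simp at hd
    exact ⟨(r - c) * b⁻¹, 1, by field_simp; ring⟩
  · have h4 : (4 : ZMod p) ≠ 0 := by
      rw [show (4 : ZMod p) = 2 * 2 by norm_num]; exact mul_ne_zero h2 h2
    obtain ⟨U, Y, h⟩ := FiniteField.exists_root_sum_quadratic
      (f := Polynomial.C 1 * Polynomial.X ^ 2 + Polynomial.C 0 * Polynomial.X + Polynomial.C 0)
      (g := Polynomial.C (4 * a * c - b ^ 2) * Polynomial.X ^ 2 + Polynomial.C 0 * Polynomial.X +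
        Polynomial.C (-(4 * a * r)))
      (Polynomial.degree_quadratic one_ne_zero) (Polynomial.degree_quadratic hd)
      (by rw [ZMod.card]; exact hodd)
    simp only [Polynomial.eval_add, Polynomial.eval_mul, Polynomial.eval_C, Polynomial.eval_pow,
      Polynomial.eval_X] at h
    refine ⟨(U - b * Y) * (2 * a)⁻¹, Y, ?_⟩
    have h2a : 2 * a ≠ 0 := mul_ne_zero h2 ha
    field_simp
    linear_combination h

namespace TernaryForm

variable (t : TernaryForm ℤ)

lemma polar_add_smul_left (x y z : Fin 3 → ℤ) (r s : ℤ) :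
    t.polar (r • x + s • y) z = r * t.polar x z + s * t.polar y z := by
  simp only [polar, grad, Pi.add_apply, Pi.smul_apply, smul_eq_mul, Matrix.cons_val]; ring

lemma val_add_smul (x y : Fin 3 → ℤ) (r : ℤ) :
    t.val (x + r • y) = t.val x + r * t.polar x y + r ^ 2 * t.val y := by
  simp [val, polar, grad]; ring

lemma val_smul_add_smul (x y : Fin 3 → ℤ) (r s : ℤ) :
    t.val (r • x + s • y) = t.val x * r ^ 2 + t.polar x y * (r * s) + t.val y * s ^ 2 := by
  simp [val, polar, grad]; ring

lemma polar_comm (x y : Fin 3 → ℤ) : t.polar x y = t.polar y x := by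
  simp [polar, grad]; ring

lemma polar_self (x : Fin 3 → ℤ) : t.polar x x = 2 * t.val x := by
  simp [val, polar, grad]; ring

lemma exists_val_modEq {p : ℕ} (hp : p.Prime) {z₁ z₂ : Fin 3 → ℤ}
    (hz : ¬(p : ℤ) ∣ 4 * t.val z₁ * t.val z₂ - t.polar z₁ z₂ ^ 2) {r : ℤ} (hr : ¬(p : ℤ) ∣ r) :
    ∃ v w, (p : ℤ) ∣ t.val v - r ∧ ¬(p : ℤ) ∣ t.polar v w := by
  have := Fact.mk hp
  simp only [← ZMod.intCast_zmod_eq_zero_iff_dvd] at hz hr ⊢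
  push_cast at hz ⊢
  obtain ⟨X, Y, h, h'⟩ := exists_binary_eq_zmod hz hr
  obtain ⟨X, rfl⟩ := ZMod.intCast_surjective X
  obtain ⟨Y, rfl⟩ := ZMod.intCast_surjective Y
  refine ⟨X • z₁ + Y • z₂, if 2 * t.val z₁ * (X : ZMod p) + t.polar z₁ z₂ * Y ≠ 0 then z₁ else z₂,
    ?_, ?_⟩
  · rw [val_smul_add_smul]
    push_cast
    rw [h, sub_self]
  · split_ifs with h''
    · rw [polar_add_smul_left, polar_self, polar_comm t z₂]
      push_cast
      convert h'' using 1
      ring_nf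
    · have := h'.resolve_left h''
      rw [polar_add_smul_left, polar_self]
      push_cast
      convert this using 1
      ring_nf

lemma exists_val_eq_of_local {N : ℕ} (hN : N ≠ 0)
    (hloc : ∀ p : ℕ, p.Prime → p ∣ N →
      ∃ z₁ z₂, ¬(p : ℤ) ∣ 4 * t.val z₁ * t.val z₂ - t.polar z₁ z₂ ^ 2)
    (hpos : ∃ z, 0 < t.val z) {r : ℤ} (hr : IsCoprime r N) :
    ∃ v, 0 < t.val v ∧ (N : ℤ) ∣ t.val v - r := by
  have h1 : ∀ p : ℕ, ∃ vw : (Fin 3 → ℤ) × (Fin 3 → ℤ), p.Prime → p ∣ N →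
      (p : ℤ) ∣ t.val vw.1 - r ∧ ¬(p : ℤ) ∣ t.polar vw.1 vw.2 := by
    intro p
    by_cases h : p.Prime ∧ p ∣ N
    · obtain ⟨z₁, z₂, hz⟩ := hloc p h.1 h.2
      obtain ⟨v, w, hv⟩ := t.exists_val_modEq h.1 hz
        (not_dvd_of_isCoprime hr h.1 (Int.natCast_dvd_natCast.2 h.2))
      exact ⟨(v, w), fun _ _ => hv⟩
    · exact ⟨0, fun h1 h2 => (h ⟨h1, h2⟩).elim⟩
  choose f hf using h1
  obtain ⟨⟨v, w⟩, hvw⟩ := exists_crt N 1 f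
  have key : ∀ p : ℕ, p.Prime → p ∣ N → (p : ℤ) ∣ t.val v - r ∧ ¬(p : ℤ) ∣ t.polar v w := by
    intro p hp hpN
    obtain ⟨⟨y, z⟩, hy⟩ := hvw p hp hpN hN
    obtain ⟨ha, hb⟩ := hf p hp hpN
    have e1 : v = (f p).1 + (p : ℤ) • y := by
      have := congrArg Prod.fst hy
      simp only [pow_one] at this
      rw [← sub_eq_iff_eq_add']
      exact this
    have e2 : w = (f p).2 + (p : ℤ) • z := by
      have := congrArg Prod.snd hy
      simp only [pow_one] at this
      rw [← sub_eq_iff_eq_add']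
      exact this
    have e3 : t.val v = t.val (f p).1 + p * (t.polar (f p).1 y + p * t.val y) := by
      rw [e1, val_add_smul]; ring
    have e4 : t.polar v w = t.polar (f p).1 (f p).2 +
        p * (t.polar (f p).1 z + t.polar y (f p).2 + p * t.polar y z) := by
      rw [e1, e2]; simp [polar, grad]; ring
    rw [e3, e4, dvd_add_left (dvd_mul_right _ _), add_sub_right_comm,
      dvd_add_left (dvd_mul_right _ _)]
    exact ⟨ha, hb⟩
  have hP : (∏ p ∈ N.primeFactors, (p : ℤ)) ∣ t.val v - r := by
    refine Finset.prod_dvd_of_coprime ?_ fun p hp =>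
      (key p (Nat.prime_of_mem_primeFactors hp) (Nat.dvd_of_mem_primeFactors hp)).1
    intro p hp q hq hpq
    rw [Function.onFun, Nat.isCoprime_iff_coprime]
    exact (Nat.coprime_primes (Nat.prime_of_mem_primeFactors hp)
      (Nat.prime_of_mem_primeFactors hq)).2 hpq
  have hPc : IsCoprime (t.polar v w) (∏ p ∈ N.primeFactors, (p : ℤ)) := by
    refine IsCoprime.prod_right fun p hp => ?_
    have := (key p (Nat.prime_of_mem_primeFactors hp) (Nat.dvd_of_mem_primeFactors hp)).2
    exact ((Nat.prime_iff_prime_int.1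
      (Nat.prime_of_mem_primeFactors hp)).coprime_iff_not_dvd.2 this).symm
  obtain ⟨h, -, hh⟩ := exists_quadratic_root (a := t.val w) hPc hP N
  have hNv : (N : ℤ) ∣ t.val (v + h • w) - r := by
    refine dvd_of_forall_prime_pow_dvd hN fun p hp hpN => ?_
    rw [show t.val (v + h • w) - r = t.val w * h ^ 2 + t.polar v w * h + (t.val v - r) by
      rw [val_add_smul]; ring]
    refine (pow_dvd_pow_of_dvd (Finset.dvd_prod_of_mem (fun p : ℕ => (p : ℤ)) ?_) N).trans hh
    exact Nat.mem_primeFactors.2 ⟨hp, hpN, hN⟩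
  obtain ⟨z, hz⟩ := hpos
  have hN' : (0 : ℤ) < N := by exact_mod_cast Nat.pos_of_ne_zero hN
  obtain ⟨k, hk⟩ := exists_quadratic_pos (a := N ^ 2 * t.val z) (by positivity)
    (N * t.polar (v + h • w) z) (t.val (v + h • w))
  refine ⟨v + h • w + (N * k) • z, ?_, ?_⟩
  · rw [val_add_smul]; linarith
  · rw [val_add_smul, show t.val (v + h • w) + N * k * t.polar (v + h • w) z +
      (N * k) ^ 2 * t.val z - r = (t.val (v + h • w) - r) +
        N * (k * t.polar (v + h • w) z + N * k ^ 2 * t.val z) by ring]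
    exact dvd_add hNv (dvd_mul_right _ _)

end TernaryForm

namespace EvenClifford

variable {t : TernaryForm ℤ}

/-- The element with coordinates `x` in the basis `1, V₁, V₂, V₁V₂`. -/
def ofCoords (t : TernaryForm ℤ) (v₁ v₂ : Fin 3 → ℤ) (x : Fin 4 → ℤ) : EvenClifford t :=
  x 0 • 1 + x 1 • ofVec t v₁ + x 2 • ofVec t v₂ + x 3 • (ofVec t v₁ * ofVec t v₂)

lemma ofCoords_add (v₁ v₂ : Fin 3 → ℤ) (x y : Fin 4 → ℤ) :
    ofCoords t v₁ v₂ (x + y) = ofCoords t v₁ v₂ x + ofCoords t v₁ v₂ y := by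
  simp only [ofCoords, Pi.add_apply, add_smul]
  abel

lemma nrd_ofCoords {v₁ v₂ : Fin 3 → ℤ} (h : t.polar v₁ v₂ = 0) (x : Fin 4 → ℤ) :
    (ofCoords t v₁ v₂ x).nrd = x 0 ^ 2 + (t.disc * t.val v₁) * x 1 ^ 2 +
      (t.disc * t.val v₂) * x 2 ^ 2 + (t.disc * t.val v₁) * (t.disc * t.val v₂) * x 3 ^ 2 := by
  have h12 : (ofVec t v₁ * ofVec t v₂).trd = 0 := by
    have := trd_conj_ofVec_mul_ofVec (t := t) v₁ v₂
    rw [conj_ofVec, h, mul_zero, neg_mul, ← neg_one_smul ℤ, trd_smul] at this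
    linarith
  have h121 : (ofVec t v₁ * (ofVec t v₁ * ofVec t v₂)).trd = 0 := by
    have e : ofVec t v₁ * ofVec t v₁ = (-(ofVec t v₁).nrd) • 1 := by
      rw [neg_smul, ← mul_conj, conj_ofVec, mul_neg, neg_neg]
    rw [← mul_assoc, e, smul_mul_assoc, one_mul, trd_smul, trd_ofVec, mul_zero]
  have h212 : (ofVec t v₂ * (ofVec t v₁ * ofVec t v₂)).trd = 0 := by
    have e : ofVec t v₂ * ofVec t v₂ = (-(ofVec t v₂).nrd) • 1 := by
      rw [neg_smul, ← mul_conj, conj_ofVec, mul_neg, neg_neg]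
    rw [trd_mul_comm, mul_assoc, e, mul_smul_comm, mul_one, trd_smul, trd_ofVec, mul_zero]
  have hc : (ofVec t v₁ * ofVec t v₂).conj = -(ofVec t v₁ * ofVec t v₂) := by
    rw [conj_eq, h12]; module
  rw [ofCoords, nrd_add, nrd_add, nrd_add]
  simp only [conj_smul, hc, conj_ofVec, nrd_smul, nrd_one, nrd_mul, nrd_ofVec, mul_one,
    add_mul, smul_mul_assoc, mul_smul_comm, trd_add, trd_smul, smul_neg, mul_neg, one_mul,
    show ∀ z : EvenClifford t, (-z).trd = -z.trd from fun z => by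
      rw [← neg_one_smul ℤ, trd_smul]; ring, trd_ofVec, h12, h121, h212, mul_zero, neg_zero,
    add_zero]
  ring

lemma ofCoords_ne_zero (hd : t.disc ≠ 0) {v₁ v₂ : Fin 3 → ℤ} (h : t.polar v₁ v₂ = 0)
    (h1 : t.val v₁ ≠ 0) (h2 : t.val v₂ ≠ 0) {x : Fin 4 → ℤ} (hx : x ≠ 0) :
    ofCoords t v₁ v₂ x ≠ 0 := by
  intro h0
  refine hx (funext fun i => ?_)
  have key : ∀ e, (ofCoords t v₁ v₂ (x + e)).nrd = (ofCoords t v₁ v₂ e).nrd := fun e => by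
    rw [ofCoords_add, h0, zero_add]
  have hq : (ofCoords t v₁ v₂ x).nrd = 0 := by rw [h0, nrd_zero]
  have k := key (Pi.single i 1)
  simp only [nrd_ofCoords h] at k hq
  have h3 : t.disc * t.val v₁ ≠ 0 := mul_ne_zero hd h1
  have h4 : t.disc * t.val v₂ ≠ 0 := mul_ne_zero hd h2
  fin_cases i
  · simp at k ⊢; linarith
  · simp at k ⊢
    have : (t.disc * t.val v₁) * x 1 = 0 := by linarith
    exact (mul_eq_zero.1 this).resolve_left h3
  · simp at k ⊢
    have : (t.disc * t.val v₂) * x 2 = 0 := by linarith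
    exact (mul_eq_zero.1 this).resolve_left h4
  · simp at k ⊢
    have : (t.disc * t.val v₁ * (t.disc * t.val v₂)) * x 3 = 0 := by linarith
    exact (mul_eq_zero.1 this).resolve_left (mul_ne_zero h3 h4)

lemma exists_orthogonal {z₁ z₂ : Fin 3 → ℤ}
    (h : 4 * t.val z₁ * t.val z₂ - t.polar z₁ z₂ ^ 2 ≠ 0) :
    ∃ v₁ v₂, t.polar v₁ v₂ = 0 ∧ t.val v₁ ≠ 0 ∧ t.val v₂ ≠ 0 := by
  have key : ∀ v y, t.val v ≠ 0 → 4 * t.val v * t.val y - t.polar v y ^ 2 ≠ 0 →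
      ∃ v₁ v₂, t.polar v₁ v₂ = 0 ∧ t.val v₁ ≠ 0 ∧ t.val v₂ ≠ 0 := by
    intro v y hv h
    refine ⟨v, (2 * t.val v) • y + (-t.polar v y) • v, ?_, hv, ?_⟩
    · rw [t.polar_comm, t.polar_add_smul_left, t.polar_self, t.polar_comm y]; ring
    · rw [t.val_smul_add_smul, t.polar_comm y]
      convert mul_ne_zero hv h using 1
      ring
  by_cases h1 : t.val z₁ = 0
  · by_cases h2 : t.val z₂ = 0
    · refine key (z₁ + (1 : ℤ) • z₂) z₂ ?_ ?_
      · rw [t.val_add_smul, h1, h2]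
        rintro h3
        rw [h1, h2] at h
        exact h (by simp at h3; simp [h3])
      · rw [show z₁ + (1 : ℤ) • z₂ = (1 : ℤ) • z₁ + (1 : ℤ) • z₂ by module,
          t.polar_add_smul_left, t.polar_self, h2]
        rw [h2] at h
        convert h using 1
        ring
    · refine key z₂ z₁ h2 ?_
      rw [t.polar_comm]
      convert h using 1
      ring
  · exact key z₁ z₂ h1 h

lemma exists_trd_mul_ne_zero (hd : t.disc ≠ 0) {δ : EvenClifford t} (h : δ ≠ 0) :
    ∃ z, (δ * z).trd ≠ 0 := by
  by_contra! hc
  exact h (eq_zero_of_trd_mul_eq_zero hd δ hc)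

lemma exists_nrd_eq_mul_sq (hd : t.disc ≠ 0) {z₁ z₂ : Fin 3 → ℤ}
    (h : 4 * t.val z₁ * t.val z₂ - t.polar z₁ z₂ ^ 2 ≠ 0) {n : ℤ} (hn : 0 < n) :
    ∃ (α : EvenClifford t) (s : ℤ), s ≠ 0 ∧ α.nrd = n * s ^ 2 := by
  obtain ⟨v₁, v₂, hv, h1, h2⟩ := exists_orthogonal h
  obtain ⟨x, y, hxy, e⟩ := exists_norm_eq_mul_norm (mul_ne_zero hd h1) (mul_ne_zero hd h2) hn
  rw [← nrd_ofCoords hv, ← nrd_ofCoords hv] at e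
  by_cases hy : (ofCoords t v₁ v₂ y).nrd = 0
  · obtain ⟨δ, hδ, hδ0⟩ : ∃ δ : EvenClifford t, δ ≠ 0 ∧ δ.nrd = 0 := by
      rcases hxy with hx | hy'
      · exact ⟨_, ofCoords_ne_zero hd hv h1 h2 hx, by rw [e, hy, mul_zero]⟩
      · exact ⟨_, ofCoords_ne_zero hd hv h1 h2 hy', hy⟩
    obtain ⟨z, hz⟩ := exists_trd_mul_ne_zero hd hδ
    refine ⟨(n - 1) • (δ * z) + (δ * z).trd • 1, (δ * z).trd, hz, ?_⟩
    rw [nrd_add, conj_smul, conj_one, mul_smul_comm, mul_one, trd_smul, trd_smul, nrd_smul,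
      nrd_smul, nrd_mul, hδ0, nrd_one]
    ring
  · refine ⟨ofCoords t v₁ v₂ x * (ofCoords t v₁ v₂ y).conj, _, hy, ?_⟩
    rw [nrd_mul, nrd_conj, e]
    ring

end EvenClifford

lemma exists_sq_dvd_sub_and_not_dvd {N : ℕ} (hN : N ≠ 0) {n : ℤ} (hn : (4 * N : ℤ) ∣ n - 1)
    (a : ℤ) {s : ℤ} (hs : s ≠ 0) :
    ∃ (F : ℕ) (c : ℤ), (N : ℤ) ^ (F + 1) ∣ c ^ 2 - n ∧ IsCoprime c N ∧
      ∀ p : ℕ, p.Prime → p ∣ N → ¬(p : ℤ) ^ F ∣ a + 2 * c * s := by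
  obtain ⟨F, hF⟩ : ∃ F : ℕ, (4 * s).natAbs < 2 ^ F := ⟨_, Nat.lt_two_pow_self⟩
  set M := N ^ (F + 1) with hM
  have hM0 : M ≠ 0 := pow_ne_zero _ hN
  have hFM : ∀ p : ℕ, p.Prime → p ∣ N → F ≤ M := fun p hp hpN => by
    have : 2 ≤ N := hp.two_le.trans (Nat.le_of_dvd (Nat.pos_of_ne_zero hN) hpN)
    calc F ≤ F + 1 := F.le_succ
      _ ≤ N ^ (F + 1) := (Nat.lt_pow_self this).le
  obtain ⟨c, hc, hcN⟩ := exists_sq_dvd_sub (N := N) hn M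
  classical
  obtain ⟨c', hc'⟩ := exists_crt N M
    (fun p : ℕ => if (p : ℤ) ^ F ∣ a + 2 * c * s then -c else c)
  have hpd : ∀ p : ℕ, p.Prime → p ∣ N → (p : ℤ) ^ M ∣ c' ^ 2 - n := by
    intro p hp hpN
    obtain ⟨y, hy⟩ := hc' p hp hpN hN
    have h1 : (p : ℤ) ^ M ∣ c' ^ 2 - c ^ 2 := by
      rw [smul_eq_mul] at hy
      split_ifs at hy
      · exact ⟨y * (c' - c), by linear_combination (c' - c) * hy⟩
      · exact ⟨y * (c' + c), by linear_combination (c' + c) * hy⟩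
    have h2 : (p : ℤ) ^ M ∣ c ^ 2 - n :=
      (pow_dvd_pow_of_dvd (Int.natCast_dvd_natCast.2 hpN) M).trans hc
    simpa using dvd_add h1 h2
  have hdvd : (N : ℤ) ^ (F + 1) ∣ c' ^ 2 - n := by
    have := dvd_of_forall_prime_pow_dvd hM0 (x := c' ^ 2 - n) fun p hp hpM =>
      hpd p hp (hp.dvd_of_dvd_pow hpM)
    rwa [hM, Nat.cast_pow] at this
  refine ⟨F, c', hdvd, ?_, ?_⟩
  · obtain ⟨w, hw⟩ := hn
    obtain ⟨v, hv⟩ := (dvd_pow_self (N : ℤ) F.succ_ne_zero).trans hdvd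
    exact ⟨c', -(v + 4 * w), by linear_combination hv + hw⟩
  · intro p hp hpN hdiv
    obtain ⟨y, hy⟩ := hc' p hp hpN hN
    have hpF : (p : ℤ) ^ F ∣ (p : ℤ) ^ M := pow_dvd_pow _ (hFM p hp hpN)
    obtain ⟨g, hg⟩ := hpF
    rw [smul_eq_mul, hg] at hy
    split_ifs at hy with h
    · have h4 : (p : ℤ) ^ F ∣ 4 * s * c := by
        have e : 4 * s * c = a + 2 * c * s - (a + 2 * c' * s) - (p : ℤ) ^ F * (-2 * s * g * y) := by
          linear_combination (2 * s) * hy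
        exact e ▸ dvd_sub (dvd_sub h hdiv) (dvd_mul_right _ _)
      have hcp : IsCoprime ((p : ℤ) ^ F) c :=
        IsCoprime.pow_left (hcN.symm.of_isCoprime_of_dvd_left (Int.natCast_dvd_natCast.2 hpN))
      have h5 := hcp.dvd_of_dvd_mul_right h4
      rw [← Nat.cast_pow, Int.natCast_dvd] at h5
      have h6 := Nat.le_of_dvd (by simpa using hs) h5
      have h7 := Nat.pow_le_pow_left hp.two_le F
      omega
    · apply h
      have e : a + 2 * c * s = a + 2 * c' * s - (p : ℤ) ^ F * (2 * s * g * y) := by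
        linear_combination (-2 * s) * hy
      exact e ▸ dvd_sub hdiv (dvd_mul_right _ _)

namespace EvenClifford

variable {t : TernaryForm ℤ}

lemma exists_twistStable (hd : t.disc ≠ 0) {z₁ z₂ : Fin 3 → ℤ}
    (h : 4 * t.val z₁ * t.val z₂ - t.polar z₁ z₂ ^ 2 ≠ 0) {n : ℤ} (hn : 0 < n)
    (hn1 : 4 * (2 * t.disc) ∣ n - 1) :
    ∃ (γ : EvenClifford t) (E : ℤ), TwistStable γ ∧ γ.nrd = n * E ^ 2 ∧
      IsCoprime E (2 * t.disc) := by
  obtain ⟨α, s, hs, hα⟩ := exists_nrd_eq_mul_sq hd h hn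
  set D : ℤ := 2 * t.disc with hD
  have hD0 : D ≠ 0 := mul_ne_zero two_ne_zero hd
  obtain ⟨F, c, hc, hcN, hp⟩ := exists_sq_dvd_sub_and_not_dvd (N := D.natAbs)
    (Int.natAbs_ne_zero.2 hD0) (n := n) (by
      have : (4 * (D.natAbs : ℤ)) ∣ 4 * D := mul_dvd_mul_left _ Int.natAbs_dvd_self
      exact this.trans hn1) α.trd hs
  replace hc : D ^ (F + 1) ∣ c ^ 2 - n :=
    (pow_dvd_pow_of_dvd Int.dvd_natAbs_self _).trans hc
  replace hcN : IsCoprime c D := hcN.of_isCoprime_of_dvd_right Int.dvd_natAbs_self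
  set g := α.trd + 2 * c * s with hg
  obtain ⟨d, g', f', hd0, hcop, hgd, hfd⟩ : ∃ d g' f' : ℤ, d ≠ 0 ∧ IsCoprime g' f' ∧ g = d * g' ∧
      D ^ F = d * f' := by
    have hF0 : D ^ F ≠ 0 := pow_ne_zero _ hD0
    refine ⟨gcd g (D ^ F), g / gcd g (D ^ F), D ^ F / gcd g (D ^ F), ?_, ?_, ?_, ?_⟩
    · rw [Ne, gcd_eq_zero_iff]; exact fun h => hF0 h.2
    · exact isCoprime_div_gcd_div_gcd hF0
    · exact (Int.mul_ediv_cancel' (gcd_dvd_left _ _)).symm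
    · exact (Int.mul_ediv_cancel' (gcd_dvd_right _ _)).symm
  obtain ⟨e, he⟩ := hc
  have he' : c ^ 2 - n = d * (D * (f' * e)) := by rw [he, pow_succ, hfd]; ring
  refine ⟨(n * g') • 1 + D • ((f' * e) • α.conj), c * g' - s * D * (f' * e), ?_, ?_, ?_⟩
  · exact twistStable_add_smul _ _
  · have hd2 : d ^ 2 ≠ 0 := pow_ne_zero _ hd0
    apply mul_left_cancel₀ hd2
    rw [nrd_add, nrd_smul, nrd_smul, nrd_smul, nrd_one, nrd_conj, hα, conj_smul, conj_smul,
      conj_conj, smul_mul_smul_comm, one_mul, trd_smul, trd_smul]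
    have e1 : α.trd = d * g' - 2 * c * s := by rw [← hgd, hg]; ring
    rw [e1]
    have e2 : n = c ^ 2 - d * (D * (f' * e)) := by linarith
    rw [e2]
    ring
  · refine isCoprime_of_forall_prime fun p hpp hpD hpE => ?_
    have hpD' : p ∣ D.natAbs := Int.natCast_dvd.1 hpD
    have hpc := not_dvd_of_isCoprime hcN hpp hpD
    have hpP := Nat.prime_iff_prime_int.1 hpp
    have h1 : (p : ℤ) ∣ c * g' := by
      have : (p : ℤ) ∣ s * D * (f' * e) := (hpD.mul_left s).mul_right _
      simpa using dvd_add hpE this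
    have hpg := (hpP.dvd_or_dvd h1).resolve_left hpc
    have hpf : ¬(p : ℤ) ∣ f' := fun h => hpP.not_isUnit (hcop.isUnit_of_dvd' hpg h)
    apply hp p hpp hpD'
    rw [hgd]
    have h2 : (p : ℤ) ^ F ∣ d * f' := hfd ▸ pow_dvd_pow_of_dvd hpD F
    exact (IsCoprime.dvd_of_dvd_mul_right
      (IsCoprime.pow_left (hpP.coprime_iff_not_dvd.2 hpf)) h2).mul_right _

end EvenClifford

/-- The rank three case: a linear map realising an isometry of scale `m`. -/
theorem TernaryForm.exists_linearMap {t : TernaryForm ℤ} (hd : t.disc ≠ 0)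
    (hpos : ∃ z, 0 < t.val z) (hneg : ∃ z, t.val z < 0)
    (hloc : ∀ p : ℕ, p.Prime → (p : ℤ) ∣ 2 * t.disc →
      ∃ z₁ z₂, ¬(p : ℤ) ∣ 4 * t.val z₁ * t.val z₂ - t.polar z₁ z₂ ^ 2)
    {m : ℤ} (hm : 0 < m) (hmd : IsCoprime m (2 * t.disc)) {x : Fin 3 → ℤ} (hx : m ^ 2 ∣ t.val x)
    (hxp : ∀ p : ℕ, p.Prime → (p : ℤ) ∣ m → ¬ ∃ y, x = (p : ℤ) • y) :
    ∃ C : (Fin 3 → ℤ) →ₗ[ℤ] (Fin 3 → ℤ),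
      (∀ ξ, m * (C ξ 0 * ξ 0 + C ξ 1 * ξ 1 + C ξ 2 * ξ 2) + t.val (C ξ) = 0) ∧
      (∀ ξ, ∃ (s : ℤ) (v : Fin 3 → ℤ), C ξ = s • x + m • v) ∧
      ∀ ξ, m ^ 2 ∣ m * (x 0 * ξ 0 + x 1 * ξ 1 + x 2 * ξ 2) + t.polar x (C ξ) := by
  open EvenClifford in
  set D : ℤ := 2 * t.disc with hD
  have hD0 : D ≠ 0 := mul_ne_zero two_ne_zero hd
  have hN : (4 * D).natAbs ≠ 0 := Int.natAbs_ne_zero.2 (mul_ne_zero four_ne_zero hD0)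
  have hNd : ∀ p : ℕ, p.Prime → p ∣ (4 * D).natAbs → (p : ℤ) ∣ D := by
    intro p hp h
    have h' : (p : ℤ) ∣ 4 * D := Int.natCast_dvd.2 h
    rcases (Nat.prime_iff_prime_int.1 hp).dvd_or_dvd h' with h4 | h4
    · have : (p : ℤ) ∣ 2 := (Nat.prime_iff_prime_int.1 hp).dvd_of_dvd_pow (n := 2) h4
      exact this.mul_right _
    · exact h4
  have hm4 : IsCoprime m (4 * D) :=
    isCoprime_of_forall_prime fun p hp h =>
      not_dvd_of_isCoprime hmd hp (hNd p hp (Int.natCast_dvd.1 h))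
  obtain ⟨r, k, hr⟩ := hm4
  have hr4 : IsCoprime r (4 * D).natAbs :=
    (IsCoprime.of_isCoprime_of_dvd_right (⟨m, k, by linarith⟩ : IsCoprime r (4 * D))
      Int.natAbs_dvd_self)
  have hloc' := fun p hp h => hloc p hp (hNd p hp h)
  obtain ⟨v₁, hv₁, hq₁⟩ := t.exists_val_eq_of_local hN hloc' hpos hr4
  obtain ⟨v₂, hv₂, hq₂⟩ := t.exists_val_eq_of_local hN hloc' hpos isCoprime_one_left
  replace hq₁ := Int.dvd_natAbs_self.trans hq₁
  replace hq₂ := Int.dvd_natAbs_self.trans hq₂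
  have hn1 : 4 * D ∣ m * t.val v₁ * t.val v₂ - 1 := by
    obtain ⟨a, ha⟩ := hq₁
    obtain ⟨b, hb⟩ := hq₂
    refine ⟨m * t.val v₁ * b + m * a - k, ?_⟩
    linear_combination m * t.val v₁ * hb + m * ha + hr
  obtain ⟨z₁, z₂, hz⟩ := hloc 2 Nat.prime_two (by simp [hD])
  obtain ⟨γ, E, hγ, hγn, hE⟩ := exists_twistStable hd (z₁ := z₁) (z₂ := z₂)
    (fun h => hz (h ▸ dvd_zero _)) (mul_pos (mul_pos hm hv₁) hv₂) hn1
  have hnD : IsCoprime (m * t.val v₁ * t.val v₂) D := by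
    obtain ⟨w, hw⟩ := hn1
    exact ⟨1, -4 * w, by linear_combination hw⟩
  have hS : IsCoprime (m * t.val v₁ * t.val v₂ * E) D := hnD.mul_left hE
  obtain ⟨β, h1, h2, h3⟩ := descent (t := t) (by
      rcases lt_or_gt_of_ne hd with h | h
      · exact hpos.imp fun z hz => mul_neg_of_neg_of_pos h hz
      · exact hneg.imp fun z hz => mul_neg_of_pos_of_neg h hz)
    hm.ne' hmd hx hxp (m * t.val v₁ * t.val v₂ * E).natAbs (m • (γ * vecMul t v₁ v₂))
    (hS.of_isCoprime_of_dvd_left Int.natAbs_dvd_self) (inIdeal_smul _)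
    (by rw [nrd_smul, nrd_mul, hγn, nrd_vecMul, Int.natCast_natAbs, sq_abs]; ring)
    ((twistStable_smul_iff hmd).2 (hγ.mul (twistStable_vecMul _ _)))
  exact exists_linearMap_of_nrd_eq hd hmd hx h1 h2 h3

section Lattice

variable {M : Type*} [AddCommGroup M] [Module.Free ℤ M] [Module.Finite ℤ M]

lemma exists_eq_smul_of_forall_dvd {k : ℤ} {x : M} (h : ∀ f : M →ₗ[ℤ] ℤ, k ∣ f x) :
    ∃ y, x = k • y := by
  let b := Module.Free.chooseBasis ℤ M
  choose c hc using fun i => h (b.coord i)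
  refine ⟨∑ i, c i • b i, ?_⟩
  conv_lhs => rw [← b.sum_repr x]
  rw [Finset.smul_sum (M := ℤ)]
  refine Finset.sum_congr rfl fun i _ => ?_
  rw [smul_smul, ← hc i]
  rfl

lemma finrank_le_of_forall_mem_span_mod {p : ℕ} (hp : p.Prime) {k : ℕ} (v : Fin k → M)
    (h : ∀ y : M, ∃ (D : ℤ) (c : Fin k → ℤ) (z : M), ¬(p : ℤ) ∣ D ∧
      D • y = ∑ i, c i • v i + (p : ℤ) • z) : Module.finrank ℤ M ≤ k := by
  have := Fact.mk hp
  let b := Module.finBasis ℤ M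
  let r : M → (Fin (Module.finrank ℤ M) → ZMod p) := fun x i => ((b.repr x i : ℤ) : ZMod p)
  have radd : ∀ x y, r (x + y) = r x + r y := fun x y => by ext; simp [r]
  have rsmul : ∀ (a : ℤ) x, r (a • x) = (a : ZMod p) • r x := fun a x => by ext; simp [r]
  have rsum : ∀ c : Fin k → ℤ, r (∑ i, c i • v i) = ∑ i, (c i : ZMod p) • r (v i) := fun c => by
    ext; simp [r, Finset.sum_apply]
  have hspan : Submodule.span (ZMod p) (Set.range fun i => r (v i)) = ⊤ := by
    rw [eq_top_iff]
    intro w _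
    choose w' hw' using fun i => ZMod.intCast_surjective (w i)
    obtain ⟨D, c, z, hD, e⟩ := h (∑ i, w' i • b i)
    have hr : r (∑ i, w' i • b i) = w := by
      ext j
      simp [r, ← hw', Finsupp.single_apply]
    have e' := congrArg r e
    rw [rsmul, radd, rsum, rsmul, hr, Int.cast_natCast, ZMod.natCast_self, zero_smul,
      add_zero] at e'
    have hD' : (D : ZMod p) ≠ 0 := by rwa [Ne, ZMod.intCast_zmod_eq_zero_iff_dvd]
    rw [← inv_smul_smul₀ hD' w, e']
    exact Submodule.smul_mem _ _ (Submodule.sum_mem _ fun i _ =>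
      Submodule.smul_mem _ _ (Submodule.subset_span ⟨i, rfl⟩))
  have := finrank_range_le_card (R := ZMod p) (fun i => r (v i))
  rw [Set.finrank, hspan, finrank_top] at this
  simpa using this

variable {B : LinearMap.BilinForm ℤ M} {N : ℕ}

lemma exists_eq_smul_of_forall_dvd_form
    (hdual : ∀ f : M →ₗ[ℤ] ℤ, ∃ y, ∀ z, B z y = N * f z) {p : ℕ} (hp : p.Prime)
    (hpN : ¬ p ∣ N) {x : M} (h : ∀ y, (p : ℤ) ∣ B x y) : ∃ y, x = (p : ℤ) • y := by
  refine exists_eq_smul_of_forall_dvd fun f => ?_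
  obtain ⟨y, hy⟩ := hdual f
  have := h y
  rw [hy] at this
  exact ((Nat.prime_iff_prime_int.1 hp).dvd_or_dvd this).resolve_left
    (fun h => hpN (Int.natCast_dvd_natCast.1 h))

omit [Module.Free ℤ M] [Module.Finite ℤ M] in
/-- A symmetric bilinear form vanishing modulo an odd prime on the diagonal vanishes modulo it. -/
lemma exists_not_dvd_diag (S : LinearMap.BilinForm ℤ M) (hS : ∀ x y, S x y = S y x) {p : ℕ}
    (hp : p.Prime) (hp2 : ¬ p ∣ 2) {y z : M} (h : ¬(p : ℤ) ∣ S y z) : ∃ x, ¬(p : ℤ) ∣ S x x := by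
  by_contra! hc
  have h1 := dvd_sub (dvd_sub (hc (y + z)) (hc y)) (hc z)
  have e : S (y + z) (y + z) - S y y - S z z = 2 * S y z := by
    simp only [map_add, LinearMap.add_apply, hS z y]; ring
  rw [e] at h1
  exact ((Nat.prime_iff_prime_int.1 hp).dvd_or_dvd h1).elim
    (fun h => hp2 (by exact_mod_cast h)) h

/-- The Gram determinant of two vectors. -/
def gram₂ (B : LinearMap.BilinForm ℤ M) (x y : M) : ℤ := B x x * B y y - B x y ^ 2

/-- The Gram determinant of three vectors (for a symmetric form). -/
def gram₃ (B : LinearMap.BilinForm ℤ M) (x b y : M) : ℤ :=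
  B (gram₂ B x b • y - (B x y * B b b - B b y * B x b) • x - (B b y * B x x - B x y * B x b) • b) y

lemma exists_not_dvd_gram₂ (hs : ∀ x y, B x y = B y x)
    (hdual : ∀ f : M →ₗ[ℤ] ℤ, ∃ y, ∀ z, B z y = N * f z) (h2 : 2 ∣ N)
    (hrank : 3 ≤ Module.finrank ℤ M) {p : ℕ} (hp : p.Prime) (hpN : ¬ p ∣ N) {x : M}
    (hx : ¬∃ y, x = (p : ℤ) • y) : ∃ y, ¬(p : ℤ) ∣ gram₂ B x y := by
  let S : LinearMap.BilinForm ℤ M := B x x • B - LinearMap.mk₂ ℤ (fun y z => B x y * B x z)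
    (by simp [add_mul]) (by simp [mul_assoc]) (by simp [mul_add]) (by simp [mul_left_comm])
  have hS : ∀ y z, S y z = B x x * B y z - B x y * B x z := fun y z => by simp [S]
  suffices h : ∃ y z, ¬(p : ℤ) ∣ S y z by
    obtain ⟨y, z, h⟩ := h
    obtain ⟨w, hw⟩ := exists_not_dvd_diag S (fun y z => by rw [hS, hS, hs y z]; ring) hp
      (fun h => hpN (h.trans h2)) h
    refine ⟨w, ?_⟩
    rw [hS] at hw
    rwa [gram₂, pow_two]
  by_contra! hc
  have key : ∀ y, ∃ z, B x x • y - B x y • x = (p : ℤ) • z := fun y => by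
    refine exists_eq_smul_of_forall_dvd_form hdual hp hpN fun z => ?_
    have := hc y z
    rw [hS] at this
    simpa using this
  by_cases hxx : (p : ℤ) ∣ B x x
  · apply hx
    refine exists_eq_smul_of_forall_dvd_form hdual hp hpN fun y => ?_
    by_contra hxy
    have hpI := Nat.prime_iff_prime_int.1 hp
    obtain ⟨r, s, hrs⟩ : IsCoprime (p : ℤ) (B x y) := hpI.coprime_iff_not_dvd.2 hxy
    obtain ⟨a, ha⟩ := hxx
    obtain ⟨z, hz⟩ := key y
    refine hx ⟨r • x + s • (a • y - z), ?_⟩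
    have e : B x y • x = (p : ℤ) • (a • y - z) := by
      rw [smul_sub, ← hz, smul_smul, ← ha]; abel
    calc x = (1 : ℤ) • x := (one_smul _ _).symm
      _ = (r * p) • x + s • (B x y • x) := by rw [← hrs]; module
      _ = _ := by rw [e]; module
  · have := finrank_le_of_forall_mem_span_mod hp (fun _ : Fin 1 => x) fun y => by
      obtain ⟨z, hz⟩ := key y
      exact ⟨B x x, fun _ => B x y, z, hxx, by simp [← hz]⟩
    omega

lemma exists_not_dvd_gram₃ (hs : ∀ x y, B x y = B y x)
    (hdual : ∀ f : M →ₗ[ℤ] ℤ, ∃ y, ∀ z, B z y = N * f z) (h2 : 2 ∣ N)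
    (hrank : 3 ≤ Module.finrank ℤ M) {p : ℕ} (hp : p.Prime) (hpN : ¬ p ∣ N) {x b : M}
    (hxb : ¬(p : ℤ) ∣ gram₂ B x b) : ∃ y, ¬(p : ℤ) ∣ gram₃ B x b y := by
  let P : M →ₗ[ℤ] M := gram₂ B x b • LinearMap.id -
    (B b b • B x - B x b • B b).smulRight x - (B x x • B b - B x b • B x).smulRight b
  have hP : ∀ y, P y = gram₂ B x b • y - (B x y * B b b - B b y * B x b) • x -
      (B b y * B x x - B x y * B x b) • b := fun y => by
    simp [P, mul_comm]
  let S : LinearMap.BilinForm ℤ M := B ∘ₗ P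
  have hS : ∀ y z, S y z = gram₂ B x b * B y z - (B x y * B b b - B b y * B x b) * B x z -
      (B b y * B x x - B x y * B x b) * B b z := fun y z => by
    change B (P y) z = _
    rw [hP]; simp
  suffices h : ∃ y z, ¬(p : ℤ) ∣ S y z by
    obtain ⟨y, z, h⟩ := h
    obtain ⟨w, hw⟩ := exists_not_dvd_diag S (fun y z => by rw [hS, hS, hs y z]; ring) hp
      (fun h => hpN (h.trans h2)) h
    refine ⟨w, ?_⟩
    rwa [gram₃, ← hP]
  by_contra! hc
  have := finrank_le_of_forall_mem_span_mod hp ![x, b] fun y => by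
    obtain ⟨z, hz⟩ := exists_eq_smul_of_forall_dvd_form hdual hp hpN (x := P y) (hc y)
    refine ⟨gram₂ B x b, ![B x y * B b b - B b y * B x b, B b y * B x x - B x y * B x b], z,
      hxb, ?_⟩
    rw [← hz, hP, Fin.sum_univ_two]
    simp only [Matrix.cons_val_zero, Matrix.cons_val_one]
    abel
  omega

end Lattice

section Lattice

variable {M : Type*} [AddCommGroup M]

lemma gram₂_add_smul (B : LinearMap.BilinForm ℤ M) (x y z : M) (k : ℤ) :
    gram₂ B x (y + k • z) = gram₂ B x y + k * (2 * (B x x * B y z - B x y * B x z) +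
      B x x * (B z y - B y z) + k * gram₂ B x z) := by
  simp only [gram₂, map_add, map_smul, LinearMap.add_apply, LinearMap.smul_apply, smul_eq_mul]
  ring

lemma dvd_gram₂_add_smul_iff (B : LinearMap.BilinForm ℤ M) (x y z : M) (k : ℤ) :
    k ∣ gram₂ B x (y + k • z) ↔ k ∣ gram₂ B x y := by
  rw [gram₂_add_smul, dvd_add_left (dvd_mul_right _ _)]

lemma dvd_gram₃_add_smul_iff {B : LinearMap.BilinForm ℤ M} (hs : ∀ x y, B x y = B y x)
    (x b y z : M) (k : ℤ) : k ∣ gram₃ B x b (y + k • z) ↔ k ∣ gram₃ B x b y := by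
  have : gram₃ B x b (y + k • z) = gram₃ B x b y + k * (
      2 * (gram₂ B x b * B y z - (B x y * B b b - B b y * B x b) * B x z -
        (B b y * B x x - B x y * B x b) * B b z) + k * gram₃ B x b z) := by
    simp only [gram₃, map_add, map_sub, map_smul, LinearMap.add_apply, LinearMap.sub_apply,
      LinearMap.smul_apply, smul_eq_mul, hs z y]
    ring
  rw [this, dvd_add_left (dvd_mul_right _ _)]

lemma exists_sign_of_gram₂_neg {B : LinearMap.BilinForm ℤ M} (hs : ∀ x y, B x y = B y x) {x b : M}
    (h : gram₂ B x b < 0) : (∃ r s : ℤ, 0 < B (r • x + s • b) (r • x + s • b)) ∧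
      ∃ r s : ℤ, B (r • x + s • b) (r • x + s • b) < 0 := by
  have e : ∀ r s : ℤ, B (r • x + s • b) (r • x + s • b) =
      r ^ 2 * B x x + 2 * (r * s) * B x b + s ^ 2 * B b b := fun r s => by
    simp only [map_add, map_smul, LinearMap.add_apply, LinearMap.smul_apply, smul_eq_mul, hs b x]
    ring
  simp only [e]
  rw [gram₂] at h
  rcases lt_trichotomy (B x x) 0 with h0 | h0 | h0
  · exact ⟨⟨-B x b, B x x, by nlinarith [mul_pos_of_neg_of_neg h0 h]⟩, 1, 0, by simpa using h0⟩
  · have hb : B x b ≠ 0 := fun hb => by rw [h0, hb] at h; simp at h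
    rw [h0]
    have hb2 : 0 < B x b ^ 2 := by positivity
    have hk : 0 ≤ (B x b ^ 2 - 1) * (|B b b| + 1) := mul_nonneg (by omega) (by positivity)
    have hk' := abs_nonneg (B b b)
    refine ⟨⟨B x b * (|B b b| + 1), 1, ?_⟩, -B x b * (|B b b| + 1), 1, ?_⟩
    · have := neg_abs_le (B b b)
      linarith
    · have := le_abs_self (B b b)
      linarith
  · exact ⟨⟨1, 0, by simpa using h0⟩, -B x b, B x x, by nlinarith [mul_neg_of_pos_of_neg h0 h]⟩

variable [Module.Free ℤ M] [Module.Finite ℤ M]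

lemma exists_primitive_add_smul (c : ℤ) {x : M} (hx0 : x ≠ 0) (hrank : 2 ≤ Module.finrank ℤ M) :
    ∃ u, ∀ p : ℕ, p.Prime → ((p : ℤ) ∣ c → ¬∃ y, x = (p : ℤ) • y) →
      ¬∃ y, x + c • u = (p : ℤ) • y := by
  classical
  let b := Module.finBasis ℤ M
  obtain ⟨i, hi⟩ : ∃ i, b.repr x i ≠ 0 := by
    by_contra! h
    exact hx0 (b.repr.map_eq_zero_iff.1 (Finsupp.ext h))
  have : Nontrivial (Fin (Module.finrank ℤ M)) := Fin.nontrivial_iff_two_le.2 hrank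
  obtain ⟨j, hj⟩ := exists_ne i
  obtain ⟨s, hs⟩ := exists_crt (b.repr x i).natAbs 1
    (fun p : ℕ => if ∃ y, x = (p : ℤ) • y then (1 : ℤ) else 0)
  refine ⟨s • b j, fun p hp hx => ?_⟩
  rintro ⟨y, hy⟩
  have hri := congrArg (fun z => b.repr z i) hy
  simp only [map_add, map_smul, Finsupp.add_apply, Finsupp.smul_apply, b.repr_self,
    Finsupp.single_eq_of_ne hj.symm, smul_eq_mul, mul_zero, add_zero] at hri
  obtain ⟨s', hs'⟩ := hs p hp (by rw [← Int.natCast_dvd, hri]; exact dvd_mul_right _ _)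
    (Int.natAbs_ne_zero.2 hi)
  rw [pow_one, smul_eq_mul] at hs'
  by_cases hpc : (p : ℤ) ∣ c
  · obtain ⟨c', rfl⟩ := hpc
    exact hx (dvd_mul_right _ _) ⟨y - c' • s • b j, by rw [smul_sub, ← hy]; module⟩
  · split_ifs at hs' with hd
    · obtain ⟨y', hy'⟩ := hd
      apply hpc
      have hrj := congrArg (fun z => b.repr z j) hy
      rw [hy'] at hrj
      simp only [map_add, map_smul, Finsupp.add_apply, Finsupp.smul_apply, b.repr_self,
        Finsupp.single_eq_same, smul_eq_mul, mul_one] at hrj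
      refine ⟨b.repr y j - b.repr y' j - c * s', ?_⟩
      have e : s = 1 + p * s' := by linarith
      rw [e] at hrj
      linear_combination hrj
    · apply hd
      refine ⟨y - (c * s') • b j, ?_⟩
      rw [smul_sub, ← hy, show s = p * s' by linarith]
      module

variable {B : LinearMap.BilinForm ℤ M} {N : ℕ}

lemma exists_gram₂_neg
    (hdual : ∀ f : M →ₗ[ℤ] ℤ, ∃ y, ∀ z, B z y = N * f z) (hN : N ≠ 0)
    (hpos : ∃ z, 0 < B z z) (hneg : ∃ z, B z z < 0) {x : M} (hx : x ≠ 0) :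
    ∃ y, gram₂ B x y < 0 := by
  rcases lt_trichotomy (B x x) 0 with h | h | h
  · obtain ⟨z, hz⟩ := hpos
    exact ⟨z, by rw [gram₂]; nlinarith [mul_neg_of_neg_of_pos h hz, sq_nonneg (B x z)]⟩
  · by_contra! hc
    have h0 : ∀ z, B x z = 0 := fun z => by
      have := hc z
      rw [gram₂, h] at this
      have : B x z ^ 2 ≤ 0 := by linarith
      exact pow_eq_zero_iff two_ne_zero |>.1 (le_antisymm this (sq_nonneg _))
    apply hx
    let b := Module.finBasis ℤ M
    refine b.repr.map_eq_zero_iff.1 (Finsupp.ext fun i => ?_)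
    obtain ⟨y, hy⟩ := hdual (b.coord i)
    have := hy x
    rw [h0, eq_comm, mul_eq_zero] at this
    exact this.resolve_left (by exact_mod_cast hN)
  · obtain ⟨z, hz⟩ := hneg
    exact ⟨z, by rw [gram₂]; nlinarith [mul_neg_of_pos_of_neg h hz, sq_nonneg (B x z)]⟩

lemma exists_second_vector (hs : ∀ x y, B x y = B y x)
    (hdual : ∀ f : M →ₗ[ℤ] ℤ, ∃ y, ∀ z, B z y = N * f z) (hN : N ≠ 0)
    (hpos : ∃ z, 0 < B z z) (hneg : ∃ z, B z z < 0) {m : ℤ} (hm : m ≠ 0) (hmN : IsCoprime m N)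
    {x : M} (hx0 : x ≠ 0) (hx : ∀ p : ℕ, p.Prime → (p : ℤ) ∣ m → ¬∃ y, x = (p : ℤ) • y)
    (hloc : ∀ p : ℕ, p.Prime → p ∣ N → ∃ b, ¬(p : ℤ) ∣ gram₂ B x b) :
    ∃ b, gram₂ B x b < 0 ∧ (∀ p : ℕ, p.Prime → p ∣ N → ¬(p : ℤ) ∣ gram₂ B x b) ∧
      ∀ p : ℕ, p.Prime → (p : ℤ) ∣ m → ¬(p : ℤ) ∣ B x b := by
  have hP0 : N * m.natAbs ≠ 0 := mul_ne_zero hN (Int.natAbs_ne_zero.2 hm)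
  have h1 : ∀ p : ℕ, ∃ b, p.Prime → (p ∣ N → ¬(p : ℤ) ∣ gram₂ B x b) ∧
      ((p : ℤ) ∣ m → ¬(p : ℤ) ∣ B x b) := by
    intro p
    by_cases hp : p.Prime
    · by_cases hpN : p ∣ N
      · obtain ⟨b, hb⟩ := hloc p hp hpN
        exact ⟨b, fun _ => ⟨fun _ => hb, fun h =>
          (not_dvd_of_isCoprime hmN hp (Int.natCast_dvd_natCast.2 hpN) h).elim⟩⟩
      · by_cases hpm : (p : ℤ) ∣ m
        · obtain ⟨b, hb⟩ : ∃ b, ¬(p : ℤ) ∣ B x b := by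
            by_contra! h
            exact hx p hp hpm (exists_eq_smul_of_forall_dvd_form hdual hp hpN h)
          exact ⟨b, fun _ => ⟨fun h => (hpN h).elim, fun _ => hb⟩⟩
        · exact ⟨0, fun _ => ⟨fun h => (hpN h).elim, fun h => (hpm h).elim⟩⟩
    · exact ⟨0, fun h => (hp h).elim⟩
  choose f hf using h1
  obtain ⟨b, hb⟩ := exists_crt (N * m.natAbs) 1 f
  obtain ⟨z, hz⟩ := exists_gram₂_neg hdual hN hpos hneg hx0
  obtain ⟨k, hk⟩ := exists_quadratic_pos (a := (N * m) ^ 2 * -gram₂ B x z)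
    (mul_pos (by positivity) (by linarith)) (-(N * m) * 2 * (B x x * B b z - B x b * B x z))
    (-gram₂ B x b)
  refine ⟨b + (k * (N * m)) • z, ?_, ?_, ?_⟩
  · rw [gram₂_add_smul, hs z b]
    linarith
  · intro p hp hpN
    obtain ⟨y, hy⟩ := hb p hp (hpN.mul_right _) hP0
    obtain ⟨N', rfl⟩ := hpN
    rw [pow_one, sub_eq_iff_eq_add'] at hy
    rw [hy, Nat.cast_mul, show f p + (p : ℤ) • y + (k * (p * N' * m)) • z =
      f p + (p : ℤ) • (y + (k * (N' * m)) • z) by module, dvd_gram₂_add_smul_iff]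
    exact (hf p hp).1 (dvd_mul_right _ _)
  · intro p hp hpm
    obtain ⟨y, hy⟩ := hb p hp ((Int.natCast_dvd.1 hpm).mul_left _) hP0
    obtain ⟨m', rfl⟩ := hpm
    rw [pow_one, sub_eq_iff_eq_add'] at hy
    rw [hy, show f p + (p : ℤ) • y + (k * (N * (p * m'))) • z =
      f p + (p : ℤ) • (y + (k * (N * m')) • z) by module, map_add, map_smul, smul_eq_mul,
      dvd_add_left (dvd_mul_right _ _)]
    exact (hf p hp).2 (dvd_mul_right _ _)

lemma exists_third_vector (hs : ∀ x y, B x y = B y x)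
    (hdual : ∀ f : M →ₗ[ℤ] ℤ, ∃ y, ∀ z, B z y = N * f z) (h2 : 2 ∣ N) (hN : N ≠ 0)
    (hrank : 3 ≤ Module.finrank ℤ M) {m : ℤ} (hm : m ≠ 0) (hmN : IsCoprime m N)
    {x b : M} (hx : ∀ p : ℕ, p.Prime → ¬∃ y, x = (p : ℤ) • y)
    (hb0 : gram₂ B x b ≠ 0) (hb : ∀ p : ℕ, p.Prime → (p : ℤ) ∣ m → ¬(p : ℤ) ∣ gram₂ B x b) :
    ∃ y, gram₃ B x b y ≠ 0 ∧
      (∀ p : ℕ, p.Prime → (p : ℤ) ∣ m → ¬(p : ℤ) ∣ gram₃ B x b y) ∧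
      ∀ p : ℕ, p.Prime → ¬p ∣ N → (p : ℤ) ∣ gram₂ B x b → ¬(p : ℤ) ∣ gram₂ B x y := by
  obtain ⟨l, hl, hlp⟩ := Nat.exists_infinite_primes (N + (gram₂ B x b).natAbs + 1)
  have hlN : ¬l ∣ N := fun h => by
    have := Nat.le_of_dvd (Nat.pos_of_ne_zero hN) h; omega
  have hlb : ¬(l : ℤ) ∣ gram₂ B x b := fun h => by
    have := Nat.le_of_dvd (Int.natAbs_pos.2 hb0) (Int.natCast_dvd.1 h); omega
  have h1 : ∀ p : ℕ, ∃ y, p.Prime → ¬p ∣ N → (¬(p : ℤ) ∣ gram₂ B x b → ¬(p : ℤ) ∣ gram₃ B x b y) ∧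
      ((p : ℤ) ∣ gram₂ B x b → ¬(p : ℤ) ∣ gram₂ B x y) := by
    intro p
    by_cases hp : p.Prime ∧ ¬p ∣ N
    · by_cases h : (p : ℤ) ∣ gram₂ B x b
      · obtain ⟨y, hy⟩ := exists_not_dvd_gram₂ hs hdual h2 hrank hp.1 hp.2 (hx p hp.1)
        exact ⟨y, fun _ _ => ⟨fun h' => (h' h).elim, fun _ => hy⟩⟩
      · obtain ⟨y, hy⟩ := exists_not_dvd_gram₃ hs hdual h2 hrank hp.1 hp.2 h
        exact ⟨y, fun _ _ => ⟨fun _ => hy, fun h' => (h h').elim⟩⟩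
    · exact ⟨0, fun h h' => (hp ⟨h, h'⟩).elim⟩
  choose f hf using h1
  obtain ⟨y, hy⟩ := exists_crt (l * m.natAbs * (gram₂ B x b).natAbs) 1 f
  replace hy : ∀ p : ℕ, p.Prime → p ∣ (l * m.natAbs * (gram₂ B x b).natAbs) →
      ∃ z, y = f p + (p : ℤ) • z := fun p hp h => by
    obtain ⟨z, hz⟩ := hy p hp h (mul_ne_zero (mul_ne_zero hlp.ne_zero (Int.natAbs_ne_zero.2 hm))
      (Int.natAbs_ne_zero.2 hb0))
    exact ⟨z, by rw [pow_one, sub_eq_iff_eq_add'] at hz; exact hz⟩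
  refine ⟨y, fun h => ?_, fun p hp hpm => ?_, fun p hp hpN hpb => ?_⟩
  · obtain ⟨z, hz⟩ := hy l hlp ((dvd_mul_right _ _).mul_right _)
    refine (hf l hlp hlN).1 hlb ?_
    rw [← dvd_gram₃_add_smul_iff hs _ _ _ z, ← hz, h]
    exact dvd_zero _
  · obtain ⟨z, hz⟩ := hy p hp (((Int.natCast_dvd.1 hpm).mul_left _).mul_right _)
    rw [hz, dvd_gram₃_add_smul_iff hs]
    refine (hf p hp fun h => ?_).1 (hb p hp hpm)
    exact not_dvd_of_isCoprime hmN hp (Int.natCast_dvd_natCast.2 h) hpm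
  · obtain ⟨z, hz⟩ := hy p hp ((Int.natCast_dvd.1 hpb).mul_left _)
    rw [hz, dvd_gram₂_add_smul_iff]
    exact (hf p hp hpN).2 hpb

end Lattice

section Lattice

variable {M : Type*} [AddCommGroup M]

lemma gram₂_comm {B : LinearMap.BilinForm ℤ M} (hs : ∀ x y, B x y = B y x) (x y : M) :
    gram₂ B x y = gram₂ B y x := by
  rw [gram₂, gram₂, hs y x, mul_comm]

lemma dvd_gram₂_iff_of_eq_add_smul {B : LinearMap.BilinForm ℤ M} (hs : ∀ x y, B x y = B y x)
    {x y z : M} {k : ℤ} (h : x = y + k • z) (b : M) : k ∣ gram₂ B x b ↔ k ∣ gram₂ B y b := by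
  rw [h, gram₂_comm hs, dvd_gram₂_add_smul_iff, gram₂_comm hs]

lemma exists_similitude_of_ternary {B : LinearMap.BilinForm ℤ M} (hs : ∀ x y, B x y = B y x)
    (he : ∀ x, Even (B x x)) {x b y : M} (hb0 : gram₂ B x b < 0) (hy0 : gram₃ B x b y ≠ 0)
    (hloc : ∀ p : ℕ, p.Prime → (p : ℤ) ∣ gram₃ B x b y → ¬(p : ℤ) ∣ gram₂ B x b ∨
      ¬(p : ℤ) ∣ gram₂ B x y)
    {m : ℤ} (hm : 0 < m) (hm3 : IsCoprime m (gram₃ B x b y)) (hx : 2 * m ^ 2 ∣ B x x) :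
    ∃ A : M →ₗ[ℤ] M, (∀ z w, B (A z) (A w) = m ^ 2 * B z w) ∧
      (∀ z, ∃ (s : ℤ) (v : M), A z = s • x + m • v) ∧ ∀ z, m ^ 2 ∣ B x (A z) := by
  obtain ⟨a₁, h₁⟩ := he x
  obtain ⟨a₂, h₂⟩ := he b
  obtain ⟨a₃, h₃⟩ := he y
  let t : TernaryForm ℤ := ⟨a₁, a₂, a₃, B b y, B x y, B x b⟩
  let K : (Fin 3 → ℤ) →ₗ[ℤ] M := (LinearMap.proj 0).smulRight x + (LinearMap.proj 1).smulRight b +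
    (LinearMap.proj 2).smulRight y
  have hK : ∀ c, K c = c 0 • x + c 1 • b + c 2 • y := fun c => rfl
  let ξ : M →ₗ[ℤ] (Fin 3 → ℤ) := LinearMap.pi ![B x, B b, B y]
  have hξ0 : ∀ z, ξ z 0 = B x z := fun z => rfl
  have hξ1 : ∀ z, ξ z 1 = B b z := fun z => rfl
  have hξ2 : ∀ z, ξ z 2 = B y z := fun z => rfl
  have hd : 2 * t.disc = gram₃ B x b y := by
    simp only [gram₃, gram₂, map_sub, map_smul, LinearMap.sub_apply, LinearMap.smul_apply,
      smul_eq_mul, h₁, h₂, h₃, TernaryForm.disc, t]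
    ring
  have hpol : ∀ c c', B (K c) (K c') = t.polar c c' := by
    intro c c'
    simp only [hK, map_add, map_smul, LinearMap.add_apply, LinearMap.smul_apply,
      smul_eq_mul, h₁, h₂, h₃, hs y x, hs y b, hs b x, TernaryForm.polar, TernaryForm.grad, t,
      Matrix.cons_val_zero, Matrix.cons_val_one, Matrix.cons_val]
    ring
  have hval : ∀ c, B (K c) (K c) = 2 * t.val c := by
    intro c
    rw [hpol, TernaryForm.polar_self]
  have hgram : ∀ c c', 4 * t.val c * t.val c' - t.polar c c' ^ 2 = gram₂ B (K c) (K c') := by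
    intro c c'
    rw [gram₂, hval, hval, hpol]
    ring
  have hKx : K ![1, 0, 0] = x := by simp [hK]
  have hKb : K ![0, 1, 0] = b := by simp [hK]
  have hKy : K ![0, 0, 1] = y := by simp [hK]
  obtain ⟨⟨r, s, hrs⟩, r', s', hrs'⟩ := exists_sign_of_gram₂_neg hs hb0
  have hKrs : ∀ r s : ℤ, K ![r, s, 0] = r • x + s • b := by simp [hK]
  rw [← hKrs, hval] at hrs hrs'
  obtain ⟨C, hC1, hC2, hC3⟩ := TernaryForm.exists_linearMap (t := t) (m := m) (x := ![1, 0, 0])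
    (fun h => hy0 (by rw [← hd, h, mul_zero])) ⟨![r, s, 0], by linarith⟩
    ⟨![r', s', 0], by linarith⟩
    (fun p hp hpd => by
      simp only [hgram]
      rw [hd] at hpd
      rcases hloc p hp hpd with h | h
      · exact ⟨![1, 0, 0], ![0, 1, 0], by rwa [hKx, hKb]⟩
      · exact ⟨![1, 0, 0], ![0, 0, 1], by rwa [hKx, hKy]⟩) hm (by rwa [hd])
    (by
      have := hval ![1, 0, 0]
      rw [hKx] at this
      rw [this] at hx
      exact (mul_dvd_mul_iff_left two_ne_zero).1 hx)
    (fun p hp _ => by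
      rintro ⟨z, hz⟩
      have := congrFun hz 0
      simp only [Matrix.cons_val_zero, Pi.smul_apply, smul_eq_mul] at this
      exact hp.one_lt.ne' (by exact_mod_cast Int.eq_one_of_dvd_one (by positivity) ⟨_, this⟩))
  obtain ⟨A, hA⟩ : ∃ A : M →ₗ[ℤ] M, ∀ z, A z = m • z + K (C (ξ z)) :=
    ⟨m • LinearMap.id + K ∘ₗ C ∘ₗ ξ, fun z => rfl⟩
  have hBK : ∀ c z, B (K c) z = c 0 * ξ z 0 + c 1 * ξ z 1 + c 2 * ξ z 2 := by
    intro c z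
    simp only [hK, hξ0, hξ1, hξ2, map_add, map_smul, LinearMap.add_apply, LinearMap.smul_apply,
      smul_eq_mul]
  have hself : ∀ z, B (A z) (A z) = m ^ 2 * B z z := by
    intro z
    rw [hA]
    have e1 := hC1 (ξ z)
    have e2 := hBK (C (ξ z)) z
    have e3 := hval (C (ξ z))
    simp only [map_add, map_smul, LinearMap.add_apply, LinearMap.smul_apply, smul_eq_mul,
      hs z (K _), e2, e3]
    linear_combination 2 * e1
  refine ⟨A, fun z w => ?_, fun z => ?_, fun z => ?_⟩
  · have e := hself (z + w)
    simp only [map_add, LinearMap.add_apply, hself, hs w z, hs (A w) (A z)] at e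
    linarith
  · obtain ⟨s, v, hv⟩ := hC2 (ξ z)
    exact ⟨s, z + K v, by rw [hA, hv, map_add, map_smul, map_smul, hKx]; module⟩
  · have := hC3 (ξ z)
    rw [← hpol, hKx] at this
    rw [hA, map_add, map_smul, smul_eq_mul]
    simpa [hξ0] using this

variable [Module.Free ℤ M] [Module.Finite ℤ M]

theorem exists_similitude {B : LinearMap.BilinForm ℤ M} (hs : ∀ x y, B x y = B y x)
    (he : ∀ x, Even (B x x)) {N : ℕ}
    (hdual : ∀ f : M →ₗ[ℤ] ℤ, ∃ y, ∀ z, B z y = N * f z) (h2 : 2 ∣ N) (hN : N ≠ 0)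
    (hrank : 3 ≤ Module.finrank ℤ M) (hpos : ∃ z, 0 < B z z) (hneg : ∃ z, B z z < 0)
    (hloc : ∀ p : ℕ, p.Prime → p ∣ N → ∃ a b, ¬(p : ℤ) ∣ gram₂ B a b)
    {m : ℤ} (hm : 0 < m) (hmN : IsCoprime m N) {x : M} (hx : 2 * m ^ 2 ∣ B x x)
    (hxm : ∀ p : ℕ, p.Prime → (p : ℤ) ∣ m → ¬∃ y, x = (p : ℤ) • y) :
    ∃ A : M →ₗ[ℤ] M, (∀ z w, B (A z) (A w) = m ^ 2 * B z w) ∧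
      (∀ z, ∃ (s : ℤ) (v : M), A z = s • x + m • v) ∧ ∀ z, m ^ 2 ∣ B x (A z) := by
  have hf : ∀ p : ℕ, ∃ a, p.Prime → p ∣ N → ∃ b, ¬(p : ℤ) ∣ gram₂ B a b := fun p => by
    by_cases h : p.Prime ∧ p ∣ N
    · obtain ⟨a, b, hab⟩ := hloc p h.1 h.2
      exact ⟨a, fun _ _ => ⟨b, hab⟩⟩
    · exact ⟨0, fun h1 h2 => (h ⟨h1, h2⟩).elim⟩
  choose f hf using hf
  obtain ⟨a, ha⟩ := exists_crt N 1 f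
  obtain ⟨x₁, u, v, hxu, hxv⟩ := exists_crt_pair (hmN.pow_left (m := 2)) x a
  have hx₁ : ∀ (w : M) (p : ℕ), p.Prime → p ∣ N →
      ∃ b, ¬(p : ℤ) ∣ gram₂ B (x₁ + (N : ℤ) • w) b := by
    intro w p hp hpN
    obtain ⟨b, hb⟩ := hf p hp hpN
    obtain ⟨z, hz⟩ := ha p hp hpN hN
    obtain ⟨N', hN'⟩ := hpN
    refine ⟨b, fun h => hb ?_⟩
    rw [pow_one, sub_eq_iff_eq_add'] at hz
    rwa [← dvd_gram₂_iff_of_eq_add_smul hs (z := z + (N' : ℤ) • (v + w))]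
    rw [hxv, hz, hN']
    push_cast
    module
  have hz0 : ∀ (k : ℤ) (y b : M), k ∣ gram₂ B (k • y) b := fun k y b => by
    rw [dvd_gram₂_iff_of_eq_add_smul hs (y := 0) (z := y) (by simp)]
    simp [gram₂]
  obtain ⟨w, hw⟩ := exists_primitive_add_smul (m ^ 2 * N) (x := x₁)
    (fun h => by
      obtain ⟨b, hb⟩ := hx₁ 0 2 Nat.prime_two h2
      rw [h] at hb
      exact hb (by simp [gram₂])) (by omega)
  replace hw : ∀ p : ℕ, p.Prime → ¬∃ y, x₁ + (m ^ 2 * N) • w = (p : ℤ) • y :=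
    fun p hp => hw p hp fun hpc => by
      rintro ⟨y, hy⟩
      rcases Int.Prime.dvd_mul' hp hpc with h | h
      · have h := Int.Prime.dvd_pow' hp h
        refine hxm p hp h ?_
        obtain ⟨m', rfl⟩ := h
        exact ⟨y - (m' * (p * m')) • u, by rw [smul_sub, ← hy, hxu]; module⟩
      · obtain ⟨b, hb⟩ := hx₁ 0 p hp (Int.natCast_dvd_natCast.1 h)
        rw [smul_zero, add_zero, hy] at hb
        exact hb (hz0 _ _ _)
  have hloc' : ∀ p : ℕ, p.Prime → p ∣ N → ∃ b, ¬(p : ℤ) ∣ gram₂ B (x₁ + (m ^ 2 * N) • w) b := by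
    intro p hp hpN
    have := hx₁ (m ^ 2 • w) p hp hpN
    rwa [smul_smul, mul_comm (N : ℤ)] at this
  generalize hx₂ : x₁ + (m ^ 2 * N) • w = x₂ at hw hloc'
  have hx₂' : x₂ = x + m ^ 2 • (u + (N : ℤ) • w) := by rw [← hx₂, hxu]; module
  generalize u + (N : ℤ) • w = e at hx₂'
  have hxx : 2 * m ^ 2 ∣ B x₂ x₂ := by
    obtain ⟨c, hc⟩ := hx
    obtain ⟨d, hd⟩ := he e
    refine ⟨c + B x e + m ^ 2 * d, ?_⟩
    simp only [hx₂', map_add, map_smul, LinearMap.add_apply, LinearMap.smul_apply, smul_eq_mul, hc,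
      hd, hs e x]
    ring
  have hx0 : x₂ ≠ 0 := fun h => hw 2 Nat.prime_two ⟨0, by rw [h, smul_zero]⟩
  obtain ⟨b, hb0, hbN, hbm⟩ := exists_second_vector hs hdual hN hpos hneg hm.ne' hmN hx0
    (fun p hp _ => hw p hp) hloc'
  obtain ⟨y, hy0, hym, hyb⟩ := exists_third_vector hs hdual h2 hN hrank hm.ne' hmN hw hb0.ne
    (fun p hp hpm h => by
      have h1 : (p : ℤ) ∣ B x₂ x₂ := ((hpm.trans (dvd_pow_self m two_ne_zero)).mul_left 2).trans hxx
      rw [gram₂, dvd_sub_right (h1.mul_right _)] at h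
      exact hbm p hp hpm (Int.Prime.dvd_pow' hp h))
  obtain ⟨A, hA1, hA2, hA3⟩ := exists_similitude_of_ternary hs he hb0 hy0
    (fun p hp _ => by
      by_cases h : (p : ℤ) ∣ gram₂ B x₂ b
      · exact Or.inr (hyb p hp (fun h' => hbN p hp h' h) h)
      · exact Or.inl h) hm
    (isCoprime_of_forall_prime fun p hp h h' => hym p hp h' h) hxx
  refine ⟨A, hA1, fun z => ?_, fun z => ?_⟩
  · obtain ⟨s, v, hv⟩ := hA2 z
    exact ⟨s, v + (s * m) • e, by rw [hv, hx₂']; module⟩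
  · have := hA3 z
    rw [hx₂', map_add, map_smul, LinearMap.add_apply, LinearMap.smul_apply, smul_eq_mul,
      dvd_add_left (dvd_mul_right _ _)] at this
    exact this

end Lattice

section Hyp

variable {M M' : Type*} [AddCommGroup M'] [AddCommGroup M]

/-- The quadratic form `B x x / 2` of an even bilinear form. -/
def halfNorm (B : LinearMap.BilinForm ℤ M) (x : M) : ℤ := B x x / 2

lemma two_mul_halfNorm {B : LinearMap.BilinForm ℤ M} (he : ∀ x, Even (B x x)) (x : M) :
    2 * halfNorm B x = B x x :=
  Int.mul_ediv_cancel' (he x).two_dvd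

lemma halfNorm_add_smul {B : LinearMap.BilinForm ℤ M} (hs : ∀ x y, B x y = B y x)
    (he : ∀ x, Even (B x x)) (x y : M) (k : ℤ) :
    halfNorm B (x + k • y) = halfNorm B x + k * B x y + k ^ 2 * halfNorm B y := by
  refine mul_left_cancel₀ (two_ne_zero (α := ℤ)) ?_
  have h1 := two_mul_halfNorm he x
  have h2 := two_mul_halfNorm he y
  rw [two_mul_halfNorm he]
  simp only [map_add, map_smul, LinearMap.add_apply, LinearMap.smul_apply, smul_eq_mul, hs y x]
  linear_combination -h1 - k ^ 2 * h2

/-- The orthogonal sum of a bilinear form with a hyperbolic plane. -/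
def addHyp (B : LinearMap.BilinForm ℤ M) : LinearMap.BilinForm ℤ (M × ℤ × ℤ) :=
  LinearMap.mk₂ ℤ (fun x y => B x.1 y.1 + x.2.1 * y.2.2 + x.2.2 * y.2.1)
    (fun x y z => by simp; ring) (fun c x y => by simp; ring)
    (fun x y z => by simp; ring) (fun c x y => by simp; ring)

@[simp] lemma addHyp_apply (B : LinearMap.BilinForm ℤ M) (x y : M × ℤ × ℤ) :
    addHyp B x y = B x.1 y.1 + x.2.1 * y.2.2 + x.2.2 * y.2.1 := rfl

/-- Isometry of integral bilinear forms. -/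
def IntIsom (B : LinearMap.BilinForm ℤ M) (C : LinearMap.BilinForm ℤ M') : Prop :=
  ∃ e : M ≃ₗ[ℤ] M', ∀ x y, C (e x) (e y) = B x y

/-- Some isometry between the sums of `B` and `C` with a hyperbolic plane takes `x` to the
first standard isotropic vector. -/
def MovesTo (B : LinearMap.BilinForm ℤ M) (C : LinearMap.BilinForm ℤ M') (x : M × ℤ × ℤ) : Prop :=
  ∃ e : (M × ℤ × ℤ) ≃ₗ[ℤ] M' × ℤ × ℤ, (∀ x y, addHyp C (e x) (e y) = addHyp B x y) ∧
    e x = (0, 1, 0)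

variable {B : LinearMap.BilinForm ℤ M} {C : LinearMap.BilinForm ℤ M'}

lemma MovesTo.of_isom {x y : M × ℤ × ℤ} (h : MovesTo B C x) (f : (M × ℤ × ℤ) ≃ₗ[ℤ] M × ℤ × ℤ)
    (hf : ∀ x y, addHyp B (f x) (f y) = addHyp B x y) (hx : f y = x) : MovesTo B C y := by
  obtain ⟨e, he, hex⟩ := h
  exact ⟨f.trans e, fun z w => by simp [he, hf, -addHyp_apply], by simp [hx, hex]⟩

lemma MovesTo.swap {x : M} {r s : ℤ} (h : MovesTo B C (x, r, s)) : MovesTo B C (x, s, r) :=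
  h.of_isom ((LinearEquiv.refl ℤ M).prodCongr (LinearEquiv.prodComm ℤ ℤ ℤ))
    (fun x y => by simp; ring) rfl

lemma MovesTo.transvect (hs : ∀ x y, B x y = B y x) (he : ∀ x, Even (B x x)) {x : M} {r s : ℤ}
    (h : MovesTo B C (x, r, s)) (w : M) :
    MovesTo B C (x + r • w, r, s - B x w - r * halfNorm B w) := by
  have hw := two_mul_halfNorm he w
  have hn : halfNorm B (-w) = halfNorm B w := by simp [halfNorm]
  let f : M → (M × ℤ × ℤ) →ₗ[ℤ] M × ℤ × ℤ := fun w =>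
    { toFun := fun z => (z.1 + z.2.1 • w, z.2.1, z.2.2 - B z.1 w - z.2.1 * halfNorm B w)
      map_add' := fun z z' => by
        ext <;> simp only [Prod.fst_add, Prod.snd_add, map_add, LinearMap.add_apply]
        · module
        · ring
      map_smul' := fun k z => by
        ext <;> simp only [Prod.smul_fst, Prod.smul_snd, map_smul, LinearMap.smul_apply,
          RingHom.id_apply, smul_eq_mul]
        · module
        · ring }
  have hf : ∀ w z, f w z = (z.1 + z.2.1 • w, z.2.1, z.2.2 - B z.1 w - z.2.1 * halfNorm B w) :=
    fun w z => rfl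
  have hinv : ∀ w, halfNorm B (-w) = halfNorm B w → 2 * halfNorm B w = B w w →
      ∀ z, f (-w) (f w z) = z := by
    intro w hn hw z
    ext <;> simp only [hf, hn, map_add, map_neg, map_smul, LinearMap.add_apply,
      LinearMap.smul_apply, smul_eq_mul]
    · module
    · linear_combination -z.2.1 * hw
  refine h.of_isom (LinearEquiv.ofLinearMap (f (-w)) (f w) (LinearMap.ext (hinv w hn hw))
    (LinearMap.ext fun z => ?_)) ?_ ?_
  · have := hinv (-w) (by rw [neg_neg, hn]) (by simp [hn, hw]) z
    rwa [neg_neg] at this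
  · intro y z
    simp only [LinearEquiv.coe_ofLinearMap, addHyp_apply, hf, hn, map_add,
      map_neg, map_smul, LinearMap.add_apply, LinearMap.smul_apply, LinearMap.neg_apply,
      smul_eq_mul, hs w z.1]
    linear_combination -(y.2.1 * z.2.1) * hw
  · exact hinv w hn hw (x, r, s)

/-- Even forms with the local and global properties needed for the cancellation of hyperbolic
planes. -/
structure IsAdmissible (B : LinearMap.BilinForm ℤ M) (N : ℕ) : Prop where
  symm : ∀ x y, B x y = B y x
  even : ∀ x, Even (B x x)
  ne_zero : N ≠ 0
  two_dvd : 2 ∣ N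
  dual : ∀ f : M →ₗ[ℤ] ℤ, ∃ y, ∀ z, B z y = N * f z
  rank : 3 ≤ Module.finrank ℤ M
  pos : ∃ z, 0 < B z z
  neg : ∃ z, B z z < 0
  loc : ∀ p : ℕ, p.Prime → p ∣ N → ∃ a b, ¬(p : ℤ) ∣ gram₂ B a b

variable [Module.Free ℤ M] [Module.Finite ℤ M] {N : ℕ}

lemma IsAdmissible.exists_not_dvd (h : IsAdmissible B N) {p : ℕ} (hp : p.Prime) :
    ∃ z w, ¬(p : ℤ) ∣ B z w := by
  by_contra! hc
  by_cases hpN : p ∣ N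
  · obtain ⟨a, b, hab⟩ := h.loc p hp hpN
    exact hab (dvd_sub ((hc a a).mul_right _) (dvd_pow (hc a b) two_ne_zero))
  · have h3 := h.rank
    let b := Module.finBasis ℤ M
    obtain ⟨y, hy⟩ := exists_eq_smul_of_forall_dvd_form h.dual hp hpN (hc (b ⟨0, by omega⟩))
    have := congrArg (fun z => b.repr z ⟨0, by omega⟩) hy
    simp only [b.repr_self, Finsupp.single_eq_same, map_smul, Finsupp.smul_apply,
      smul_eq_mul] at this
    exact hp.one_lt.ne' (by exact_mod_cast Int.eq_one_of_dvd_one (by positivity) ⟨_, this⟩)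

lemma IsAdmissible.exists_not_dvd_transvect (h : IsAdmissible B N) {p : ℕ} (hp : p.Prime)
    {x : M} {r s : ℤ} (hx : (p : ℤ) ∣ r → (p : ℤ) ∣ s → ∃ z, ¬(p : ℤ) ∣ B x z) :
    ∃ w, ¬(p : ℤ) ∣ s - B x w - r * halfNorm B w := by
  by_contra! hc
  have h0 : (p : ℤ) ∣ s := by simpa [halfNorm] using hc 0
  have h1 : ∀ w, (p : ℤ) ∣ B x w + r * halfNorm B w := fun w => by
    have := hc w
    rwa [sub_sub, dvd_sub_right h0] at this
  have h2 : ∀ w z, (p : ℤ) ∣ r * B w z := fun w z => by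
    have := h1 (w + (1 : ℤ) • z)
    rw [halfNorm_add_smul h.symm h.even, one_smul, map_add] at this
    have e : r * B w z = B x w + B x z + r * (halfNorm B w + 1 * B w z + 1 ^ 2 * halfNorm B z) -
      (B x w + r * halfNorm B w) - (B x z + r * halfNorm B z) := by ring
    rw [e]
    exact dvd_sub (dvd_sub this (h1 w)) (h1 z)
  have h3 : (p : ℤ) ∣ r := by
    obtain ⟨z, w, hzw⟩ := h.exists_not_dvd hp
    exact (Int.Prime.dvd_mul' hp (h2 z w)).resolve_right hzw
  obtain ⟨z, hz⟩ := hx h3 h0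
  exact hz ((dvd_add_left (h3.mul_right _)).1 (h1 z))

lemma IsAdmissible.exists_coprime_transvect (h : IsAdmissible B N) {K : ℕ} (hK : K ≠ 0)
    {x : M} {r s : ℤ}
    (hx : ∀ p : ℕ, p.Prime → (p : ℤ) ∣ r → (p : ℤ) ∣ s → ∃ z, ¬(p : ℤ) ∣ B x z) :
    ∃ w, ∀ u, IsCoprime (s - B x (w + (K : ℤ) • u) - r * halfNorm B (w + (K : ℤ) • u)) K := by
  have hf : ∀ p : ℕ, ∃ w, p.Prime → ¬(p : ℤ) ∣ s - B x w - r * halfNorm B w := fun p => by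
    by_cases hp : p.Prime
    · obtain ⟨w, hw⟩ := h.exists_not_dvd_transvect hp (hx p hp)
      exact ⟨w, fun _ => hw⟩
    · exact ⟨0, fun h => (hp h).elim⟩
  choose f hf using hf
  obtain ⟨w, hw⟩ := exists_crt K 1 f
  refine ⟨w, fun u => isCoprime_of_forall_prime fun p hp hpK hd => hf p hp ?_⟩
  obtain ⟨y, hy⟩ := hw p hp (Int.natCast_dvd_natCast.1 hpK) hK
  obtain ⟨K', hK'⟩ := hpK
  rw [pow_one, sub_eq_iff_eq_add'] at hy
  have e : f p = w + (K : ℤ) • u + (p : ℤ) • (-y - K' • u) := by rw [hK', hy]; module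
  rw [e, halfNorm_add_smul h.symm h.even]
  generalize w + (K : ℤ) • u = w' at hd
  generalize -y - K' • u = y' at *
  obtain ⟨d, hd⟩ := hd
  refine ⟨d - B x y' - r * (B w' y' + p * halfNorm B y'), ?_⟩
  rw [map_add, map_smul, smul_eq_mul]
  linear_combination hd

end Hyp

section Cancel

variable {M M' : Type*} [AddCommGroup M] [AddCommGroup M']
  {B : LinearMap.BilinForm ℤ M} {C : LinearMap.BilinForm ℤ M'}

lemma MovesTo.exists_not_dvd {x : M} {r s : ℤ} (h : MovesTo B C (x, r, s)) {p : ℕ} (hp : p.Prime)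
    (hr : (p : ℤ) ∣ r) (hs : (p : ℤ) ∣ s) : ∃ z, ¬(p : ℤ) ∣ B x z := by
  obtain ⟨e, he, hx⟩ := h
  refine ⟨(e.symm (0, 0, 1)).1, fun hd => ?_⟩
  have := he (x, r, s) (e.symm (0, 0, 1))
  rw [hx, LinearEquiv.apply_symm_apply, addHyp_apply, addHyp_apply] at this
  have h1 : (p : ℤ) ∣ 1 := by
    have e : (1 : ℤ) = B x (e.symm (0, 0, 1)).1 + r * (e.symm (0, 0, 1)).2.2 +
      s * (e.symm (0, 0, 1)).2.1 := by simpa using this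
    rw [e]
    exact dvd_add (dvd_add hd (hr.mul_right _)) (hs.mul_right _)
  exact hp.one_lt.ne' (by exact_mod_cast Int.eq_one_of_dvd_one (by positivity) h1)

lemma MovesTo.norm_eq {x : M} {r s : ℤ} (h : MovesTo B C (x, r, s)) : B x x = -2 * (r * s) := by
  obtain ⟨e, he, hx⟩ := h
  have := he (x, r, s) (x, r, s)
  rw [hx] at this
  simp only [addHyp_apply, map_zero] at this
  linarith

variable [Module.Free ℤ M] [Module.Finite ℤ M] [Module.Free ℤ M'] {N : ℕ}

lemma IsAdmissible.exists_embedding_of_dvd (h : IsAdmissible B N) {x : M} {m β : ℤ}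
    (hM : MovesTo B C (x, m, β)) (hm : m ≠ 0) (hmN : IsCoprime m N) (hβ : m ∣ β)
    (hx : ∀ p : ℕ, p.Prime → (p : ℤ) ∣ m → ¬∃ y, x = (p : ℤ) • y) :
    ∃ ψ : M →ₗ[ℤ] M', ∀ z w, C (ψ z) (ψ w) = B z w := by
  have hxx : 2 * |m| ^ 2 ∣ B x x := by
    obtain ⟨c, rfl⟩ := hβ
    exact ⟨-c, by rw [hM.norm_eq, sq_abs]; ring⟩
  have habs : ∀ p : ℕ, (p : ℤ) ∣ |m| ↔ (p : ℤ) ∣ m := fun p => dvd_abs _ _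
  obtain ⟨A, hA1, hA2, hA3⟩ := exists_similitude h.symm h.even h.dual h.two_dvd h.ne_zero h.rank
    h.pos h.neg h.loc (abs_pos.2 hm)
    (isCoprime_of_forall_prime fun p hp hpN hpm =>
      not_dvd_of_isCoprime hmN hp hpN ((habs p).1 hpm)) hxx
    fun p hp hpm => hx p hp ((habs p).1 hpm)
  simp only [sq_abs] at hA1 hA3
  obtain ⟨e, he, hex⟩ := hM
  have key : ∀ z, ∃ y : M', ∃ k, e (A z, 0, -(B x (A z) / m)) = (m • y, k, 0) := by
    intro z
    obtain ⟨c, hc⟩ := hA3 z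
    obtain ⟨s, v, hv⟩ := hA2 z
    obtain ⟨v', hv'⟩ : ∃ v', A z = s • x + m • v' := by
      rcases abs_choice m with h | h
      · exact ⟨v, by rw [hv, h]⟩
      · exact ⟨-v, by rw [hv, h]; module⟩
    obtain ⟨b, rfl⟩ := hβ
    have hdiv : B x (A z) / m = m * c := by
      rw [hc, show m ^ 2 * c = m * (m * c) by ring, Int.mul_ediv_cancel_left _ hm]
    have h1 : ((A z, 0, -(B x (A z) / m)) : M × ℤ × ℤ) =
        s • (x, m, m * b) + m • (v', -s, -c - s * b) := by
      rw [hdiv, hv']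
      ext <;> simp
      · ring
      · ring
    have h2 := he (x, m, m * b) (A z, 0, -(B x (A z) / m))
    rw [hex] at h2
    have h3 : (e (A z, 0, -(B x (A z) / m))).2.2 = 0 := by
      rw [hdiv] at h2 ⊢
      simp only [addHyp_apply, map_zero, LinearMap.zero_apply] at h2
      linear_combination h2 + hc
    refine ⟨(e (v', -s, -c - s * b)).1, (e (A z, 0, -(B x (A z) / m))).2.1, ?_⟩
    refine Prod.ext ?_ (Prod.ext rfl h3)
    rw [h1, map_add, map_smul, map_smul, hex]
    simp
  choose ψ k hψ using key
  have hinj := smul_right_injective M' hm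
  have hdiv : ∀ z w, B x (A (z + w)) / m = B x (A z) / m + B x (A w) / m := fun z w => by
    rw [map_add, map_add, Int.add_ediv_of_dvd_right
      (((dvd_pow_self m two_ne_zero).trans (hA3 w)))]
  have hdiv' : ∀ (r : ℤ) z, B x (A (r • z)) / m = r * (B x (A z) / m) := fun r z => by
    rw [map_smul, map_smul, smul_eq_mul, Int.mul_ediv_assoc _
      (((dvd_pow_self m two_ne_zero).trans (hA3 z)))]
  refine ⟨⟨⟨ψ, fun z w => hinj ?_⟩, fun r z => hinj ?_⟩, fun z w => ?_⟩
  · have : ((A (z + w), 0, -(B x (A (z + w)) / m)) : M × ℤ × ℤ) =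
        (A z, 0, -(B x (A z) / m)) + (A w, 0, -(B x (A w) / m)) := by
      rw [hdiv]
      ext <;> simp
      ring
    have h1 := congrArg Prod.fst (congrArg e this)
    rw [hψ (z + w), map_add, hψ, hψ] at h1
    simpa using h1
  · have : ((A (r • z), 0, -(B x (A (r • z)) / m)) : M × ℤ × ℤ) =
        r • (A z, 0, -(B x (A z) / m)) := by
      rw [hdiv']
      ext <;> simp
    have h1 := congrArg Prod.fst (congrArg e this)
    rw [hψ (r • z), map_smul, hψ] at h1
    simp only [Prod.smul_fst] at h1
    simp only [RingHom.id_apply]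
    rw [h1, smul_comm]
  · have := he (A z, 0, -(B x (A z) / m)) (A w, 0, -(B x (A w) / m))
    rw [hψ, hψ] at this
    simp only [addHyp_apply, map_smul, LinearMap.smul_apply, smul_eq_mul, hA1] at this
    refine mul_left_cancel₀ (pow_ne_zero 2 hm) ?_
    change m ^ 2 * C (ψ z) (ψ w) = _
    linear_combination this

lemma IsAdmissible.exists_embedding (h : IsAdmissible B N) {x : M} {r s : ℤ}
    (hM : MovesTo B C (x, r, s)) : ∃ ψ : M →ₗ[ℤ] M', ∀ z w, C (ψ z) (ψ w) = B z w := by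
  have h3 := h.rank
  obtain ⟨w, hw⟩ := h.exists_coprime_transvect h.ne_zero (x := x) (r := r) (s := s)
    fun p hp => hM.exists_not_dvd hp
  replace hw := hw 0
  replace hM := (hM.transvect h.symm h.even (w + (N : ℤ) • 0)).swap
  generalize x + r • (w + (N : ℤ) • 0) = x at hM
  generalize s - B _ _ - _ = r' at hM hw
  clear s w
  rename' r => s, r' => r
  have hN2 : ∀ {a : ℤ}, IsCoprime a N → a ≠ 0 := by
    rintro a ha rfl
    exact not_dvd_of_isCoprime ha Nat.prime_two (Int.natCast_dvd_natCast.2 h.two_dvd)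
      (dvd_zero _)
  have hr0 := hN2 hw
  have hK0 : N * r.natAbs ≠ 0 := mul_ne_zero h.ne_zero (Int.natAbs_ne_zero.2 hr0)
  obtain ⟨w, hw'⟩ := h.exists_coprime_transvect hK0 (x := x) (r := r) (s := s)
    fun p hp => hM.exists_not_dvd hp
  have hne : x + r • w ≠ 0 := fun h0 => by
    have hM' := hM.transvect h.symm h.even (w + ((N * r.natAbs : ℕ) : ℤ) • 0)
    have h1 := hM'.norm_eq
    have h2 := hw' 0
    rw [smul_zero, add_zero] at h1 h2
    rw [h0, map_zero, eq_comm] at h1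
    have h4 : s - B x w - r * halfNorm B w ≠ 0 := by
      push_cast at h2
      exact hN2 h2.of_mul_right_left
    exact mul_ne_zero (by norm_num) (mul_ne_zero hr0 h4) h1
  obtain ⟨u, hu⟩ := exists_primitive_add_smul (r * (N * r.natAbs : ℕ)) hne (by omega)
  replace hM := (hM.transvect h.symm h.even (w + ((N * r.natAbs : ℕ) : ℤ) • u)).swap
  replace hw' := hw' u
  have hxe : x + r • (w + ((N * r.natAbs : ℕ) : ℤ) • u) =
    x + r • w + (r * (N * r.natAbs : ℕ)) • u := by module
  rw [hxe] at hM
  generalize s - B _ _ - _ = m at hM hw'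
  generalize hx' : x + r • w + (r * (N * r.natAbs : ℕ)) • u = x' at hM hu
  have hprim : ∀ p : ℕ, p.Prime → (p : ℤ) ∣ m → ¬∃ y, x' = (p : ℤ) • y := fun p hp hpm =>
    hu p hp fun hpc => by
      have h1 : (p : ℤ) ∣ ((N * r.natAbs : ℕ) : ℤ) := by
        rcases Int.Prime.dvd_mul' hp hpc with h1 | h1
        · exact Int.natCast_dvd_natCast.2 ((Int.natCast_dvd.1 h1).mul_left _)
        · exact h1
      exact (not_dvd_of_isCoprime hw' hp h1 hpm).elim
  have hmN : IsCoprime m N := by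
    push_cast at hw'
    exact hw'.of_mul_right_left
  obtain ⟨v, hv⟩ : ∃ v, m ∣ r - B x' v := by
    obtain ⟨c, hc⟩ := (IsPrincipalIdealRing.principal (LinearMap.range (B x'))).principal
    have hmem : ∀ z, c ∣ B x' z := fun z => by
      have : B x' z ∈ LinearMap.range (B x') := ⟨z, rfl⟩
      rw [hc, Submodule.mem_span_singleton] at this
      obtain ⟨a, ha⟩ := this
      exact ⟨a, by rw [← ha, smul_eq_mul, mul_comm]⟩
    obtain ⟨z, hz⟩ : c ∈ LinearMap.range (B x') := by
      rw [hc]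
      exact Submodule.mem_span_singleton_self c
    obtain ⟨a, b, hab⟩ : IsCoprime c m := isCoprime_of_forall_prime fun p hp hpm hpc =>
      hprim p hp hpm (exists_eq_smul_of_forall_dvd_form h.dual hp
        (fun hpN => not_dvd_of_isCoprime hmN hp (Int.natCast_dvd_natCast.2 hpN) hpm)
        fun z => hpc.trans (hmem z))
    refine ⟨(r * a) • z, r * b, ?_⟩
    rw [map_smul, hz, smul_eq_mul]
    linear_combination -r * hab
  refine h.exists_embedding_of_dvd (hM.transvect h.symm h.even v) (hN2 hmN) hmN
    (dvd_sub hv (dvd_mul_right _ _)) fun p hp hpm => ?_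
  rintro ⟨y, hy⟩
  refine hprim p hp hpm ?_
  obtain ⟨m', rfl⟩ := hpm
  exact ⟨y - m' • v, by rw [smul_sub, ← hy]; module⟩

end Cancel

section

variable {M M' : Type*} [AddCommGroup M] [AddCommGroup M']
  {B : LinearMap.BilinForm ℤ M} {C : LinearMap.BilinForm ℤ M'}

lemma IntIsom.symm (h : IntIsom B C) : IntIsom C B := by
  obtain ⟨e, he⟩ := h
  exact ⟨e.symm, fun x y => by simp [← he]⟩

lemma IntIsom.trans {M'' : Type*} [AddCommGroup M''] {D : LinearMap.BilinForm ℤ M''}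
    (h : IntIsom B C) (h' : IntIsom C D) : IntIsom B D := by
  obtain ⟨e, he⟩ := h
  obtain ⟨e', he'⟩ := h'
  exact ⟨e.trans e', fun x y => by simp [he, he']⟩

lemma nondegenerate_of_separatingLeft (hs : ∀ x y, B x y = B y x)
    (h : ∀ x, (∀ y, B x y = 0) → x = 0) : B.Nondegenerate :=
  ⟨h, fun y hy => h y fun x => (hs y x).trans (hy x)⟩

variable [Module.Free ℤ M] [Module.Finite ℤ M]

lemma bijective_of_isometric (hB : B.Nondegenerate) {f : M →ₗ[ℤ] M}
    (hf : ∀ x y, B (f x) (f y) = B x y) : Function.Bijective f := by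
  let b := Module.finBasis ℤ M
  have h1 : (LinearMap.toMatrix b b f).transpose * LinearMap.BilinForm.toMatrix b B *
      LinearMap.toMatrix b b f = LinearMap.BilinForm.toMatrix b B := by
    rw [← LinearMap.BilinForm.toMatrix_comp]
    congr 1
    ext x y
    simp [hf]
  have h2 := (LinearMap.BilinForm.nondegenerate_iff_det_ne_zero b).1 hB
  have h3 := congrArg Matrix.det h1
  rw [Matrix.det_mul, Matrix.det_mul, Matrix.det_transpose] at h3
  have h4 : IsUnit (LinearMap.toMatrix b b f).det := by
    refine IsUnit.of_mul_eq_one (LinearMap.toMatrix b b f).det (mul_right_cancel₀ h2 ?_)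
    linear_combination h3
  rw [LinearMap.det_toMatrix, ← LinearMap.isUnit_iff_isUnit_det] at h4
  exact (Module.End.isUnit_iff f).1 h4

lemma IntIsom.of_embeddings [Module.Free ℤ M'] [Module.Finite ℤ M']
    (hB : B.Nondegenerate) (hC : C.Nondegenerate)
    (h : ∃ f : M →ₗ[ℤ] M', ∀ x y, C (f x) (f y) = B x y)
    (h' : ∃ f : M' →ₗ[ℤ] M, ∀ x y, B (f x) (f y) = C x y) : IntIsom B C := by
  obtain ⟨f, hf⟩ := h
  obtain ⟨g, hg⟩ := h'
  have h1 := bijective_of_isometric (f := g ∘ₗ f) hB fun x y => by simp [hf, hg]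
  have h2 := bijective_of_isometric (f := f ∘ₗ g) hC fun x y => by simp [hf, hg]
  exact ⟨LinearEquiv.ofBijective f ⟨Function.Injective.of_comp h1.1,
    Function.Surjective.of_comp h2.2⟩, hf⟩

lemma IsAdmissible.nondegenerate {N : ℕ} (h : IsAdmissible B N) : B.Nondegenerate := by
  refine nondegenerate_of_separatingLeft h.symm fun x hx => ?_
  let b := Module.finBasis ℤ M
  refine b.repr.map_eq_zero_iff.1 (Finsupp.ext fun i => ?_)
  obtain ⟨y, hy⟩ := h.dual (b.coord i)
  have := hy x
  rw [hx, eq_comm, mul_eq_zero] at this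
  exact this.resolve_left (by exact_mod_cast h.ne_zero)

/-- Admissible forms can be cancelled against hyperbolic planes. -/
theorem IsAdmissible.cancel [Module.Free ℤ M'] [Module.Finite ℤ M'] {N N' : ℕ}
    (hB : IsAdmissible B N) (hC : IsAdmissible C N') (h : IntIsom (addHyp B) (addHyp C)) :
    IntIsom B C := by
  obtain ⟨e, he⟩ := h
  refine IntIsom.of_embeddings hB.nondegenerate hC.nondegenerate ?_ ?_
  · exact hB.exists_embedding (x := (e.symm (0, 1, 0)).1) (r := (e.symm (0, 1, 0)).2.1)
      (s := (e.symm (0, 1, 0)).2.2) ⟨e, he, e.apply_symm_apply _⟩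
  · exact hC.exists_embedding (x := (e (0, 1, 0)).1) (r := (e (0, 1, 0)).2.1)
      (s := (e (0, 1, 0)).2.2) ⟨e.symm, fun x y => by
        rw [← he, e.apply_symm_apply, e.apply_symm_apply], e.symm_apply_apply _⟩

end

section

variable {M M' : Type*} [AddCommGroup M'] [AddCommGroup M]

/-- The orthogonal sum of a bilinear form with `k` hyperbolic planes. -/
def addHyps (B : LinearMap.BilinForm ℤ M) (k : ℕ) :
    LinearMap.BilinForm ℤ (M × (Fin k → ℤ) × (Fin k → ℤ)) :=
  LinearMap.mk₂ ℤ (fun x y => B x.1 y.1 + x.2.1 ⬝ᵥ y.2.2 + x.2.2 ⬝ᵥ y.2.1)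
    (fun x y z => by simp [add_dotProduct]; ring) (fun c x y => by
      simp only [Prod.smul_fst, Prod.smul_snd, map_smul, LinearMap.smul_apply, smul_dotProduct,
        smul_eq_mul]
      ring)
    (fun x y z => by simp [dotProduct_add]; ring) (fun c x y => by
      simp only [Prod.smul_fst, Prod.smul_snd, map_smul, dotProduct_smul, smul_eq_mul]
      ring)

lemma addHyps_apply (B : LinearMap.BilinForm ℤ M) {k : ℕ} (x y : M × (Fin k → ℤ) × (Fin k → ℤ)) :
    addHyps B k x y = B x.1 y.1 + x.2.1 ⬝ᵥ y.2.2 + x.2.2 ⬝ᵥ y.2.1 := rfl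

lemma intIsom_addHyp_addHyps (B : LinearMap.BilinForm ℤ M) (k : ℕ) :
    IntIsom (addHyp (addHyps B k)) (addHyps B (k + 1)) := by
  refine ⟨⟨⟨⟨fun x => (x.1.1, Fin.cons x.2.1 x.1.2.1, Fin.cons x.2.2 x.1.2.2), fun x y => ?_⟩,
    fun c x => ?_⟩, fun x => ((x.1, Fin.tail x.2.1, Fin.tail x.2.2), x.2.1 0, x.2.2 0),
    fun x => ?_, fun x => ?_⟩, fun x y => ?_⟩
  · refine Prod.ext rfl (Prod.ext ?_ ?_) <;> ext i <;> refine Fin.cases ?_ (fun i => ?_) i <;> simp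
  · refine Prod.ext rfl (Prod.ext ?_ ?_) <;> ext i <;> refine Fin.cases ?_ (fun i => ?_) i <;> simp
  · simp
  · simp
  · change addHyps B (k + 1) (x.1.1, Fin.cons x.2.1 x.1.2.1, Fin.cons x.2.2 x.1.2.2)
      (y.1.1, Fin.cons y.2.1 y.1.2.1, Fin.cons y.2.2 y.1.2.2) = _
    simp only [addHyps_apply, addHyp_apply, dotProduct, Fin.sum_univ_succ, Fin.cons_zero,
      Fin.cons_succ]
    ring

lemma intIsom_addHyps_zero (B : LinearMap.BilinForm ℤ M) : IntIsom (addHyps B 0) B :=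
  ⟨⟨⟨⟨fun x => x.1, fun _ _ => rfl⟩, fun _ _ => rfl⟩, fun x => (x, 0, 0),
    fun x => Prod.ext rfl (Subsingleton.elim _ _), fun _ => rfl⟩, fun x y => by
    simp [addHyps_apply]⟩

/-- Nondegenerate indefinite even forms. -/
structure IsIndefinite (B : LinearMap.BilinForm ℤ M) (N : ℕ) : Prop where
  symm : ∀ x y, B x y = B y x
  even : ∀ x, Even (B x x)
  ne_zero : N ≠ 0
  two_dvd : 2 ∣ N
  dual : ∀ f : M →ₗ[ℤ] ℤ, ∃ y, ∀ z, B z y = N * f z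
  pos : ∃ z, 0 < B z z
  neg : ∃ z, B z z < 0

variable {B : LinearMap.BilinForm ℤ M} {C : LinearMap.BilinForm ℤ M'} {N N' k : ℕ}
  [Module.Free ℤ M] [Module.Finite ℤ M]

lemma IsIndefinite.isAdmissible_addHyps (h : IsIndefinite B N)
    (hrank : 3 ≤ Module.finrank ℤ M + 2 * k)
    (hloc : k = 0 → ∀ p : ℕ, p.Prime → p ∣ N → ∃ a b, ¬(p : ℤ) ∣ gram₂ B a b) :
    IsAdmissible (addHyps B k) N where
  symm x y := by
    rw [addHyps_apply, addHyps_apply, h.symm, dotProduct_comm y.2.1, dotProduct_comm y.2.2]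
    ring
  even x := by
    rw [addHyps_apply, dotProduct_comm x.2.2, add_assoc]
    exact (h.even _).add ⟨_, rfl⟩
  ne_zero := h.ne_zero
  two_dvd := h.two_dvd
  dual f := by
    obtain ⟨y, hy⟩ := h.dual (f ∘ₗ LinearMap.inl ℤ M _)
    refine ⟨(y, fun i => N * f (0, 0, Pi.single i 1), fun i => N * f (0, Pi.single i 1, 0)),
      fun z => ?_⟩
    have h1 := LinearMap.pi_apply_eq_sum_univ
      (f ∘ₗ LinearMap.inr ℤ M _ ∘ₗ LinearMap.inl ℤ (Fin k → ℤ) (Fin k → ℤ)) z.2.1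
    have h2 := LinearMap.pi_apply_eq_sum_univ
      (f ∘ₗ LinearMap.inr ℤ M _ ∘ₗ LinearMap.inr ℤ (Fin k → ℤ) (Fin k → ℤ)) z.2.2
    have h3 : f z = f (z.1, 0, 0) + f (0, z.2.1, 0) + f (0, 0, z.2.2) := by
      rw [← map_add, ← map_add]
      simp
    have hsingle : ∀ i : Fin k, (Pi.single i 1 : Fin k → ℤ) = fun j => if i = j then 1 else 0 := by
      intro i
      ext j
      simp [Pi.single_apply, eq_comm]
    simp only [LinearMap.comp_apply, LinearMap.inr_apply, LinearMap.inl_apply, ← hsingle,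
      smul_eq_mul] at h1 h2 hy
    rw [addHyps_apply, hy, h3, h1, h2, mul_add, mul_add, Finset.mul_sum, Finset.mul_sum]
    simp only [dotProduct]
    congr 1
    · congr 1
      exact Finset.sum_congr rfl fun _ _ => by ring
    · exact Finset.sum_congr rfl fun _ _ => by ring
  rank := by
    simp
    omega
  pos := by
    obtain ⟨z, hz⟩ := h.pos
    exact ⟨(z, 0, 0), by simpa [addHyps_apply] using hz⟩
  neg := by
    obtain ⟨z, hz⟩ := h.neg
    exact ⟨(z, 0, 0), by simpa [addHyps_apply] using hz⟩
  loc p hp hpN := by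
    rcases k with _ | k
    · obtain ⟨a, b, hab⟩ := hloc rfl p hp hpN
      exact ⟨(a, 0, 0), (b, 0, 0), by simpa [gram₂, addHyps_apply] using hab⟩
    · refine ⟨(0, Pi.single 0 1, 0), (0, 0, Pi.single 0 1), ?_⟩
      simp only [gram₂, addHyps_apply, map_zero, dotProduct_zero, zero_dotProduct,
        single_dotProduct, Pi.single_eq_same]
      norm_num
      exact fun h => hp.one_lt.ne' (by exact_mod_cast Int.eq_one_of_dvd_one (by positivity) h)

lemma IsIndefinite.cancel_addHyps [Module.Free ℤ M'] [Module.Finite ℤ M']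
    (hB : IsIndefinite B N) (hC : IsIndefinite C N') {j : ℕ}
    (h : IntIsom (addHyps B (k + j)) (addHyps C (k + j)))
    (hrB : 3 ≤ Module.finrank ℤ M + 2 * k) (hrC : 3 ≤ Module.finrank ℤ M' + 2 * k)
    (hlB : k = 0 → ∀ p : ℕ, p.Prime → p ∣ N → ∃ a b, ¬(p : ℤ) ∣ gram₂ B a b)
    (hlC : k = 0 → ∀ p : ℕ, p.Prime → p ∣ N' → ∃ a b, ¬(p : ℤ) ∣ gram₂ C a b) :
    IntIsom (addHyps B k) (addHyps C k) := by
  induction j with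
  | zero => exact h
  | succ j ih =>
    refine ih ((hB.isAdmissible_addHyps (by omega) fun h => hlB (by omega)).cancel
      (hC.isAdmissible_addHyps (by omega) fun h => hlC (by omega)) ?_)
    exact (intIsom_addHyp_addHyps B (k + j)).trans (h.trans (intIsom_addHyp_addHyps C (k + j)).symm)

end

section Glue

variable {n : ℕ} {G G' : Matrix (Fin n) (Fin n) ℤ}

lemma discMk_add (u v : Fin n → ℤ) : discMk G (u + v) = discMk G u + discMk G v := rfl

lemma discMk_eq_iff {u v : Fin n → ℤ} : discMk G u = discMk G v ↔ ∃ z, u = v + G *ᵥ z := by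
  refine (Submodule.Quotient.eq (LinearMap.range (Matrix.mulVecLin G))).trans ?_
  exact ⟨fun ⟨z, hz⟩ => ⟨z, by rw [← sub_eq_iff_eq_add', ← hz]; rfl⟩,
    fun ⟨z, hz⟩ => ⟨z, by rw [hz, add_sub_cancel_left]; rfl⟩⟩

lemma discMk_surjective : Function.Surjective (discMk G) := Submodule.Quotient.mk_surjective _

lemma mul_left_cancel_of_det_ne_zero {m : Type*} (hG : G.det ≠ 0) {A B : Matrix (Fin n) m ℤ}
    (h : G * A = G * B) : A = B := by
  have := congrArg (fun X => G.adjugate * X) h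
  simp only [← Matrix.mul_assoc, adjugate_mul, Matrix.smul_mul, Matrix.one_mul] at this
  ext i j
  have := congrFun (congrFun this i) j
  simp only [Matrix.smul_apply, smul_eq_mul] at this
  exact mul_left_cancel₀ hG this

lemma exists_matrix_of_discMk (φ : DiscGroup G ≃+ DiscGroup G') :
    ∃ F : Matrix (Fin n) (Fin n) ℤ, ∀ u, φ (discMk G u) = discMk G' (F *ᵥ u) := by
  choose f hf using fun i : Fin n => discMk_surjective (G := G') (φ (discMk G (Pi.single i 1)))
  refine ⟨(Matrix.of f)ᵀ, fun u => ?_⟩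
  let a : (Fin n → ℤ) →+ DiscGroup G' :=
    AddMonoidHom.mk' (fun u => φ (discMk G u)) fun u v => by rw [discMk_add, map_add]
  let b : (Fin n → ℤ) →+ DiscGroup G' :=
    AddMonoidHom.mk' (fun u => discMk G' ((Matrix.of f)ᵀ *ᵥ u)) fun u v => by
      rw [mulVec_add, discMk_add]
  suffices h : a = b from DFunLike.congr_fun h u
  refine AddMonoidHom.functions_ext' _ _ _ fun i => AddMonoidHom.ext_int ?_
  change φ (discMk G (Pi.single i 1)) = discMk G' ((Matrix.of f)ᵀ *ᵥ Pi.single i 1)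
  rw [← hf]
  congr 1
  ext j
  simp

lemma exists_matrix_mul {A : Matrix (Fin n) (Fin n) ℤ} (h : ∀ u, ∃ z, A *ᵥ u = G *ᵥ z) :
    ∃ X : Matrix (Fin n) (Fin n) ℤ, A = G * X := by
  choose f hf using fun i : Fin n => h (Pi.single i 1)
  refine ⟨(Matrix.of f)ᵀ, ?_⟩
  ext i j
  have := congrFun (hf j) i
  rw [mulVec_single_one] at this
  exact this

lemma exists_int_quadratic {D : Matrix (Fin n) (Fin n) ℚ} (hD : Dᵀ = D)
    (h : ∀ u : Fin n → ℤ, ∃ k : ℤ, ratify u ⬝ᵥ D *ᵥ ratify u = 2 * k) :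
    ∃ H : Matrix (Fin n) (Fin n) ℤ, H.map Int.cast = D ∧ Hᵀ = H ∧
      ∀ u, Even (u ⬝ᵥ H *ᵥ u) := by
  choose k hk using h
  have hadd : ∀ u v : Fin n → ℤ, ratify (u + v) = ratify u + ratify v := fun u v => by
    ext i; simp [ratify]
  have hs : ∀ u v : Fin n → ℚ, u ⬝ᵥ D *ᵥ v = v ⬝ᵥ D *ᵥ u := fun u v => by
    conv_lhs => rw [← hD, dotProduct_mulVec, vecMul_transpose, dotProduct_comm]
  have hsingle : ∀ i : Fin n, ratify (Pi.single i 1) = Pi.single i 1 := fun i => by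
    ext j
    by_cases h : j = i
    · subst h; simp [ratify]
    · simp [ratify, h]
  have hH : ((Matrix.of fun i j => k (Pi.single i 1 + Pi.single j 1) - k (Pi.single i 1) -
      k (Pi.single j 1)) : Matrix (Fin n) (Fin n) ℤ).map Int.cast = D := by
    ext i j
    have h1 := hk (Pi.single i 1 + Pi.single j 1)
    have h2 := hk (Pi.single i 1)
    have h3 := hk (Pi.single j 1)
    have h4 := hs (Pi.single i 1) (Pi.single j 1)
    rw [hadd, hsingle, hsingle, mulVec_add, dotProduct_add, add_dotProduct, add_dotProduct] at h1
    rw [hsingle] at h2 h3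
    have h5 : (Pi.single i 1 : Fin n → ℚ) ⬝ᵥ D *ᵥ Pi.single j 1 = D i j := by simp
    rw [h5] at h4 h1
    simp only [Matrix.map_apply, Matrix.of_apply, Int.cast_sub]
    linarith
  generalize (Matrix.of _ : Matrix (Fin n) (Fin n) ℤ) = H at hH
  refine ⟨H, hH, ?_, fun u => ⟨k u, ?_⟩⟩
  · ext i j
    have := congrFun (congrFun hD i) j
    rw [← hH] at this
    simpa using this
  · have := hk u
    have e : ratify u ⬝ᵥ D *ᵥ ratify u = ((u ⬝ᵥ H *ᵥ u : ℤ) : ℚ) := by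
      rw [← hH]
      simp [ratify, dotProduct, mulVec]
    rw [e] at this
    have : u ⬝ᵥ H *ᵥ u = 2 * k u := by exact_mod_cast this
    rw [this, two_mul]

theorem exists_glue_matrices (hG : Gᵀ = G) (hG' : G'ᵀ = G') (hd : G.det ≠ 0) (hd' : G'.det ≠ 0)
    (φ : DiscGroup G ≃+ DiscGroup G') (hφ : ∀ u u' : Fin n → ℤ, φ (discMk G u) = discMk G' u' →
      discQuad G' u' = discQuad G u) :
    ∃ F R H K : Matrix (Fin n) (Fin n) ℤ, F * G = G' * R ∧ G * H + Rᵀ * F = 1 ∧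
      F * Rᵀ = 1 + G' * K ∧ Hᵀ = H ∧ ∀ u, Even (u ⬝ᵥ H *ᵥ u) := by
  obtain ⟨F, hF⟩ := exists_matrix_of_discMk φ
  obtain ⟨R, hR⟩ : ∃ R, F * G = G' * R := exists_matrix_mul fun u => by
    have h0 : discMk G (G *ᵥ u) = discMk G 0 := discMk_eq_iff.2 ⟨u, by simp⟩
    have := congrArg φ h0
    rw [hF, hF, discMk_eq_iff] at this
    simpa using this
  have hR' : G * Fᵀ = Rᵀ * G' := by
    have := congrArg transpose hR
    rwa [transpose_mul, transpose_mul, hG, hG'] at this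
  set g : Matrix (Fin n) (Fin n) ℚ := G.map Int.cast with hg
  set g' : Matrix (Fin n) (Fin n) ℚ := G'.map Int.cast with hg'
  set f : Matrix (Fin n) (Fin n) ℚ := F.map Int.cast with hf
  have hgd : IsUnit g.det := by
    rw [hg, ← Int.cast_det]
    exact isUnit_iff_ne_zero.2 (by exact_mod_cast hd)
  have hgd' : IsUnit g'.det := by
    rw [hg', ← Int.cast_det]
    exact isUnit_iff_ne_zero.2 (by exact_mod_cast hd')
  have hgs : gᵀ = g := by rw [hg, ← transpose_map, hG]
  have hgs' : g'ᵀ = g' := by rw [hg', ← transpose_map, hG']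
  obtain ⟨H, hH, hHs, hHe⟩ := exists_int_quadratic (D := g⁻¹ - fᵀ * g'⁻¹ * f)
    (by simp only [transpose_sub, transpose_mul, transpose_nonsing_inv, transpose_transpose,
      hgs, hgs', Matrix.mul_assoc])
    (fun u => by
      have h1 := hφ u _ (hF u)
      rw [discQuad, discQuad, eq_comm, ← sub_eq_zero, ← AddCircle.coe_sub,
        AddCircle.coe_eq_zero_iff] at h1
      obtain ⟨k, hk⟩ := h1
      refine ⟨k, ?_⟩
      have h2 : ratify (F *ᵥ u) = f *ᵥ ratify u := by
        ext i
        simp [ratify, mulVec, dotProduct, hf]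
      rw [h2, zsmul_eq_mul] at hk
      rw [sub_mulVec, dotProduct_sub, mul_comm, hk]
      congr 1
      rw [← mulVec_mulVec, ← mulVec_mulVec, dotProduct_mulVec _ fᵀ, vecMul_transpose])
  have hGH : G * H + Rᵀ * F = 1 := by
    have hinj : Function.Injective fun X : Matrix (Fin n) (Fin n) ℤ => X.map (Int.cast : ℤ → ℚ) :=
      Matrix.map_injective Int.cast_injective
    apply hinj
    have h1 : g * fᵀ = (Rᵀ.map Int.cast : Matrix (Fin n) (Fin n) ℚ) * g' := by
      have := congrArg (fun X : Matrix (Fin n) (Fin n) ℤ => X.map (Int.castRingHom ℚ)) hR'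
      simp only [Matrix.map_mul] at this
      exact this
    have h2 : (G * H + Rᵀ * F).map (Int.castRingHom ℚ) = g * (H.map Int.cast) +
        (Rᵀ.map Int.cast : Matrix (Fin n) (Fin n) ℚ) * f := by
      rw [Matrix.map_add _ (map_add _), Matrix.map_mul, Matrix.map_mul]
      rfl
    change (G * H + Rᵀ * F).map (Int.castRingHom ℚ) =
      (1 : Matrix (Fin n) (Fin n) ℤ).map (Int.castRingHom ℚ)
    rw [h2, hH, Matrix.map_one _ (map_zero _) (map_one _), Matrix.mul_sub, mul_nonsing_inv _ hgd,
      ← Matrix.mul_assoc, ← Matrix.mul_assoc, h1, Matrix.mul_assoc _ g', mul_nonsing_inv _ hgd',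
      Matrix.mul_one, sub_add_cancel]
  obtain ⟨K, hK⟩ : ∃ K, F * Rᵀ - 1 = G' * K := exists_matrix_mul fun u => by
    obtain ⟨w, hw⟩ := discMk_surjective (φ.symm (discMk G' u))
    have h1 : discMk G' u = discMk G' (F *ᵥ w) := by rw [← hF, hw, AddEquiv.apply_symm_apply]
    obtain ⟨z, hz⟩ := discMk_eq_iff.1 h1
    have h2 : Rᵀ *ᵥ u = w - G *ᵥ (H *ᵥ w - Fᵀ *ᵥ z) := by
      have h3 := congrArg (· *ᵥ w) hGH
      simp only [add_mulVec, ← mulVec_mulVec, one_mulVec] at h3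
      rw [hz, mulVec_add, mulVec_mulVec _ Rᵀ G', ← hR', mulVec_sub, ← mulVec_mulVec]
      nth_rw 2 [← h3]
      abel
    refine ⟨-(z + R *ᵥ (H *ᵥ w - Fᵀ *ᵥ z)), ?_⟩
    rw [sub_mulVec, one_mulVec, ← mulVec_mulVec, h2, mulVec_sub F, mulVec_mulVec _ F G, hR,
      ← mulVec_mulVec, mulVec_neg, mulVec_add G']
    rw [hz]
    abel
  refine ⟨F, R, H, K, hR, hGH, by rw [← hK, add_sub_cancel], hHs, hHe⟩

end Glue

section Hyperbolic

variable {M : Type*} [AddCommGroup M]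

/-- The orthogonal sum of `k` hyperbolic planes. -/
def hypForm (k : ℕ) : BilinForm ℤ ((Fin k → ℤ) × (Fin k → ℤ)) :=
  LinearMap.mk₂ ℤ (fun x y => x.1 ⬝ᵥ y.2 + x.2 ⬝ᵥ y.1)
    (fun x y z => by simp only [Prod.fst_add, Prod.snd_add, add_dotProduct]; ring)
    (fun c x y => by simp only [Prod.smul_fst, Prod.smul_snd, smul_dotProduct, smul_add])
    (fun x y z => by simp only [Prod.fst_add, Prod.snd_add, dotProduct_add]; ring)
    (fun c x y => by simp only [Prod.smul_fst, Prod.smul_snd, dotProduct_smul, smul_add])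

lemma hypForm_apply (k : ℕ) (x y : (Fin k → ℤ) × (Fin k → ℤ)) :
    hypForm k x y = x.1 ⬝ᵥ y.2 + x.2 ⬝ᵥ y.1 := rfl

lemma exists_add_transpose {k : ℕ} (K : Matrix (Fin k) (Fin k) ℤ) (hK : Kᵀ = K)
    (he : ∀ i, Even (K i i)) : ∃ T, K = T + Tᵀ := by
  choose h hh using he
  refine ⟨Matrix.of fun i j => if i = j then h i else if i < j then K i j else 0, ?_⟩
  ext i j
  simp only [Matrix.add_apply, Matrix.transpose_apply, Matrix.of_apply]
  rcases lt_trichotomy i j with hij | rfl | hij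
  · rw [if_neg hij.ne, if_pos hij, if_neg hij.ne', if_neg hij.not_gt, add_zero]
  · rw [if_pos rfl, hh]
  · rw [if_neg hij.ne', if_neg hij.not_gt, if_neg hij.ne, if_pos hij, zero_add]
    exact (congrFun (congrFun hK i) j).symm

lemma exists_isotropic_correction {k : ℕ} {B : BilinForm ℤ M} (hs : ∀ x y, B x y = B y x)
    (he : ∀ x, Even (B x x)) (d c : (Fin k → ℤ) →ₗ[ℤ] M) (hd : ∀ x y, B (d x) (d y) = 0)
    (hc : ∀ x y, B (d x) (c y) = x ⬝ᵥ y) :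
    ∃ f : ((Fin k → ℤ) × (Fin k → ℤ)) →ₗ[ℤ] M, (∀ x y, B (f x) (f y) = hypForm k x y) ∧
      ∀ x, ∃ u v, f x = d u + c v := by
  let K : Matrix (Fin k) (Fin k) ℤ :=
    Matrix.of fun i j => B (c (Pi.single i 1)) (c (Pi.single j 1))
  have hK : ∀ x y, B (c x) (c y) = x ⬝ᵥ K *ᵥ y := fun x y => by
    have : Matrix.toBilin' K = B.comp c c := by
      apply (LinearMap.BilinForm.toMatrix' (R₁ := ℤ) (n := Fin k)).injective
      rw [LinearMap.BilinForm.toMatrix'_toBilin']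
      ext i j
      rw [LinearMap.BilinForm.toMatrix'_apply]
      rfl
    rw [← Matrix.toBilin'_apply', this]
    rfl
  obtain ⟨T, hT⟩ := exists_add_transpose K (by ext i j; exact hs _ _) fun i => he _
  refine ⟨d.comp (LinearMap.fst ℤ _ _ - T.mulVecLin.comp (LinearMap.snd ℤ _ _)) +
    c.comp (LinearMap.snd ℤ _ _), fun x y => ?_, fun x => ⟨_, _, rfl⟩⟩
  obtain ⟨a, b⟩ := x
  obtain ⟨a', b'⟩ := y
  change B (d (a - T *ᵥ b) + c b) (d (a' - T *ᵥ b') + c b') = _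
  rw [map_add, map_add, LinearMap.add_apply, LinearMap.add_apply, hd, hc, hs (c b), hc, hK, hT,
    hypForm_apply, add_mulVec, dotProduct_add, sub_dotProduct, sub_dotProduct,
    dotProduct_mulVec b Tᵀ, vecMul_transpose, dotProduct_comm (T *ᵥ b') b, dotProduct_comm b a']
  ring

theorem IntIsom.of_hypForm [Module.Free ℤ M] [Module.Finite ℤ M] {k : ℕ} {B : BilinForm ℤ M}
    (hr : Module.finrank ℤ M = k + k) (f : ((Fin k → ℤ) × (Fin k → ℤ)) →ₗ[ℤ] M)
    (hf : ∀ x y, B (f x) (f y) = hypForm k x y) : IntIsom B (hypForm k) := by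
  let g : M →ₗ[ℤ] (Fin k → ℤ) × (Fin k → ℤ) :=
    LinearMap.prod (LinearMap.pi fun i => B.flip (f (0, Pi.single i 1)))
      (LinearMap.pi fun i => B.flip (f (Pi.single i 1, 0)))
  have hg : ∀ x, g (f x) = x := fun x => by
    refine Prod.ext (funext fun i => ?_) (funext fun i => ?_)
    · change B (f x) (f _) = _
      rw [hf, hypForm_apply]
      simp
    · change B (f x) (f _) = _
      rw [hf, hypForm_apply]
      simp
  have hgs : Function.Surjective g := fun x => ⟨f x, hg x⟩
  have hgi : Function.Injective g := by
    have hr' : Module.finrank ℤ M = Module.finrank ℤ ((Fin k → ℤ) × (Fin k → ℤ)) := by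
      rw [hr, Module.finrank_prod, Module.finrank_fin_fun]
    exact OrzechProperty.injective_of_surjective_of_injective
      (LinearEquiv.ofFinrankEq M ((Fin k → ℤ) × (Fin k → ℤ)) hr').toLinearMap g
      (LinearEquiv.injective _) hgs
  have hfg : ∀ x, f (g x) = x := fun x => hgi (hg (g x))
  exact ⟨LinearEquiv.ofBijective g ⟨hgi, hgs⟩, fun x y => by
    conv_rhs => rw [← hfg x, ← hfg y, hf]
    rfl⟩

end Hyperbolic

section Embedding

variable {n : ℕ} {G G' F R H K : Matrix (Fin n) (Fin n) ℤ}

/-- The Gram matrix of the overlattice of `(-G') ⊥ G` determined by a glue map. -/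
def glueMatrix (G' F H : Matrix (Fin n) (Fin n) ℤ) : Matrix (Fin n ⊕ Fin n) (Fin n ⊕ Fin n) ℤ :=
  fromBlocks H (-Fᵀ) (-F) (-G')

lemma glueMatrix_apply (u v u' v' : Fin n → ℤ) :
    Sum.elim u v ⬝ᵥ glueMatrix G' F H *ᵥ Sum.elim u' v' =
      u ⬝ᵥ (H *ᵥ u' - Fᵀ *ᵥ v') - v ⬝ᵥ (F *ᵥ u' + G' *ᵥ v') := by
  rw [glueMatrix, fromBlocks_mulVec, sumElim_dotProduct_sumElim]
  simp only [Sum.elim_comp_inl, Sum.elim_comp_inr, neg_mulVec, dotProduct_add, dotProduct_sub,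
    dotProduct_neg]
  ring

lemma glue_aux (hG : Gᵀ = G) (hG' : G'ᵀ = G') (hd : G.det ≠ 0) (h1 : F * G = G' * R)
    (h2 : G * H + Rᵀ * F = 1) (h3 : F * Rᵀ = 1 + G' * K) : H * Rᵀ + Fᵀ * K = 0 := by
  have h1' : G * Fᵀ = Rᵀ * G' := by
    have := congrArg transpose h1
    rwa [transpose_mul, transpose_mul, hG, hG'] at this
  apply mul_left_cancel_of_det_ne_zero hd
  rw [Matrix.mul_add, ← Matrix.mul_assoc, ← Matrix.mul_assoc, h1', eq_sub_of_add_eq h2,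
    Matrix.sub_mul, Matrix.mul_assoc Rᵀ F, h3, Matrix.mul_add, Matrix.one_mul, Matrix.mul_one,
    Matrix.mul_zero, Matrix.mul_assoc]
  abel

lemma isUnit_det_glueMatrix (hG : Gᵀ = G) (hG' : G'ᵀ = G') (hd : G.det ≠ 0)
    (h1 : F * G = G' * R) (h2 : G * H + Rᵀ * F = 1) (h3 : F * Rᵀ = 1 + G' * K) (hH : Hᵀ = H) :
    IsUnit (glueMatrix G' F H).det := by
  have h : glueMatrix G' F H * fromBlocks G (-Rᵀ) (-R) K = 1 := by
    have h2' : H * G + Fᵀ * R = 1 := by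
      have := congrArg transpose h2
      rwa [transpose_add, transpose_mul, transpose_mul, hG, hH, transpose_transpose,
        transpose_one] at this
    have h4 := glue_aux hG hG' hd h1 h2 h3
    rw [glueMatrix, fromBlocks_multiply, ← fromBlocks_one]
    congr 1
    · rw [← h2', Matrix.neg_mul, Matrix.mul_neg, neg_neg]
    · rw [Matrix.mul_neg, Matrix.neg_mul, ← neg_add, h4, neg_zero]
    · rw [Matrix.neg_mul, Matrix.neg_mul, Matrix.mul_neg, neg_neg, h1, neg_add_cancel]
    · rw [Matrix.neg_mul, Matrix.mul_neg, neg_neg, Matrix.neg_mul, h3]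
      abel
  have := congrArg det h
  rw [det_mul, det_one] at this
  exact IsUnit.of_mul_eq_one _ this

lemma isSymm_glueMatrix (hG' : G'ᵀ = G') (hH : Hᵀ = H) :
    (glueMatrix G' F H)ᵀ = glueMatrix G' F H := by
  rw [glueMatrix, fromBlocks_transpose, hH, transpose_neg, transpose_neg, transpose_transpose,
    transpose_neg, hG']

lemma even_glueMatrix (hG' : ∀ u, Even (u ⬝ᵥ G' *ᵥ u)) (hH : ∀ u, Even (u ⬝ᵥ H *ᵥ u))
    (x : Fin n ⊕ Fin n → ℤ) : Even (x ⬝ᵥ glueMatrix G' F H *ᵥ x) := by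
  obtain ⟨a, ha⟩ := hH (x ∘ Sum.inl)
  obtain ⟨b, hb⟩ := hG' (x ∘ Sum.inr)
  rw [← Sum.elim_comp_inl_inr x, glueMatrix_apply, dotProduct_sub, dotProduct_add, ha, hb,
    dotProduct_mulVec _ Fᵀ, vecMul_transpose, dotProduct_comm (F *ᵥ _)]
  exact ⟨a - b - (x ∘ Sum.inr) ⬝ᵥ F *ᵥ (x ∘ Sum.inl), by ring⟩

theorem exists_isometric_of_glue (hG : Gᵀ = G) (hG' : G'ᵀ = G') (hd : G.det ≠ 0)
    (he' : ∀ u, Even (u ⬝ᵥ G' *ᵥ u))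
    (h1 : F * G = G' * R) (h2 : G * H + Rᵀ * F = 1) (h3 : F * Rᵀ = 1 + G' * K)
    (hS : IntIsom (Matrix.toBilin' (glueMatrix G' F H)) (hypForm n)) :
    ∃ f : ((Fin n → ℤ) × (Fin n → ℤ) × (Fin n → ℤ)) →ₗ[ℤ]
        ((Fin n → ℤ) × (Fin n → ℤ) × (Fin n → ℤ)),
      ∀ x y, addHyps (Matrix.toBilin' G') n (f x) (f y) = addHyps (Matrix.toBilin' G) n x y := by
  obtain ⟨e, he⟩ := hS
  have h1' : G * Fᵀ = Rᵀ * G' := by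
    have := congrArg transpose h1
    rwa [transpose_mul, transpose_mul, hG, hG'] at this
  have h4 := glue_aux hG hG' hd h1 h2 h3
  let s : ((Fin n → ℤ) × (Fin n → ℤ)) →ₗ[ℤ] (Fin n ⊕ Fin n → ℤ) :=
    (LinearEquiv.sumArrowLequivProdArrow (Fin n) (Fin n) ℤ ℤ).symm.toLinearMap
  have hs : ∀ u v, s (u, v) = Sum.elim u v := fun u v => rfl
  let C := addHyps (Matrix.toBilin' G') n
  have hC : ∀ (a : Fin n → ℤ) x b y, C (a, e (s x)) (b, e (s y)) =
      a ⬝ᵥ G' *ᵥ b + (x.1 ⬝ᵥ (H *ᵥ y.1 - Fᵀ *ᵥ y.2) - x.2 ⬝ᵥ (F *ᵥ y.1 + G' *ᵥ y.2)) := by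
    rintro a ⟨u, v⟩ b ⟨u', v'⟩
    have := he (Sum.elim u v) (Sum.elim u' v')
    rw [hypForm_apply, Matrix.toBilin'_apply', glueMatrix_apply] at this
    rw [addHyps_apply, add_assoc, hs, hs, Matrix.toBilin'_apply']
    simp only
    rw [this]
  have hGs : ∀ u v : Fin n → ℤ, (G' *ᵥ u) ⬝ᵥ v = u ⬝ᵥ G' *ᵥ v := fun u v => by
    rw [dotProduct_mulVec u, ← mulVec_transpose, hG']
  let l : (Fin n → ℤ) →ₗ[ℤ] ((Fin n → ℤ) × (Fin n → ℤ) × (Fin n → ℤ)) :=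
    R.mulVecLin.prod ((e.toLinearMap.comp s).comp (G.mulVecLin.prod 0))
  let d : (Fin n → ℤ) →ₗ[ℤ] ((Fin n → ℤ) × (Fin n → ℤ) × (Fin n → ℤ)) :=
    LinearMap.id.prod ((e.toLinearMap.comp s).comp (LinearMap.prod 0 LinearMap.id))
  let c : (Fin n → ℤ) →ₗ[ℤ] ((Fin n → ℤ) × (Fin n → ℤ) × (Fin n → ℤ)) :=
    LinearMap.prod 0 ((e.toLinearMap.comp s).comp (LinearMap.prod (-Rᵀ.mulVecLin) K.mulVecLin))
  have hl : ∀ x, l x = (R *ᵥ x, e (s (G *ᵥ x, 0))) := fun x => rfl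
  have hdd : ∀ x, d x = (x, e (s (0, x))) := fun x => rfl
  have hc : ∀ x, c x = (0, e (s (-(Rᵀ *ᵥ x), K *ᵥ x))) := fun x => rfl
  have key : ∀ x, H *ᵥ (-(Rᵀ *ᵥ x)) - Fᵀ *ᵥ (K *ᵥ x) = 0 := fun x => by
    have := congrArg (· *ᵥ x) h4
    simp only [add_mulVec, ← mulVec_mulVec, zero_mulVec] at this
    rw [mulVec_neg, ← neg_add', this, neg_zero]
  have key2 : ∀ x, F *ᵥ (-(Rᵀ *ᵥ x)) + G' *ᵥ (K *ᵥ x) = -x := fun x => by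
    rw [mulVec_neg, mulVec_mulVec, h3, add_mulVec, one_mulVec, ← mulVec_mulVec]
    abel
  obtain ⟨f, hf, hf'⟩ := exists_isotropic_correction (B := C) (k := n)
    (fun x y => by
      change addHyps _ _ _ _ = addHyps _ _ _ _
      rw [addHyps_apply, addHyps_apply, Matrix.toBilin'_apply', Matrix.toBilin'_apply',
        ← hGs, dotProduct_comm, dotProduct_comm x.2.1, dotProduct_comm x.2.2]
      ring)
    (fun x => by
      change Even (addHyps _ _ _ _)
      obtain ⟨a, ha⟩ := he' x.1
      rw [addHyps_apply, Matrix.toBilin'_apply', ha, dotProduct_comm x.2.1]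
      exact ⟨a + x.2.2 ⬝ᵥ x.2.1, by ring⟩) d c
    (fun x y => by rw [hdd, hdd, hC]; simp)
    (fun x y => by rw [hdd, hc, hC]; simp only [key2]; simp)
  have hlf : ∀ x y, C (l x) (f y) = 0 := fun x y => by
    obtain ⟨u, v, h⟩ := hf' y
    rw [h, map_add, hl, hdd, hc, hC, hC]
    simp only [key, key2]
    have : (G *ᵥ x) ⬝ᵥ (Fᵀ *ᵥ u) = (R *ᵥ x) ⬝ᵥ (G' *ᵥ u) := by
      rw [dotProduct_mulVec, ← mulVec_transpose, transpose_transpose, mulVec_mulVec, h1,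
        ← mulVec_mulVec, hGs]
    simp [this]
  have hfl : ∀ x y, C (f x) (l y) = 0 := fun x y => by
    rw [← hlf y x]
    change addHyps _ _ _ _ = addHyps _ _ _ _
    rw [addHyps_apply, addHyps_apply, Matrix.toBilin'_apply', Matrix.toBilin'_apply',
      ← hGs, dotProduct_comm, dotProduct_comm (f x).2.1, dotProduct_comm (f x).2.2]
    ring
  have hll : ∀ x y, C (l x) (l y) = x ⬝ᵥ G *ᵥ y := fun x y => by
    rw [hl, hl, hC]
    simp only [mulVec_zero, sub_zero, add_zero, zero_dotProduct]
    have h5 : (R *ᵥ x) ⬝ᵥ G' *ᵥ (R *ᵥ y) = x ⬝ᵥ (Rᵀ * F * G) *ᵥ y := by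
      rw [Matrix.mul_assoc, h1, ← mulVec_mulVec, ← mulVec_mulVec, dotProduct_mulVec x,
        vecMul_transpose]
    have h6 : (G *ᵥ x) ⬝ᵥ H *ᵥ (G *ᵥ y) = x ⬝ᵥ (G * H * G) *ᵥ y := by
      rw [← mulVec_mulVec, ← mulVec_mulVec, dotProduct_mulVec x, ← mulVec_transpose, hG]
    rw [h5, h6, ← dotProduct_add, ← add_mulVec, ← Matrix.add_mul, add_comm, h2, Matrix.one_mul]
  refine ⟨l.coprod f, fun x y => ?_⟩
  change C _ _ = _
  rw [LinearMap.coprod_apply, LinearMap.coprod_apply, map_add, map_add, LinearMap.add_apply,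
    LinearMap.add_apply, hlf, hfl, hll, hf, addHyps_apply, hypForm_apply, Matrix.toBilin'_apply']
  ring

end Embedding

section Unimodular

variable {ι : Type*} [Fintype ι]

lemma exists_dual_functionals {k : ℕ} {Λ : Submodule ℚ (ι → ℚ)} {b : Fin k → ι → ℤ}
    (hli : LinearIndependent ℤ b) (hb : ∀ i, castVec ι (b i) ∈ Λ)
    (hspan : ∀ w, castVec ι w ∈ Λ → ∃ c : Fin k → ℤ, w = ∑ i, c i • b i) :
    ∃ f : (ι → ℤ) →ₗ[ℤ] (Fin k → ℤ), ∀ i, f (b i) = Pi.single i 1 := by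
  let P : Submodule ℤ (ι → ℤ) := Submodule.span ℤ (Set.range b)
  have hP : ∀ w, w ∈ P ↔ castVec ι w ∈ Λ := fun w => by
    constructor
    · intro hw
      have : P ≤ (Λ.restrictScalars ℤ).comap (castVec ι) := by
        rw [Submodule.span_le]
        rintro _ ⟨i, rfl⟩
        exact hb i
      exact this hw
    · intro hw
      obtain ⟨c, rfl⟩ := hspan w hw
      exact sum_mem fun i _ => P.smul_mem _ (Submodule.subset_span ⟨i, rfl⟩)
  have : Module.IsTorsionFree ℤ ((ι → ℤ) ⧸ P) := by
    rw [Module.isTorsionFree_iff_smul_eq_zero]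
    intro k x hx
    obtain ⟨w, rfl⟩ := P.mkQ_surjective x
    rw [← map_smul, Submodule.mkQ_apply, Submodule.Quotient.mk_eq_zero] at hx
    rw [Submodule.mkQ_apply, Submodule.Quotient.mk_eq_zero]
    rw [hP, map_smul] at hx
    rw [or_iff_not_imp_left]
    intro hk
    rw [hP]
    have h := Λ.smul_mem ((k : ℚ)⁻¹) hx
    rwa [← Int.cast_smul_eq_zsmul ℚ, smul_smul, inv_mul_cancel₀ (by exact_mod_cast hk),
      one_smul] at h
  obtain ⟨s, hs⟩ := Module.projective_lifting_property P.mkQ (LinearMap.id) P.mkQ_surjective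
  have hs' : ∀ x, P.mkQ (s x) = x := fun x => LinearMap.congr_fun hs x
  let π : (ι → ℤ) →ₗ[ℤ] P := (LinearMap.id - s.comp P.mkQ).codRestrict P fun x => by
    refine (Submodule.Quotient.mk_eq_zero P).1 ?_
    rw [← Submodule.mkQ_apply]
    simp only [LinearMap.sub_apply, LinearMap.id_apply, LinearMap.comp_apply, map_sub, hs',
      sub_self]
  let β := Module.Basis.span hli
  refine ⟨β.equivFun.toLinearMap.comp π, fun i => ?_⟩
  have h1 : π (b i) = β i := by
    apply Subtype.ext
    rw [Module.Basis.span_apply]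
    have h2 : P.mkQ (b i) = 0 := by
      rw [← LinearMap.mem_ker, P.ker_mkQ]
      exact Submodule.subset_span ⟨i, rfl⟩
    change b i - s (P.mkQ (b i)) = b i
    rw [h2, map_zero, sub_zero]
  rw [LinearMap.comp_apply, h1]
  ext j
  simp [Pi.single_apply, eq_comm]

theorem intIsom_hypForm_of_metabolic [DecidableEq ι] {n : ℕ} {S : Matrix ι ι ℤ} (hS : Sᵀ = S)
    (hd : IsUnit S.det) (he : ∀ x, Even (x ⬝ᵥ S *ᵥ x)) (hm : Metabolic (ratForm S))
    (hc : Fintype.card ι = n + n) : IntIsom (Matrix.toBilin' S) (hypForm n) := by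
  obtain ⟨Λ, hΛ⟩ := hm
  have hnd : (ratForm S).Nondegenerate := by
    refine LinearMap.BilinForm.nondegenerate_toBilin'_of_det_ne_zero' _ ?_
    rw [← Int.cast_det]
    exact_mod_cast hd.ne_zero
  have hr : Module.finrank ℚ Λ = n := by
    have := BilinForm.finrank_orthogonal hnd Λ
    rw [hΛ, Module.finrank_fintype_fun_eq_card] at this
    omega
  obtain ⟨b, hli, hb, hspan⟩ : ∃ b : Fin n → ι → ℤ, LinearIndependent ℤ b ∧
      (∀ i, castVec ι (b i) ∈ Λ) ∧
      ∀ w, castVec ι w ∈ Λ → ∃ c : Fin n → ℤ, w = ∑ i, c i • b i := by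
    rw [← hr]
    exact exists_integral_basis Λ
  obtain ⟨f, hf⟩ := exists_dual_functionals hli hb hspan
  let d : (Fin n → ℤ) →ₗ[ℤ] (ι → ℤ) := Fintype.linearCombination ℤ b
  have hfd : ∀ x, f (d x) = x := fun x => by
    change f (∑ i, x i • b i) = x
    rw [map_sum]
    ext j
    simp_rw [map_smul, hf]
    simp [Pi.single_apply]
  let A := LinearMap.toMatrix' f
  have hA : ∀ x, A *ᵥ x = f x := fun x => LinearMap.toMatrix'_mulVec f x
  let c : (Fin n → ℤ) →ₗ[ℤ] (ι → ℤ) := (S⁻¹ * Aᵀ).mulVecLin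
  have hdΛ : ∀ x, castVec ι (d x) ∈ Λ := fun x => by
    change castVec ι (∑ i, x i • b i) ∈ Λ
    rw [map_sum]
    refine sum_mem fun i _ => ?_
    rw [map_smul]
    exact (Λ.restrictScalars ℤ).smul_mem _ (hb i)
  have hsymm : ∀ x y, Matrix.toBilin' S x y = Matrix.toBilin' S y x :=
    (toBilin'_isSymm hS).eq
  obtain ⟨g, hg, -⟩ := exists_isotropic_correction (B := Matrix.toBilin' S) hsymm
    (fun x => by rw [Matrix.toBilin'_apply']; exact he x) d c
    (fun x y => by
      have h := hdΛ y
      rw [← hΛ] at h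
      have h' : ratForm S (castVec ι (d x)) (castVec ι (d y)) = 0 := h _ (hdΛ x)
      rw [ratForm_castVec] at h'
      exact_mod_cast h')
    (fun x y => by
      change Matrix.toBilin' S (d x) ((S⁻¹ * Aᵀ) *ᵥ y) = _
      rw [Matrix.toBilin'_apply', mulVec_mulVec, ← Matrix.mul_assoc, mul_nonsing_inv _ hd,
        Matrix.one_mul, dotProduct_mulVec, vecMul_transpose, hA, hfd])
  exact IntIsom.of_hypForm (by rw [Module.finrank_fintype_fun_eq_card, hc]) g hg

end Unimodular

section Congruence

variable {ι : Type*} [Fintype ι] [DecidableEq ι]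

/-- Multiplication by an invertible matrix as a linear automorphism. -/
noncomputable def mulVecEquiv {K : Type*} [Field K] {P : Matrix ι ι K} (hP : IsUnit P.det) :
    (ι → K) ≃ₗ[K] (ι → K) :=
  LinearEquiv.ofBijective P.mulVecLin
    (by
      have := (Matrix.isUnit_iff_isUnit_det P).2 hP
      exact ⟨Matrix.mulVec_injective_iff_isUnit.2 this, Matrix.mulVec_surjective_iff_isUnit.2 this⟩)

lemma toBilin'_congr {R : Type*} [CommRing R] (P A : Matrix ι ι R) (x y : ι → R) :
    Matrix.toBilin' A (P *ᵥ x) (P *ᵥ y) = Matrix.toBilin' (Pᵀ * A * P) x y := by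
  rw [Matrix.toBilin'_apply', Matrix.toBilin'_apply', ← mulVec_mulVec, ← mulVec_mulVec,
    dotProduct_mulVec x, vecMul_transpose]

lemma isom_of_congr {P : Matrix ι ι ℚ} (hP : IsUnit P.det) {A D : Matrix ι ι ℚ}
    (h : Pᵀ * A * P = D) : Isom (Matrix.toBilin' D) (Matrix.toBilin' A) :=
  ⟨mulVecEquiv hP, fun x y => by rw [← h]; exact toBilin'_congr P A x y⟩

lemma isom_diagForm_toBilin' (f : ι → ℚ) :
    Isom (diagForm f) (Matrix.toBilin' (diagonal f)) :=
  ⟨.refl ℚ _, fun x y => by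
    rw [Matrix.toBilin'_apply', diagForm_apply, dotProduct]
    refine Finset.sum_congr rfl fun i _ => ?_
    rw [mulVec_diagonal]
    simp only [LinearEquiv.refl_apply]
    ring⟩

lemma exists_congr_diagonal {n : ℕ} (A : Matrix (Fin n) (Fin n) ℚ) (hA : Aᵀ = A) :
    ∃ (P : Matrix (Fin n) (Fin n) ℚ) (f : Fin n → ℚ), IsUnit P.det ∧
      Pᵀ * A * P = diagonal f := by
  obtain ⟨v, hv⟩ := LinearMap.BilinForm.exists_orthogonal_basis
    (B := Matrix.toBilin' A) ⟨fun x y => (toBilin'_isSymm hA).eq x y⟩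
  let w := v.reindex (finCongr (Module.finrank_fin_fun ℚ : Module.finrank ℚ (Fin n → ℚ) = n))
  have hw : ∀ i j, i ≠ j → Matrix.toBilin' A (w i) (w j) = 0 := fun i j hij => by
    rw [Module.Basis.reindex_apply, Module.Basis.reindex_apply]
    exact hv (fun h => hij ((finCongr _).symm.injective h))
  let P := (Pi.basisFun ℚ (Fin n)).toMatrix w
  have hPw : ∀ i, P *ᵥ Pi.single i 1 = w i := fun i => by
    rw [mulVec_single_one]
    rfl
  refine ⟨P, fun i => Matrix.toBilin' A (w i) (w i), ?_, ?_⟩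
  · rw [← Matrix.isUnit_iff_isUnit_det]
    have := (Pi.basisFun ℚ (Fin n)).invertibleToMatrix w
    exact isUnit_of_invertible P
  · ext i j
    have h : (Pᵀ * A * P) i j = Matrix.toBilin' A (w i) (w j) := by
      rw [← hPw, ← hPw, toBilin'_congr, Matrix.toBilin'_single]
    rw [h]
    rcases eq_or_ne i j with rfl | hij
    · rw [diagonal_apply_eq]
    · rw [hw i j hij, diagonal_apply_ne _ hij]

end Congruence

section Inertia

variable {n : ℕ}

lemma sum_sign_eq_ncard_sub (w : Fin n → ℝ) :
    ∑ i, (SignType.sign (w i) : ℤ) = ({i | 0 < w i}.ncard : ℤ) - {i | w i < 0}.ncard := by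
  classical
  rw [Set.ncard_eq_toFinset_card', Set.ncard_eq_toFinset_card', Set.toFinset_ofPred,
    Set.toFinset_ofPred, Finset.card_filter, Finset.card_filter]
  push_cast
  rw [← Finset.sum_sub_distrib]
  refine Finset.sum_congr rfl fun i _ => ?_
  rcases lt_trichotomy (w i) 0 with h | h | h
  · simp [h, h.not_gt]
  · simp [h]
  · simp [h, h.not_gt]

lemma equivalent_of_congr {A P : Matrix (Fin n) (Fin n) ℝ} {d : Fin n → ℝ} (hP : IsUnit P.det)
    (h : Pᵀ * A * P = diagonal d) :
    QuadraticMap.Equivalent (Matrix.toBilin' A).toQuadraticMap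
      (QuadraticMap.weightedSumSquares ℝ d) := by
  refine QuadraticMap.Equivalent.symm ⟨⟨mulVecEquiv hP, fun x => ?_⟩⟩
  have := toBilin'_congr P A x x
  rw [h] at this
  refine this.trans ?_
  rw [Matrix.toBilin'_apply', dotProduct, QuadraticMap.weightedSumSquares_apply]
  refine Finset.sum_congr rfl fun i _ => ?_
  rw [mulVec_diagonal, smul_eq_mul]
  ring

lemma sum_sign_eq_of_congr {A P P' : Matrix (Fin n) (Fin n) ℝ} {d d' : Fin n → ℝ}
    (hP : IsUnit P.det) (h : Pᵀ * A * P = diagonal d)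
    (hP' : IsUnit P'.det) (h' : P'ᵀ * A * P' = diagonal d') :
    ∑ i, (SignType.sign (d i) : ℤ) = ∑ i, (SignType.sign (d' i) : ℤ) := by
  have e := equivalent_of_congr hP h
  have e' := equivalent_of_congr hP' h'
  rw [sum_sign_eq_ncard_sub, sum_sign_eq_ncard_sub,
    ← QuadraticForm.sigPos_of_equiv_weightedSumSquares e,
    ← QuadraticForm.sigPos_of_equiv_weightedSumSquares e',
    ← QuadraticForm.sigNeg_of_equiv_weightedSumSquares e,
    ← QuadraticForm.sigNeg_of_equiv_weightedSumSquares e']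

lemma sum_sign_of_hasSignature {G : Matrix (Fin n) (Fin n) ℤ} {p q : ℕ} (hG : HasSignature G p q)
    {P : Matrix (Fin n) (Fin n) ℚ} {f : Fin n → ℚ} (hP : IsUnit P.det)
    (h : Pᵀ * G.map Int.cast * P = diagonal f) :
    ∑ i, (SignType.sign (f i) : ℤ) = p - q := by
  obtain ⟨P', d, hP', hd, hp, hq, h'⟩ := hG
  have h1 : (P.map (algebraMap ℚ ℝ))ᵀ * (G.map (Int.cast : ℤ → ℝ)) * P.map (algebraMap ℚ ℝ) =
      diagonal fun i => algebraMap ℚ ℝ (f i) := by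
    have := congrArg (fun X : Matrix (Fin n) (Fin n) ℚ => X.map (algebraMap ℚ ℝ)) h
    simp only [Matrix.map_mul, diagonal_map (map_zero _)] at this
    rw [← this, transpose_map, Matrix.map_map]
    congr 3
  have h2 : IsUnit (P.map (algebraMap ℚ ℝ)).det := by
    have := hP.map (algebraMap ℚ ℝ)
    rwa [RingHom.map_det] at this
  have h3 := sum_sign_eq_of_congr h2 h1 hP' h'
  have h4 : ∀ i, SignType.sign (algebraMap ℚ ℝ (f i)) = SignType.sign (f i) := fun i => by
    rw [eq_ratCast]
    rcases lt_trichotomy (f i) 0 with h | h | h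
    · rw [sign_neg h, sign_neg (by exact_mod_cast h)]
    · simp [h]
    · rw [sign_pos h, sign_pos (by exact_mod_cast h)]
  simp only [h4] at h3
  rw [h3, ← hp, ← hq, Finset.card_filter, Finset.card_filter]
  push_cast
  rw [← Finset.sum_sub_distrib]
  refine Finset.sum_congr rfl fun i _ => ?_
  rcases hd i with h | h <;> rw [h] <;> norm_num

end Inertia

section GlueMetabolic

variable {n : ℕ} {G G' F R H : Matrix (Fin n) (Fin n) ℤ}

lemma glueMatrix_congr (hG : Gᵀ = G) (hG' : G'ᵀ = G') (h1 : F * G = G' * R)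
    (h2 : G * H + Rᵀ * F = 1) (hH : Hᵀ = H) :
    (fromBlocks G 0 (-R) 1)ᵀ * glueMatrix G' F H * fromBlocks G 0 (-R) 1 =
      fromBlocks G 0 0 (-G') := by
  have h1' : G * Fᵀ = Rᵀ * G' := by
    have := congrArg transpose h1
    rwa [transpose_mul, transpose_mul, hG, hG'] at this
  have h2' : H * G + Fᵀ * R = 1 := by
    have := congrArg transpose h2
    rwa [transpose_add, transpose_mul, transpose_mul, hG, hH, transpose_transpose,
      transpose_one] at this
  rw [Matrix.mul_assoc, glueMatrix, fromBlocks_multiply, fromBlocks_transpose, fromBlocks_multiply]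
  simp only [Matrix.mul_neg, Matrix.neg_mul, neg_neg, h2', h1, Matrix.mul_zero, Matrix.mul_one,
    zero_add, hG, transpose_neg, transpose_zero, transpose_one, Matrix.zero_mul, Matrix.one_mul,
    h1', add_zero, neg_add_cancel, neg_zero]

theorem metabolic_glueMatrix (hG : Gᵀ = G) (hG' : G'ᵀ = G') (hd : G.det ≠ 0)
    (h1 : F * G = G' * R) (h2 : G * H + Rᵀ * F = 1) (hH : Hᵀ = H)
    (hS : IsUnit (glueMatrix G' F H).det) {p q : ℕ} (hs : HasSignature G p q)
    (hs' : HasSignature G' p q) : Metabolic (ratForm (glueMatrix G' F H)) := by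
  obtain ⟨P, f, hP, hf⟩ := exists_congr_diagonal (G.map (Int.cast : ℤ → ℚ))
    (by rw [← transpose_map, hG])
  obtain ⟨P', f', hP', hf'⟩ := exists_congr_diagonal (G'.map (Int.cast : ℤ → ℚ))
    (by rw [← transpose_map, hG'])
  have hf'' : P'ᵀ * (-G').map Int.cast * P' = diagonal (-f') := by
    have : (-G').map (Int.cast : ℤ → ℚ) = -G'.map Int.cast := by ext; simp
    rw [this, Matrix.mul_neg, Matrix.neg_mul, hf', diagonal_neg]
    rfl
  have hθ : IsUnit ((fromBlocks G 0 (-R) 1).map (Int.cast : ℤ → ℚ)).det := by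
    rw [← Int.cast_det, det_fromBlocks_zero₁₂, det_one, mul_one]
    exact isUnit_iff_ne_zero.2 (by exact_mod_cast hd)
  have hcongr := congrArg (fun X : Matrix (Fin n ⊕ Fin n) (Fin n ⊕ Fin n) ℤ =>
    X.map (Int.castRingHom ℚ)) (glueMatrix_congr hG hG' h1 h2 hH)
  simp only [Matrix.map_mul] at hcongr
  have i1 : Isom (ratForm (fromBlocks G 0 0 (-G'))) (ratForm (glueMatrix G' F H)) :=
    isom_of_congr hθ hcongr
  have i2 : Isom (diagForm (Sum.elim f (-f'))) (ratForm (glueMatrix G' F H)) :=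
    (isom_diagForm_sumElim _ _).trans
      ((((isom_diagForm_toBilin' f).trans (isom_of_congr hP hf)).prod
        ((isom_diagForm_toBilin' _).trans (isom_of_congr hP' hf''))).trans
        ((isom_ratForm_fromBlocks G (-G')).symm.trans i1))
  refine i2.metabolic (met_of_sum_of_eq_zero _ (WittQ.eq_zero_of_unramified ?_ fun p hp => ?_))
  · rw [map_sum, Fintype.sum_sum_type]
    simp only [WittQ.sig_of, Sum.elim_inl, Sum.elim_inr, Pi.neg_apply, Left.sign_neg]
    have e1 := sum_sign_of_hasSignature hs hP hf
    have e2 := sum_sign_of_hasSignature hs' hP' hf'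
    rw [e1]
    have e3 : ∀ i, ((-SignType.sign (f' i) : SignType) : ℤ) = -(SignType.sign (f' i) : ℤ) :=
      fun i => by cases SignType.sign (f' i) <;> rfl
    simp only [e3, Finset.sum_neg_distrib, e2]
    ring
  · refine unramified_of_isom hp (fun hdvd => ?_) i2
    exact hp.one_lt.ne' (by
      have := isUnit_of_dvd_unit hdvd hS
      rwa [Int.isUnit_iff_natAbs_eq, Int.natAbs_natCast] at this)

theorem exists_isometric_addHyps (hG : Gᵀ = G) (hG' : G'ᵀ = G') (hd : G.det ≠ 0)
    (hd' : G'.det ≠ 0) (he' : ∀ u, Even (u ⬝ᵥ G' *ᵥ u)) {p q : ℕ} (hs : HasSignature G p q)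
    (hs' : HasSignature G' p q) (φ : DiscGroup G ≃+ DiscGroup G')
    (hφ : ∀ u u' : Fin n → ℤ, φ (discMk G u) = discMk G' u' → discQuad G' u' = discQuad G u) :
    ∃ f : ((Fin n → ℤ) × (Fin n → ℤ) × (Fin n → ℤ)) →ₗ[ℤ]
        ((Fin n → ℤ) × (Fin n → ℤ) × (Fin n → ℤ)),
      ∀ x y, addHyps (Matrix.toBilin' G') n (f x) (f y) = addHyps (Matrix.toBilin' G) n x y := by
  obtain ⟨F, R, H, K, h1, h2, h3, hH, hHe⟩ := exists_glue_matrices hG hG' hd hd' φ hφ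
  have hS := isUnit_det_glueMatrix hG hG' hd h1 h2 h3 hH
  exact exists_isometric_of_glue hG hG' hd he' h1 h2 h3
    (intIsom_hypForm_of_metabolic (isSymm_glueMatrix hG' hH) hS (even_glueMatrix he' hHe)
      (metabolic_glueMatrix hG hG' hd h1 h2 hH hS hs hs') (by simp))

end GlueMetabolic

section SignatureVectors

variable {n : ℕ} {G : Matrix (Fin n) (Fin n) ℤ} {p q : ℕ}

lemma HasSignature.add_eq (h : HasSignature G p q) : p + q = n := by
  obtain ⟨P, d, -, hd, rfl, rfl, -⟩ := h
  have h1 : (Finset.univ.filter fun i => d i = -1) = Finset.univ.filter fun i => ¬ d i = 1 := by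
    refine Finset.filter_congr fun i _ => ?_
    rcases hd i with h | h <;> rw [h] <;> norm_num
  rw [h1, Finset.card_filter_add_card_filter_not, Finset.card_univ, Fintype.card_fin]

lemma map_neg_cast {R : Type*} [Ring R] (G : Matrix (Fin n) (Fin n) ℤ) :
    (-G).map (Int.cast : ℤ → R) = -G.map Int.cast := by
  ext
  simp

lemma HasSignature.neg (h : HasSignature G p q) : HasSignature (-G) q p := by
  obtain ⟨P, d, hP, hd, hp, hq, h⟩ := h
  refine ⟨P, -d, hP, fun i => ?_, ?_, ?_, ?_⟩
  · rcases hd i with h | h <;> simp [h]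
  · rw [← hq]
    congr 1
    refine Finset.filter_congr fun i _ => ?_
    rw [Pi.neg_apply, neg_eq_iff_eq_neg]
  · rw [← hp]
    congr 1
    refine Finset.filter_congr fun i _ => ?_
    rw [Pi.neg_apply, neg_inj]
  · rw [map_neg_cast, Matrix.mul_neg, Matrix.neg_mul, h, diagonal_neg]
    rfl

lemma HasSignature.pos_of_exists (h : HasSignature G p q)
    (hx : ∃ x : Fin n → ℝ, 0 < x ⬝ᵥ (G.map (Int.cast : ℤ → ℝ)) *ᵥ x) : 0 < p := by
  obtain ⟨P, d, hP, hd, rfl, -, h⟩ := h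
  obtain ⟨x, hx⟩ := hx
  obtain ⟨y, rfl⟩ := (mulVecEquiv hP).surjective x
  have h1 := toBilin'_congr P (G.map (Int.cast : ℤ → ℝ)) y y
  rw [h, Matrix.toBilin'_apply', Matrix.toBilin'_apply'] at h1
  have h2 : 0 < y ⬝ᵥ diagonal d *ᵥ y := h1 ▸ hx
  obtain ⟨i, -, hi⟩ := Finset.exists_lt_of_sum_lt (s := Finset.univ) (f := fun _ => (0 : ℝ))
    (g := fun i => y i * (diagonal d *ᵥ y) i) (by simpa [dotProduct] using h2)
  rw [mulVec_diagonal] at hi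
  refine Finset.card_pos.2 ⟨i, Finset.mem_filter.2 ⟨Finset.mem_univ i, ?_⟩⟩
  rcases hd i with h | h
  · exact h
  · rw [h] at hi
    nlinarith [mul_self_nonneg (y i)]

lemma HasSignature.exists_of_pos (h : HasSignature G p q) (hp : 0 < p) :
    ∃ x : Fin n → ℝ, 0 < x ⬝ᵥ (G.map (Int.cast : ℤ → ℝ)) *ᵥ x := by
  obtain ⟨P, d, hP, hd, rfl, -, h⟩ := h
  obtain ⟨i, hi⟩ := Finset.card_pos.1 hp
  have hi := (Finset.mem_filter.1 hi).2
  refine ⟨P *ᵥ Pi.single i 1, ?_⟩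
  rw [← Matrix.toBilin'_apply', toBilin'_congr, h, Matrix.toBilin'_single, diagonal_apply_eq, hi]
  exact one_pos

lemma exists_int_pos (h : ∃ x : Fin n → ℝ, 0 < x ⬝ᵥ (G.map (Int.cast : ℤ → ℝ)) *ᵥ x) :
    ∃ z : Fin n → ℤ, 0 < z ⬝ᵥ G *ᵥ z := by
  have hc : Continuous fun x : Fin n → ℝ => x ⬝ᵥ (G.map (Int.cast : ℤ → ℝ)) *ᵥ x := by
    fun_prop
  have hd : DenseRange fun (v : Fin n → ℚ) (i : Fin n) => (v i : ℝ) :=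
    DenseRange.piMap fun _ => Rat.denseRange_cast
  obtain ⟨v, hv⟩ := hd.exists_mem_open (isOpen_lt continuous_const hc) h
  obtain ⟨k, hk, w, hw⟩ := exists_smul_eq_castVec v
  refine ⟨w, ?_⟩
  set r : Fin n → ℝ := fun i => (v i : ℝ)
  have hw' : (fun i => (w i : ℝ)) = (k : ℝ) • r := by
    ext i
    have := congrFun hw i
    simp only [Pi.smul_apply, smul_eq_mul, castVec_apply] at this
    simp only [Pi.smul_apply, smul_eq_mul, r]
    exact_mod_cast this.symm
  have h1 : ((w ⬝ᵥ G *ᵥ w : ℤ) : ℝ) =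
      (fun i => (w i : ℝ)) ⬝ᵥ (G.map (Int.cast : ℤ → ℝ)) *ᵥ fun i => (w i : ℝ) := by
    simp [dotProduct, mulVec]
  rw [hw', mulVec_smul, dotProduct_smul, smul_dotProduct, smul_smul, smul_eq_mul] at h1
  have hk' : (k : ℝ) ≠ 0 := by exact_mod_cast hk
  have h2 : 0 < (k : ℝ) * k * (r ⬝ᵥ (G.map (Int.cast : ℤ → ℝ)) *ᵥ r) :=
    mul_pos (mul_self_pos.2 hk') hv
  rw [← h1] at h2
  exact_mod_cast h2

end SignatureVectors

section Generators

variable {n m : ℕ} {G G' : Matrix (Fin n) (Fin n) ℤ}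

/-- The discriminant group is generated by `m` elements. -/
def DiscGenerated (G : Matrix (Fin n) (Fin n) ℤ) (m : ℕ) : Prop :=
  ∃ u : Fin m → Fin n → ℤ, ∀ v, ∃ (c : Fin m → ℤ) (z : Fin n → ℤ), v = ∑ i, c i • u i + G *ᵥ z

lemma discGenerated_of_span (h : ∃ s : Fin m → DiscGroup G, Submodule.span ℤ (Set.range s) = ⊤) :
    DiscGenerated G m := by
  obtain ⟨s, hs⟩ := h
  choose u hu using fun i => discMk_surjective (s i)
  refine ⟨u, fun v => ?_⟩
  let N := LinearMap.range (Matrix.mulVecLin G)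
  have hs' : Submodule.span ℤ (Set.range fun i => N.mkQ (u i)) = ⊤ := by
    have : (fun i => N.mkQ (u i)) = s := funext hu
    rw [this]
    exact hs
  have hv : N.mkQ v ∈ Submodule.span ℤ (Set.range fun i => N.mkQ (u i)) := hs' ▸ trivial
  obtain ⟨c, hc⟩ := (Submodule.mem_span_range_iff_exists_fun ℤ).1 hv
  simp only [← map_smul] at hc
  rw [← map_sum, eq_comm, Submodule.mkQ_apply, Submodule.mkQ_apply, Submodule.Quotient.eq] at hc
  obtain ⟨z, hz⟩ := hc
  exact ⟨c, z, by rw [← sub_eq_iff_eq_add', ← hz]; rfl⟩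

lemma DiscGenerated.map (h : DiscGenerated G m) (φ : DiscGroup G ≃+ DiscGroup G') :
    DiscGenerated G' m := by
  obtain ⟨u, hu⟩ := h
  obtain ⟨F, hF⟩ := exists_matrix_of_discMk φ
  refine ⟨fun i => F *ᵥ u i, fun v => ?_⟩
  obtain ⟨w, hw⟩ := discMk_surjective (φ.symm (discMk G' v))
  obtain ⟨c, z, hc⟩ := hu w
  have h1 : discMk G w = discMk G (∑ i, c i • u i) := discMk_eq_iff.2 ⟨z, hc⟩
  have h2 : discMk G' v = discMk G' (F *ᵥ ∑ i, c i • u i) := by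
    rw [← hF, ← h1, hw, AddEquiv.apply_symm_apply]
  obtain ⟨z', hz'⟩ := discMk_eq_iff.1 h2
  refine ⟨c, z', ?_⟩
  rw [hz', mulVec_sum]
  simp only [mulVec_smul]

lemma DiscGenerated.isUnit_det (h : DiscGenerated G 0) : IsUnit G.det := by
  obtain ⟨u, hu⟩ := h
  obtain ⟨X, hX⟩ : ∃ X : Matrix (Fin n) (Fin n) ℤ, 1 = G * X := exists_matrix_mul fun v => by
    obtain ⟨c, z, hc⟩ := hu v
    exact ⟨z, by rw [one_mulVec, hc, Fin.sum_univ_zero, zero_add]⟩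
  have := congrArg det hX
  rw [det_one, det_mul] at this
  exact IsUnit.of_mul_eq_one _ this.symm

lemma DiscGenerated.lt_of_rank_le_one (h : DiscGenerated G m) {K : Type*} [Field K]
    (hK : Function.Surjective (Int.cast : ℤ → K)) (w : Fin n → K)
    (hw : ∀ z, ∃ c : K, (fun i => ((G *ᵥ z) i : K)) = c • w) : n ≤ m + 1 := by
  obtain ⟨u, hu⟩ := h
  let t : Fin m ⊕ Unit → Fin n → K := Sum.elim (fun i j => (u i j : K)) fun _ => w
  have ht : Submodule.span K (Set.range t) = ⊤ := by
    rw [eq_top_iff]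
    rintro v -
    choose v' hv' using fun i => hK (v i)
    obtain ⟨c, z, hc⟩ := hu v'
    obtain ⟨a, ha⟩ := hw z
    have : v = ∑ i, (c i : K) • t (Sum.inl i) + a • t (Sum.inr ()) := by
      ext j
      have h1 := congrFun ha j
      simp only [Pi.smul_apply, smul_eq_mul] at h1
      rw [← hv' j, hc]
      simp [t, h1]
    rw [this]
    exact add_mem (sum_mem fun i _ => Submodule.smul_mem _ _ (Submodule.subset_span ⟨_, rfl⟩))
      (Submodule.smul_mem _ _ (Submodule.subset_span ⟨_, rfl⟩))
  have := finrank_range_le_card (R := K) t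
  rw [Set.finrank, ht, finrank_top, Module.finrank_fin_fun] at this
  simpa using this

theorem DiscGenerated.exists_not_dvd_gram₂ (h : DiscGenerated G m) (hm : m + 1 < n)
    (hG : Gᵀ = G) (he : ∀ x, Even (x ⬝ᵥ G *ᵥ x)) {p : ℕ} (hp : p.Prime) :
    ∃ a b, ¬ (p : ℤ) ∣ gram₂ (Matrix.toBilin' G) a b := by
  by_contra! hc
  have : Fact p.Prime := ⟨hp⟩
  have hpz : Prime (p : ℤ) := Nat.prime_iff_prime_int.1 hp
  have hs : ∀ x y, Matrix.toBilin' G x y = Matrix.toBilin' G y x := (toBilin'_isSymm hG).eq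
  have hentry : ∀ z i, Matrix.toBilin' G (Pi.single i 1) z = (G *ᵥ z) i := fun z i => by
    rw [Matrix.toBilin'_apply', single_one_dotProduct]
  refine hm.not_ge ?_
  by_cases h0 : ∀ a, (p : ℤ) ∣ Matrix.toBilin' G a a
  · refine h.lt_of_rank_le_one (K := ZMod p) (ZMod.intCast_surjective) 0 fun z => ⟨0, ?_⟩
    ext i
    rw [smul_zero, Pi.zero_apply, ZMod.intCast_zmod_eq_zero_iff_dvd, ← hentry]
    have h1 := hc (Pi.single i 1) z
    rw [gram₂] at h1
    exact hpz.dvd_of_dvd_pow ((dvd_sub_right ((h0 _).mul_right _)).1 h1)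
  · push Not at h0
    obtain ⟨a, ha⟩ := h0
    have hp2 : ¬ (p : ℤ) ∣ 2 := fun h2 => ha <| by
      have h3 := Even.two_dvd (he a)
      have : p = 2 := (Nat.prime_dvd_prime_iff_eq hp Nat.prime_two).1 (by exact_mod_cast h2)
      rw [this, Matrix.toBilin'_apply']
      exact_mod_cast h3
    have key : ∀ b z, (p : ℤ) ∣ Matrix.toBilin' G a a * Matrix.toBilin' G b z -
        Matrix.toBilin' G a z * Matrix.toBilin' G a b := fun b z => by
      have h1 := hc a (b + z)
      have h2 := hc a b
      have h3 := hc a z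
      simp only [gram₂, map_add, LinearMap.add_apply, hs z b] at h1 h2 h3
      refine (hpz.dvd_or_dvd ?_).resolve_left hp2
      have h4 := dvd_sub (dvd_sub h1 h2) h3
      convert h4 using 1
      ring
    have haK : ((Matrix.toBilin' G a a : ℤ) : ZMod p) ≠ 0 := by
      rwa [Ne, ZMod.intCast_zmod_eq_zero_iff_dvd]
    refine h.lt_of_rank_le_one (K := ZMod p) (ZMod.intCast_surjective)
      (fun i => ((G *ᵥ a) i : ZMod p)) fun z =>
      ⟨((Matrix.toBilin' G a a : ℤ) : ZMod p)⁻¹ * (Matrix.toBilin' G a z : ℤ), ?_⟩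
    ext i
    have h1 := (ZMod.intCast_zmod_eq_zero_iff_dvd _ p).2 (key (Pi.single i 1) z)
    rw [hs a (Pi.single i 1), hentry, hentry] at h1
    push_cast at h1
    rw [Pi.smul_apply, smul_eq_mul, mul_assoc, eq_inv_mul_iff_mul_eq₀ haK]
    linear_combination h1

end Generators

section Main

variable {n : ℕ} {G G' : Matrix (Fin n) (Fin n) ℤ} {p q : ℕ}

lemma exists_toBilin_dual_vector (f : (Fin n → ℤ) →ₗ[ℤ] ℤ) :
    ∃ y, ∀ z, Matrix.toBilin' G z y = (2 * G.det.natAbs : ℕ) * f z := by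
  let v : Fin n → ℤ := fun i => f (Pi.single i 1)
  have hv : ∀ z, f z = z ⬝ᵥ v := fun z => by
    conv_lhs => rw [pi_eq_sum_univ' z]
    rw [map_sum]
    refine Finset.sum_congr rfl fun i _ => ?_
    rw [map_smul, smul_eq_mul]
  have h1 : ∀ z, Matrix.toBilin' G z (G.adjugate *ᵥ v) = G.det * f z := fun z => by
    rw [Matrix.toBilin'_apply', mulVec_mulVec, mul_adjugate, smul_mulVec, one_mulVec,
      dotProduct_smul, hv, smul_eq_mul]
  obtain ⟨ε, hε⟩ : ∃ ε : ℤ, (G.det.natAbs : ℤ) = ε * G.det := by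
    rcases Int.natAbs_eq G.det with h | h
    · exact ⟨1, by omega⟩
    · exact ⟨-1, by omega⟩
  refine ⟨(2 * ε) • G.adjugate *ᵥ v, fun z => ?_⟩
  rw [map_smul, h1, smul_eq_mul]
  push_cast
  rw [Int.natCast_natAbs] at hε
  rw [hε]
  ring

lemma isIndefinite_toBilin' (hG : Gᵀ = G) (hd : G.det ≠ 0) (he : ∀ x, Even (x ⬝ᵥ G *ᵥ x))
    (hs : HasSignature G p q) (hp : 0 < p) (hq : 0 < q) :
    IsIndefinite (Matrix.toBilin' G) (2 * G.det.natAbs) where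
  symm := (toBilin'_isSymm hG).eq
  even x := by rw [Matrix.toBilin'_apply']; exact he x
  ne_zero := mul_ne_zero two_ne_zero (Int.natAbs_ne_zero.2 hd)
  two_dvd := dvd_mul_right _ _
  dual := exists_toBilin_dual_vector
  pos := by
    obtain ⟨z, hz⟩ := exists_int_pos (hs.exists_of_pos hp)
    exact ⟨z, by rwa [Matrix.toBilin'_apply']⟩
  neg := by
    obtain ⟨z, hz⟩ := exists_int_pos (hs.neg.exists_of_pos hq)
    rw [neg_mulVec, dotProduct_neg] at hz
    exact ⟨z, by rw [Matrix.toBilin'_apply']; omega⟩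

lemma metabolic_of_isUnit_det (hG : Gᵀ = G) (hd : IsUnit G.det) (hs : HasSignature G p p) :
    Metabolic (ratForm G) := by
  obtain ⟨P, f, hP, hf⟩ := exists_congr_diagonal (G.map (Int.cast : ℤ → ℚ))
    (by rw [← transpose_map, hG])
  have i := (isom_diagForm_toBilin' f).trans (isom_of_congr hP hf)
  refine i.metabolic (met_of_sum_of_eq_zero _ (WittQ.eq_zero_of_unramified ?_ fun l hl => ?_))
  · rw [map_sum]
    simp only [WittQ.sig_of]
    rw [sum_sign_of_hasSignature hs hP hf, sub_self]
  · refine unramified_of_isom hl (fun hdvd => ?_) i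
    exact hl.one_lt.ne' (by
      have := isUnit_of_dvd_unit hdvd hd
      rwa [Int.isUnit_iff_natAbs_eq, Int.natAbs_natCast] at this)

theorem intIsom_addHyps_of_discGroup (hG : Gᵀ = G) (hG' : G'ᵀ = G') (hd : G.det ≠ 0)
    (hd' : G'.det ≠ 0) (he : ∀ u, Even (u ⬝ᵥ G *ᵥ u)) (he' : ∀ u, Even (u ⬝ᵥ G' *ᵥ u))
    (hs : HasSignature G p q) (hs' : HasSignature G' p q)
    (hB : (addHyps (Matrix.toBilin' G) n).Nondegenerate)
    (hB' : (addHyps (Matrix.toBilin' G') n).Nondegenerate) (φ : DiscGroup G ≃+ DiscGroup G')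
    (hφ : ∀ u u' : Fin n → ℤ, φ (discMk G u) = discMk G' u' → discQuad G' u' = discQuad G u) :
    IntIsom (addHyps (Matrix.toBilin' G) n) (addHyps (Matrix.toBilin' G') n) :=
  IntIsom.of_embeddings hB hB' (exists_isometric_addHyps hG hG' hd hd' he' hs hs' φ hφ)
    (exists_isometric_addHyps hG' hG hd' hd he hs' hs φ.symm fun u' u h =>
      (hφ u u' (by rw [← h, AddEquiv.apply_symm_apply])).symm)

end Main

/-- Kneser–Nikulin uniqueness, even case: Let `L = ℤⁿ` (of rank `r = n`)
be an even indefinite lattice with symmetric Gram matrix `G` whose discriminant group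
can be generated by at most `r − 2` elements.  Then every even lattice `L'` of rank `r`
with the same signature as `L` admitting a group isomorphism `A(L) → A(L')` preserving
the discriminant quadratic forms is isometric to `L`. -/
theorem even_indefinite_lattice_unique_in_genus
    {n : ℕ} (G : Matrix (Fin n) (Fin n) ℤ)
    (hsymm : G.transpose = G)
    (hdet : G.det ≠ 0)
    (heven : ∀ x : Fin n → ℤ, Even (x ⬝ᵥ G.mulVec x))
    (hindef : (∃ x : Fin n → ℝ, 0 < x ⬝ᵥ (G.map (Int.cast : ℤ → ℝ)).mulVec x) ∧
      (∃ y : Fin n → ℝ, y ⬝ᵥ (G.map (Int.cast : ℤ → ℝ)).mulVec y < 0))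
    (hgen : ∃ s : Fin (n - 2) → DiscGroup G, Submodule.span ℤ (Set.range s) = ⊤) :
    ∀ G' : Matrix (Fin n) (Fin n) ℤ,
      G'.transpose = G' →
      G'.det ≠ 0 →
      (∀ x : Fin n → ℤ, Even (x ⬝ᵥ G'.mulVec x)) →
      (∃ p q : ℕ, HasSignature G p q ∧ HasSignature G' p q) →
      (∃ φ : DiscGroup G ≃+ DiscGroup G',
        ∀ (u : Fin n → ℤ) (u' : Fin n → ℤ),
          φ (discMk G u) = discMk G' u' → discQuad G' u' = discQuad G u) →
      ∃ e : (Fin n → ℤ) ≃ₗ[ℤ] (Fin n → ℤ), ∀ x y : Fin n → ℤ,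
        x ⬝ᵥ G'.mulVec y = (e x) ⬝ᵥ G.mulVec (e y) := by
  intro G' hsymm' hdet' heven' ⟨p, q, hs, hs'⟩ ⟨φ, hφ⟩
  have hp : 0 < p := hs.pos_of_exists hindef.1
  have hq : 0 < q := hs.neg.pos_of_exists (by
    obtain ⟨y, hy⟩ := hindef.2
    exact ⟨y, by rw [map_neg_cast, neg_mulVec, dotProduct_neg]; exact neg_pos.2 hy⟩)
  have hn := hs.add_eq
  have hg := discGenerated_of_span hgen
  have hg' := hg.map φ
  suffices h : IntIsom (Matrix.toBilin' G') (Matrix.toBilin' G) by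
    obtain ⟨e, he⟩ := h
    exact ⟨e, fun x y => by
      rw [← Matrix.toBilin'_apply', ← Matrix.toBilin'_apply', he]⟩
  have h23 : n = 2 ∨ 3 ≤ n := by omega
  rcases h23 with h2 | h3
  · subst h2
    have hp1 : p = 1 := by omega
    have hq1 : q = 1 := by omega
    subst hp1 hq1
    have hu := DiscGenerated.isUnit_det hg
    have hu' := DiscGenerated.isUnit_det hg'
    exact (intIsom_hypForm_of_metabolic (n := 1) hsymm' hu' heven'
      (metabolic_of_isUnit_det hsymm' hu' hs') (by simp)).trans
      (intIsom_hypForm_of_metabolic hsymm hu heven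
        (metabolic_of_isUnit_det hsymm hu hs) (by simp)).symm
  · have hB := isIndefinite_toBilin' hsymm hdet heven hs hp hq
    have hB' := isIndefinite_toBilin' hsymm' hdet' heven' hs' hp hq
    have hk : n = 0 → ∀ A : Prop, A := fun h _ => absurd h (by omega)
    have hst := intIsom_addHyps_of_discGroup hsymm hsymm' hdet hdet' heven heven' hs hs'
      (hB.isAdmissible_addHyps (k := n) (by rw [Module.finrank_fin_fun]; omega)
        fun h => hk h _).nondegenerate
      (hB'.isAdmissible_addHyps (k := n) (by rw [Module.finrank_fin_fun]; omega)
        fun h => hk h _).nondegenerate φ hφ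
    have hc := hB.cancel_addHyps (k := 0) (j := n) hB' (by rwa [zero_add])
      (by rw [Module.finrank_fin_fun]; omega) (by rw [Module.finrank_fin_fun]; omega)
      (fun _ l hl _ => hg.exists_not_dvd_gram₂ (by omega) hsymm heven hl)
      (fun _ l hl _ => hg'.exists_not_dvd_gram₂ (by omega) hsymm' heven' hl)
    exact ((intIsom_addHyps_zero _).symm.trans (hc.trans (intIsom_addHyps_zero _))).symm
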